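/- Let n ≥ 1 and let a_i, b_i (for 1 ≤ i ≤ n) and c_{ij} (for 1 ≤ i < j ≤ n) be integers such that the function F(t_1,…,t_n) = (∏_{i=1}^n t_i^{a_i}(1−t_i)^{b_i}) / (∏_{1≤i<j≤n} (t_j−t_i)^{c_{ij}}) is absolutely integrable on the open simplex Δ = {(t_1,…,t_n) : 0 < t_1 < ⋯ < t_n < 1}. Then the integral ∫_Δ F(t_1,…,t_n) dt_1⋯dt_n belongs to the ℚ-linear span (inside ℝ) of the set consisting of 1 together with all multiple zeta values ζ(n_1,…,n_r). -/

import Mathlib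

open MeasureTheory

/-- The multiple zeta value ζ(n₁,…,n_r) = Σ_{0<k₁<…<k_r} ∏ᵢ 1/kᵢ^{nᵢ}. -/
noncomputable def mzv {r : ℕ} (n : Fin r → ℕ) : ℝ :=
  ∑' k : {k : Fin r → ℕ // StrictMono k ∧ ∀ i, 0 < k i}, ∏ i, (1 : ℝ) / (k.1 i : ℝ) ^ (n i)

/-- The set of all multiple zeta values ζ(n₁,…,n_r) with r ≥ 1, nᵢ ≥ 1 and n_r ≥ 2. -/
def mzvSet : Set ℝ :=
  {x | ∃ (r : ℕ) (n : Fin (r + 1) → ℕ),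
    (∀ i, 1 ≤ n i) ∧ 2 ≤ n (Fin.last r) ∧ x = mzv n}

/-- The open simplex 0 < t₁ < ⋯ < t_n < 1. -/
def openSimplex (n : ℕ) : Set (Fin n → ℝ) :=
  {t | (∀ i, 0 < t i ∧ t i < 1) ∧ ∀ i j : Fin n, i < j → t i < t j}

open MeasureTheory

/-! ## Coefficients of hyperlogarithms -/

/-- One step of iterated integration on power series coefficients. -/
noncomputable def opA (a : Option ℝ) (c : ℕ → ℝ) (N : ℕ) : ℝ :=
  match a with
  | none => c N / N
  | some r => (∑ M ∈ Finset.range N, r ^ (N - M) * c M) / N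

/-- Coefficients of the hyperlogarithm attached to a word. -/
noncomputable def hA : List (Option ℝ) → ℕ → ℝ
  | [] => fun N => if N = 0 then 1 else 0
  | a :: w => opA a (hA w)

/-- The hyperlogarithm attached to a word. -/
noncomputable def hL (w : List (Option ℝ)) (x : ℝ) : ℝ := ∑' N, hA w N * x ^ N

/-- The value at one. -/
noncomputable def hZ (w : List (Option ℝ)) : ℝ := ∑' N, hA w N

/-- The kernel attached to a letter. -/
noncomputable def kf (a : Option ℝ) (x : ℝ) : ℝ :=
  match a with
  | none => x⁻¹
  | some r => r * (1 - r * x)⁻¹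

/-- Words not ending with the letter zero. -/
def Vld {α : Type} : List (Option α) → Prop
  | [] => True
  | a :: w => (w = [] → a ≠ none) ∧ Vld w

/-- Words with letters in the unit interval. -/
def Gd (w : List (Option ℝ)) : Prop := ∀ r, some r ∈ w → 0 ≤ r ∧ r ≤ 1

lemma Gd.tail {a : Option ℝ} {w} (h : Gd (a :: w)) : Gd w :=
  fun r hr => h r (List.mem_cons_of_mem _ hr)

lemma Gd.nil : Gd [] := fun r hr => by simp at hr

lemma hA_zero (a : Option ℝ) (w) : hA (a :: w) 0 = 0 := by
  cases a <;> simp [hA, opA]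

lemma hA_bd : ∀ (w) (_ : Gd w) (N : ℕ), 0 ≤ hA w N ∧ hA w N ≤ 1
  | [], _, N => by
      simp only [hA]; split_ifs <;> simp
  | none :: w, h, N => by
      have ih := hA_bd w h.tail N
      simp only [hA, opA]
      refine ⟨div_nonneg ih.1 (by positivity), ?_⟩
      rcases Nat.eq_zero_or_pos N with rfl | hN
      · simp
      · have : (1:ℝ) ≤ N := by exact_mod_cast hN
        rw [div_le_one (by positivity)]; linarith
  | some r :: w, h, N => by
      have ih := hA_bd w h.tail
      have hr := h r (by simp)
      simp only [hA, opA]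
      refine ⟨div_nonneg (Finset.sum_nonneg fun M _ => mul_nonneg (pow_nonneg hr.1 _) (ih M).1)
        (by positivity), ?_⟩
      rcases Nat.eq_zero_or_pos N with rfl | hN
      · simp
      · rw [div_le_one (by positivity)]
        calc _ ≤ ∑ M ∈ Finset.range N, (1:ℝ) := Finset.sum_le_sum fun M _ =>
              mul_le_one₀ (pow_le_one₀ hr.1 hr.2) (ih M).1 (ih M).2
          _ = N := by simp

lemma sum_inv_sqrt' (N : ℕ) : ∑ M ∈ Finset.range (N+1), 1 / √(M:ℝ) ≤ 2 * √(N:ℝ) := by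
  induction N with
  | zero => simp
  | succ n ih =>
    rw [Finset.sum_range_succ]
    push_cast
    have h1 : 0 < √((n:ℝ)+1) := Real.sqrt_pos.2 (by positivity)
    have h2 : √(n:ℝ) * √(n:ℝ) = n := Real.mul_self_sqrt (by positivity)
    have h3 : √((n:ℝ)+1) * √((n:ℝ)+1) = n + 1 := Real.mul_self_sqrt (by positivity)
    have : 1 / √((n:ℝ)+1) ≤ 2 * (√((n:ℝ)+1) - √(n:ℝ)) := by
      rw [div_le_iff₀ h1]
      nlinarith [sq_nonneg (√((n:ℝ)+1) - √(n:ℝ))]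
    linarith

lemma sum_inv_sqrt (N : ℕ) : ∑ M ∈ Finset.range N, 1 / √(M:ℝ) ≤ 2 * √(N:ℝ) := by
  cases N with
  | zero => simp
  | succ n =>
    refine (sum_inv_sqrt' n).trans ?_
    gcongr; simp

lemma hA_sqrt : ∀ (a : Option ℝ) (w) (_ : Gd (a :: w)),
    ∃ K : ℝ, 0 ≤ K ∧ ∀ N : ℕ, hA (a :: w) N ≤ K / √(N:ℝ)
  | a, [], h => by
      refine ⟨1, zero_le_one, fun N => ?_⟩
      rcases Nat.eq_zero_or_pos N with rfl | hN
      · simp [hA_zero]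
      have h1 : (1:ℝ) ≤ N := by exact_mod_cast hN
      have h2 : 1 / (N:ℝ) ≤ 1 / √(N:ℝ) := by
        apply one_div_le_one_div_of_le (Real.sqrt_pos.2 (by positivity))
        rw [Real.sqrt_le_left (by positivity)]; nlinarith
      refine le_trans ?_ h2
      cases a with
      | none => simp [hA, opA, hN.ne']
      | some r =>
        have hr := h r (by simp)
        simp only [hA, opA]
        gcongr
        rw [Finset.sum_eq_single 0] 
        · simpa using pow_le_one₀ hr.1 hr.2
        · intro b _ hb; simp [hb]
        · intro h; simp at h; omega
  | a, b :: w, h => by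
      obtain ⟨K, hK, ih⟩ := hA_sqrt b w h.tail
      have bd := hA_bd _ h.tail
      cases a with
      | none =>
        refine ⟨K, hK, fun N => le_trans ?_ (ih N)⟩
        rcases Nat.eq_zero_or_pos N with rfl | hN
        · simp [hA_zero]
        have h1 : (1:ℝ) ≤ N := by exact_mod_cast hN
        show hA (b :: w) N / N ≤ _
        exact div_le_self (bd N).1 h1
      | some r =>
        have hr := h r (by simp)
        refine ⟨2 * K, by positivity, fun N => ?_⟩
        rcases Nat.eq_zero_or_pos N with rfl | hN
        · simp [hA_zero]
        have h1 : (0:ℝ) < N := by exact_mod_cast hN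
        show (∑ M ∈ Finset.range N, r ^ (N - M) * hA (b :: w) M) / N ≤ _
        have : ∑ M ∈ Finset.range N, r ^ (N - M) * hA (b :: w) M ≤ K * (2 * √(N:ℝ)) := by
          refine le_trans ?_ (mul_le_mul_of_nonneg_left (sum_inv_sqrt N) hK)
          rw [Finset.mul_sum]
          refine Finset.sum_le_sum fun M _ => ?_
          calc _ ≤ 1 * hA (b :: w) M :=
                mul_le_mul_of_nonneg_right (pow_le_one₀ hr.1 hr.2) (bd M).1
            _ ≤ _ := by rw [one_mul, mul_one_div]; exact ih M
        rw [div_le_div_iff₀ h1 (Real.sqrt_pos.2 h1)]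
        calc _ ≤ K * (2 * √(N:ℝ)) * √(N:ℝ) := by gcongr
          _ = 2 * K * N := by
            rw [mul_assoc, mul_assoc, Real.mul_self_sqrt h1.le]; ring

lemma hA_tendsto (a : Option ℝ) (w) (h : Gd (a :: w)) :
    Filter.Tendsto (hA (a :: w)) Filter.atTop (nhds 0) := by
  obtain ⟨K, _, hb⟩ := hA_sqrt a w h
  refine squeeze_zero (fun N => (hA_bd _ h N).1) hb ?_
  exact Filter.Tendsto.const_div_atTop (Real.tendsto_sqrt_atTop.comp tendsto_natCast_atTop_atTop) K

lemma summable_hA_div (w) (h : Gd w) : Summable fun N : ℕ => hA w N / (N:ℝ) := by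
  cases w with
  | nil =>
    apply summable_of_ne_finset_zero (s := {0})
    intro b hb; simp at hb; simp [hA, hb]
  | cons a w =>
    obtain ⟨K, hK, hb⟩ := hA_sqrt a w h
    have h1 : Summable fun N : ℕ => K * (1 / (N:ℝ) ^ (3/2 : ℝ)) :=
      (Real.summable_one_div_nat_rpow.2 (by norm_num)).mul_left K
    refine Summable.of_nonneg_of_le
      (fun N => div_nonneg (hA_bd _ h N).1 (by positivity)) (fun N => ?_) h1
    rcases Nat.eq_zero_or_pos N with rfl | hN
    · simp
    have h1 : (0:ℝ) < N := by exact_mod_cast hN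
    have : (N:ℝ) ^ (3/2:ℝ) = √(N:ℝ) * N := by
      rw [Real.sqrt_eq_rpow]
      nth_rewrite 3 [← Real.rpow_one (N:ℝ)]
      rw [← Real.rpow_add h1]; norm_num
    rw [this, mul_one_div, ← div_div]
    gcongr
    exact hb N

/-- Words whose outermost letter is not one. -/
def Cv (w : List (Option ℝ)) : Prop := w.head? ≠ some (some 1)

lemma summable_hA (w) (h : Gd w) (hc : Cv w) : Summable (hA w) := by
  match w, h, hc with
  | [], _, _ =>
    apply summable_of_ne_finset_zero (s := {0})
    intro b hb; simp at hb; simp [hA, hb]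
  | none :: w, h, _ => exact summable_hA_div w h.tail
  | some r :: w, h, hc =>
    have hr := h r (by simp)
    have hr1 : r < 1 := lt_of_le_of_ne hr.2 (by rintro rfl; simp [Cv] at hc)
    have bd := hA_bd w h.tail
    have s1 : Summable fun M : ℕ => hA w M / ((M:ℝ) + 1) := by
      refine Summable.of_nonneg_of_le (fun N => div_nonneg (bd N).1 (by positivity)) (fun N => ?_)
        ((summable_hA_div w h.tail).add (summable_of_ne_finset_zero (s := {0}) (f := fun N : ℕ => if N = 0 then (1:ℝ) else 0)
          (by intro b hb; simp at hb; simp [hb])))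
      rcases Nat.eq_zero_or_pos N with rfl | hN
      · simpa using (bd 0).2
      have h1 : (0:ℝ) < N := by exact_mod_cast hN
      simp [hN.ne']
      gcongr
      · exact (bd N).1
      · linarith
    have s2 : Summable fun M : ℕ => r ^ M := summable_geometric_of_lt_one hr.1 hr1
    have s3 := summable_norm_sum_mul_antidiagonal_of_summable_norm s2.norm s1.norm
    have s4 := s3.of_norm
    refine Summable.of_nonneg_of_le (fun N => (hA_bd _ h N).1) (fun N => ?_) s4
    rw [Finset.Nat.sum_antidiagonal_eq_sum_range_succ_mk, ← Finset.sum_range_reflect,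
       Finset.sum_range_succ]
    show (∑ M ∈ Finset.range N, r ^ (N - M) * hA w M) / N ≤ _
    rw [Finset.sum_div]
    have : ∑ M ∈ Finset.range N, r ^ (N - M) * hA w M / N ≤
      ∑ j ∈ Finset.range N, r ^ (N + 1 - 1 - j) * (hA w (N - (N + 1 - 1 - j)) / (((N - (N + 1 - 1 - j) : ℕ):ℝ) + 1)) := by
      refine Finset.sum_le_sum fun M hM => ?_
      rw [Finset.mem_range] at hM
      have e : N - (N + 1 - 1 - M) = M := by omega
      rw [e, mul_div_assoc]
      simp only [Nat.add_sub_cancel]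
      refine mul_le_mul_of_nonneg_left ?_ (pow_nonneg hr.1 _)
      refine div_le_div_of_nonneg_left (bd M).1 (by positivity) ?_
      exact_mod_cast hM
    refine this.trans (le_add_of_nonneg_right ?_)
    have := (bd (N - (N + 1 - 1 - N))).1
    have := pow_nonneg hr.1 (N + 1 - 1 - N)
    positivity

lemma hA_term_le (w) (h : Gd w) (N : ℕ) {x y : ℝ} (hx : |x| ≤ y) :
    ‖hA w N * x ^ N‖ ≤ y ^ N := by
  rw [norm_mul, norm_pow, Real.norm_eq_abs, Real.norm_eq_abs, abs_of_nonneg (hA_bd w h N).1]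
  calc _ ≤ 1 * |x| ^ N := by gcongr; exact (hA_bd w h N).2
    _ ≤ y ^ N := by rw [one_mul]; gcongr

lemma summable_hL (w) (h : Gd w) {x : ℝ} (hx : |x| < 1) : Summable fun N => ‖hA w N * x ^ N‖ :=
  Summable.of_nonneg_of_le (fun _ => norm_nonneg _) (fun N => hA_term_le w h N le_rfl)
    (summable_geometric_of_lt_one (abs_nonneg x) hx)

lemma hL_zero_cons (a : Option ℝ) (w) : hL (a :: w) 0 = 0 := by
  unfold hL
  rw [tsum_eq_single 0]
  · simp [hA_zero]
  · intro b hb; simp [hb]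

lemma hL_nil (x : ℝ) : hL [] x = 1 := by
  unfold hL
  rw [tsum_eq_single 0]
  · simp [hA]
  · intro b hb; simp [hA, hb]

lemma hL_tendsto (w) (h : Gd w) (hc : Cv w) :
    Filter.Tendsto (hL w) (nhdsWithin 1 (Set.Iio 1)) (nhds (hZ w)) := by
  have := (summable_hA w h hc).hasSum.tendsto_sum_nat
  exact Real.tendsto_tsum_powerSeries_nhdsWithin_lt this

open MeasureTheory

lemma hL_hasDerivAt_raw (w) (h : Gd w) {x : ℝ} (hx : |x| < 1) :
    HasDerivAt (hL w) (∑' N : ℕ, hA w N * (N * x ^ (N - 1))) x := by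
  obtain ⟨r, hr1, hr2⟩ := exists_between hx
  have hr0 : 0 < r := lt_of_le_of_lt (abs_nonneg x) hr1
  have su : Summable fun N : ℕ => (N:ℝ) * r ^ (N - 1) := by
    have := summable_pow_mul_geometric_of_norm_lt_one 1 (r := r) (by rw [Real.norm_eq_abs, abs_of_pos hr0]; exact hr2)
    have h2 := this.mul_right r⁻¹
    refine h2.congr fun N => ?_
    cases N with
    | zero => simp
    | succ n => simp; field_simp; ring
  refine hasDerivAt_tsum_of_isPreconnected (g := fun N y => hA w N * y ^ N)
    (g' := fun N y => hA w N * (N * y ^ (N - 1))) (t := Metric.ball (0:ℝ) r) (y₀ := 0) su Metric.isOpen_ball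
    (convex_ball _ _).isPreconnected (fun N y _ => ?_) (fun N y hy => ?_) (by simp [hr0]) ?_ ?_
  · exact (hasDerivAt_pow N y).const_mul _
  · rw [mem_ball_zero_iff, Real.norm_eq_abs] at hy
    rw [norm_mul, norm_mul, norm_pow, Real.norm_eq_abs, abs_of_nonneg (hA_bd w h N).1, Real.norm_natCast, Real.norm_eq_abs]
    calc _ ≤ 1 * ((N:ℝ) * r ^ (N-1)) := by
          gcongr
          exact (hA_bd w h N).2
      _ = _ := one_mul _
  · exact (summable_hL w h (x := 0) (by simp)).of_norm
  · simpa using hr1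

lemma hL_continuousAt (w) (h : Gd w) {x : ℝ} (hx : |x| < 1) : ContinuousAt (hL w) x :=
  (hL_hasDerivAt_raw w h hx).continuousAt

lemma conv_id (r x : ℝ) (w) (N : ℕ) :
    r * ∑ kl ∈ Finset.HasAntidiagonal.antidiagonal N, (r * x) ^ kl.1 * (hA w kl.2 * x ^ kl.2) =
    hA (some r :: w) (N + 1) * (((N + 1 : ℕ) : ℝ) * x ^ (N + 1 - 1)) := by
  have h1 : ((N + 1 : ℕ) : ℝ) ≠ 0 := by positivity
  simp only [hA, opA, Nat.add_sub_cancel]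
  rw [div_mul_eq_mul_div, mul_left_comm, mul_div_cancel_left₀ _ h1,
    Finset.Nat.sum_antidiagonal_eq_sum_range_succ_mk, ← Finset.sum_range_reflect, Finset.mul_sum,
    Finset.sum_mul]
  refine Finset.sum_congr rfl fun M hM => ?_
  rw [Finset.mem_range] at hM
  simp only [Nat.succ_sub_one]
  have e1 : N - (N - M) = M := by omega
  have e2 : N + 1 - M = (N - M) + 1 := by omega
  have e3 : x ^ N = x ^ (N - M) * x ^ M := by rw [← pow_add]; congr 1; omega
  rw [e1, e2, e3, mul_pow]
  ring

lemma hL_hasDerivAt (a : Option ℝ) (w) (h : Gd (a :: w)) (hv : Vld (a :: w)) {x : ℝ}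
    (hx0 : 0 < x) (hx : x < 1) : HasDerivAt (hL (a :: w)) (kf a x * hL w x) x := by
  have hx' : |x| < 1 := by rw [abs_of_pos hx0]; exact hx
  convert hL_hasDerivAt_raw _ h hx' using 1
  cases a with
  | none =>
    have hw : w ≠ [] := fun e => hv.1 e rfl
    have h0 : hA w 0 = 0 := by
      cases w with
      | nil => exact absurd rfl hw
      | cons b w => exact hA_zero b w
    unfold hL kf
    rw [← tsum_mul_left]
    refine tsum_congr fun N => ?_
    rcases Nat.eq_zero_or_pos N with rfl | hN
    · simp [h0]
    have h1 : (0:ℝ) < N := by exact_mod_cast hN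
    simp only [hA, opA]
    obtain ⟨n, rfl⟩ : ∃ n, N = n + 1 := ⟨N - 1, by omega⟩
    simp only [Nat.add_sub_cancel]
    field_simp
    ring
  | some r =>
    have hr := h r (by simp)
    have hrx : r * x < 1 := by nlinarith
    have hrx0 : 0 ≤ r * x := mul_nonneg hr.1 hx0.le
    have g := tsum_geometric_of_lt_one hrx0 hrx
    unfold kf hL
    simp only
    rw [← g, mul_assoc, tsum_mul_tsum_eq_tsum_sum_antidiagonal_of_summable_norm
      (summable_geometric_of_lt_one hrx0 hrx).norm (summable_hL w h.tail hx'), ← tsum_mul_left]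
    have s1 : Summable fun N : ℕ => hA (some r :: w) N * (N * x ^ (N - 1)) := by
      have := summable_norm_sum_mul_antidiagonal_of_summable_norm
       (summable_geometric_of_lt_one hrx0 hrx).norm (summable_hL w h.tail hx')
      have := this.of_norm.mul_left r
      rw [← summable_nat_add_iff 1]
      refine this.congr fun N => ?_
      exact conv_id r x w N
    rw [s1.tsum_eq_zero_add]
    simp only [hA_zero, zero_mul, zero_add]
    refine tsum_congr fun N => ?_
    exact conv_id r x w N

/-- All shuffles of two words. -/
def shf {α : Type} : List α → List α → List (List α)
  | [], v => [v]
  | u, [] => [u]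
  | a :: u, b :: v => (shf u (b :: v)).map (a :: ·) ++ (shf (a :: u) v).map (b :: ·)
termination_by u v => u.length + v.length

lemma shf_nil_right {α : Type} (u : List α) : shf u [] = [u] := by
  cases u <;> simp [shf]

lemma shf_map {α β : Type} (f : α → β) : ∀ (u v : List α),
    shf (u.map f) (v.map f) = (shf u v).map (List.map f)
  | [], v => by simp [shf]
  | a :: u, [] => by simp [shf]
  | a :: u, b :: v => by
    have h1 := shf_map f u (b :: v)
    have h2 := shf_map f (a :: u) v
    simp only [List.map_cons] at h1 h2 ⊢
    rw [shf, h1, h2, shf]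
    simp [Function.comp_def]
termination_by u v => u.length + v.length

lemma shf_mem {α : Type} : ∀ (u v : List α) (w) (_ : w ∈ shf u v) (x : α), x ∈ w → x ∈ u ∨ x ∈ v
  | [], v, w, hw, x, hx => by simp [shf] at hw; subst hw; exact Or.inr hx
  | a :: u, [], w, hw, x, hx => by simp [shf] at hw; subst hw; exact Or.inl hx
  | a :: u, b :: v, w, hw, x, hx => by
    rw [shf, List.mem_append, List.mem_map, List.mem_map] at hw
    rcases hw with ⟨w', hw', rfl⟩ | ⟨w', hw', rfl⟩
    · have := shf_mem u (b :: v) w' hw' x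
      simp only [List.mem_cons] at hx this ⊢; tauto
    · have := shf_mem (a :: u) v w' hw' x
      simp only [List.mem_cons] at hx this ⊢; tauto
termination_by u v => u.length + v.length

lemma shf_length {α : Type} : ∀ (u v : List α) (w) (_ : w ∈ shf u v), w.length = u.length + v.length
  | [], v, w, hw => by simp [shf] at hw; subst hw; simp
  | a :: u, [], w, hw => by simp [shf] at hw; subst hw; simp
  | a :: u, b :: v, w, hw => by
    rw [shf, List.mem_append, List.mem_map, List.mem_map] at hw
    rcases hw with ⟨w', hw', rfl⟩ | ⟨w', hw', rfl⟩
    · have := shf_length u (b :: v) w' hw'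
      simp at this ⊢; omega
    · have := shf_length (a :: u) v w' hw'
      simp at this ⊢; omega
termination_by u v => u.length + v.length

lemma shf_vld {α : Type} : ∀ (u v : List (Option α)) (_ : Vld u) (_ : Vld v) (w) (_ : w ∈ shf u v), Vld w
  | [], v, _, hv, w, hw => by simp [shf] at hw; subst hw; exact hv
  | a :: u, [], hu, _, w, hw => by simp [shf] at hw; subst hw; exact hu
  | a :: u, b :: v, hu, hv, w, hw => by
    rw [shf, List.mem_append, List.mem_map, List.mem_map] at hw
    rcases hw with ⟨w', hw', rfl⟩ | ⟨w', hw', rfl⟩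
    · have h1 := shf_vld u (b :: v) hu.2 hv w' hw'
      have h2 := shf_length u (b :: v) w' hw'
      exact ⟨fun e => by simp [e] at h2, h1⟩
    · have h1 := shf_vld (a :: u) v hu hv.2 w' hw'
      have h2 := shf_length (a :: u) v w' hw'
      exact ⟨fun e => by simp [e] at h2; omega, h1⟩
termination_by u v => u.length + v.length

lemma shf_head {α : Type} (u v : List α) (w) (hw : w ∈ shf u v) :
    w.head? = u.head? ∨ w.head? = v.head? := by
  match u, v, hw with
  | [], v, hw => simp [shf] at hw; subst hw; simp
  | a :: u, [], hw => simp [shf] at hw; subst hw; simp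
  | a :: u, b :: v, hw =>
    rw [shf, List.mem_append, List.mem_map, List.mem_map] at hw
    rcases hw with ⟨w', hw', rfl⟩ | ⟨w', hw', rfl⟩ <;> simp

lemma hasDerivAt_list_sum {β : Type} (l : List β) (f : β → ℝ → ℝ) (f' : β → ℝ) (x : ℝ)
    (h : ∀ b ∈ l, HasDerivAt (f b) (f' b) x) :
    HasDerivAt (fun y => (l.map fun b => f b y).sum) (l.map f').sum x := by
  induction l with
  | nil => simpa using hasDerivAt_const x (0:ℝ)
  | cons b l ih =>
    simp only [List.map_cons, List.sum_cons]
    exact (h b (by simp)).add (ih fun c hc => h c (by simp [hc]))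

lemma eq_of_deriv_eq_Ico {f g f' : ℝ → ℝ} (hf : ∀ x, 0 < x → x < 1 → HasDerivAt f (f' x) x)
    (hg : ∀ x, 0 < x → x < 1 → HasDerivAt g (f' x) x) (cf : ContinuousAt f 0) (cg : ContinuousAt g 0)
    (h0 : f 0 = g 0) {x : ℝ} (hx0 : 0 ≤ x) (hx : x < 1) : f x = g x := by
  rcases hx0.eq_or_lt with rfl | hx0
  · exact h0
  obtain ⟨c, hc, e⟩ := exists_hasDerivAt_eq_slope (fun y => f y - g y) (fun _ => 0) hx0
    (fun y hy => by
      rcases hy.1.eq_or_lt with rfl | hy0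
      · exact (cf.sub cg).continuousWithinAt
      · have hy1 := lt_of_le_of_lt hy.2 hx
        exact ((hf y hy0 hy1).continuousAt.sub (hg y hy0 hy1).continuousAt).continuousWithinAt)
    (fun y hy => by
      have hy1 := hy.2.trans hx
      have := (hf y hy.1 hy1).sub (hg y hy.1 hy1)
      rw [sub_self] at this
      exact this)
  simp only [h0, sub_self, sub_zero] at e
  have := (div_eq_zero_iff.1 e.symm).resolve_right hx0.ne'
  linarith

lemma hL_mul : ∀ (u v) (_ : Gd u) (_ : Gd v) (_ : Vld u) (_ : Vld v) {x : ℝ} (_ : 0 ≤ x) (_ : x < 1),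
    hL u x * hL v x = ((shf u v).map fun w => hL w x).sum
  | [], v, _, _, _, _, x, _, _ => by simp [shf, hL_nil]
  | a :: u, [], _, _, _, _, x, _, _ => by simp [shf, hL_nil]
  | a :: u, b :: v, gu, gv, hu, hv, x, hx0, hx => by
    have gs : ∀ w ∈ shf (a :: u) (b :: v), Gd w := fun w hw r hr =>
      (shf_mem _ _ w hw _ hr).elim (gu r) (gv r)
    have vs := shf_vld _ _ hu hv
    refine eq_of_deriv_eq_Ico (f := fun x => hL (a :: u) x * hL (b :: v) x)
      (g := fun x => ((shf (a :: u) (b :: v)).map fun w => hL w x).sum)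
      (f' := fun x => kf a x * hL u x * hL (b :: v) x + hL (a :: u) x * (kf b x * hL v x))
      ?_ ?_ ?_ ?_ ?_ hx0 hx
    · intro x hx0 hx
      exact (hL_hasDerivAt a u gu hu hx0 hx).mul (hL_hasDerivAt b v gv hv hx0 hx)
    · intro x hx0 hx
      have e1 := hL_mul u (b :: v) gu.tail gv hu.2 hv hx0.le hx
      have e2 := hL_mul (a :: u) v gu gv.tail hu hv.2 hx0.le hx
      have := hasDerivAt_list_sum (shf (a :: u) (b :: v)) hL
        (fun w => match w with | [] => 0 | c :: w => kf c x * hL w x) x (fun w hw => by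
          match w, hw with
          | [], hw => have := shf_length _ _ _ hw; simp at this
          | c :: w, hw => exact hL_hasDerivAt c w (gs _ hw) (vs _ hw) hx0 hx)
      convert this using 1
      rw [shf]
      simp only [List.map_append, List.map_map, List.sum_append, Function.comp_def]
      rw [List.sum_map_mul_left, List.sum_map_mul_left, ← e1, ← e2]
      ring
    · exact (hL_continuousAt _ gu (by simp)).mul (hL_continuousAt _ gv (by simp))
    · have : ∀ l : List (List (Option ℝ)), (∀ w ∈ l, Gd w) →
          ContinuousAt (fun x => (l.map fun w => hL w x).sum) 0 := by
        intro l
        induction l with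
        | nil => intro _; simpa using continuousAt_const
        | cons c l ih =>
          intro h
          simp only [List.map_cons, List.sum_cons]
          exact (hL_continuousAt _ (h c (by simp)) (by simp)).add (ih fun w hw => h w (by simp [hw]))
      exact this _ gs
    · simp only [hL_zero_cons, zero_mul]
      symm
      apply List.sum_eq_zero
      intro y hy
      rw [List.mem_map] at hy
      obtain ⟨w, hw, rfl⟩ := hy
      match w, hw with
      | [], hw => have := shf_length _ _ _ hw; simp at this
      | c :: w, hw => exact hL_zero_cons c w
termination_by u v => u.length + v.length

open MeasureTheory Filter Topology Asymptotics Polynomial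

/-! ## Asymptotic expansions -/
lemma derivCongr {f g : ℝ → ℝ} {a b x : ℝ} (h : HasDerivAt f a x) (h1 : ∀ y, g y = f y) (h2 : b = a) :
    HasDerivAt g b x := by
  rw [h2, show g = f from funext h1]; exact h

section expn
variable {P : Type} (C : Subalgebra ℚ (P → ℝ))

/-- Functions of the parameters. -/
def parSet : Set (P → ℝ → ℝ) := {f | ∃ c ∈ C, f = fun p _ => c p}

/-- Laurent polynomials in `u` with coefficients in `C`. -/
noncomputable def T0 : Subalgebra ℚ (P → ℝ → ℝ) :=
  Algebra.adjoin ℚ (parSet C ∪ {(fun _ u => u), (fun _ u => u⁻¹)})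

/-- Laurent polynomials in `u` and `log u` with coefficients in `C`. -/
noncomputable def T1 : Subalgebra ℚ (P → ℝ → ℝ) :=
  Algebra.adjoin ℚ (parSet C ∪ {(fun _ u => u), (fun _ u => u⁻¹), (fun _ u => Real.log u)})

lemma T0_le_T1 : T0 C ≤ T1 C := by
  apply Algebra.adjoin_mono
  intro f hf
  simp only [Set.mem_union, Set.mem_insert_iff, Set.mem_singleton_iff] at hf ⊢
  tauto

variable {C}
lemma T0_const {c : P → ℝ} (hc : c ∈ C) : (fun p _ => c p) ∈ T0 C :=
  Algebra.subset_adjoin (Or.inl ⟨c, hc, rfl⟩)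
lemma T0_u : (fun _ u => u : P → ℝ → ℝ) ∈ T0 C :=
  Algebra.subset_adjoin (Or.inr (by simp))
lemma T0_inv : (fun _ u => u⁻¹ : P → ℝ → ℝ) ∈ T0 C :=
  Algebra.subset_adjoin (Or.inr (by simp))
lemma T1_log : (fun _ u => Real.log u : P → ℝ → ℝ) ∈ T1 C :=
  Algebra.subset_adjoin (Or.inr (by simp))
lemma T0_zpow (j : ℤ) : (fun _ u => u ^ j : P → ℝ → ℝ) ∈ T0 C := by
  cases j with
  | ofNat n =>
    have := (T0 C).pow_mem T0_u n
    convert this using 1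
    ext p u; simp
  | negSucc n =>
    have := (T0 C).pow_mem T0_inv (n+1)
    convert this using 1
    ext p u; simp [zpow_negSucc]

lemma isBigO_inv_pow_mono {m n : ℕ} (h : m ≤ n) :
    (fun u : ℝ => (u⁻¹) ^ m) =O[𝓝[>] 0] (fun u : ℝ => (u⁻¹) ^ n) := by
  apply IsBigO.of_bound 1
  have : Set.Ioo (0:ℝ) 1 ∈ 𝓝[>] (0:ℝ) := Ioo_mem_nhdsGT one_pos
  filter_upwards [this] with u hu
  have h1 : 1 ≤ u⁻¹ := (one_le_inv₀ hu.1).2 hu.2.le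
  have h0 : 0 ≤ u⁻¹ := by linarith
  rw [one_mul, norm_pow, norm_pow, Real.norm_of_nonneg h0]
  exact pow_le_pow_right₀ h1 h

lemma isBigO_pow_mono {m n : ℕ} (h : m ≤ n) :
    (fun u : ℝ => u ^ n) =O[𝓝[>] 0] (fun u : ℝ => u ^ m) := by
  apply IsBigO.of_bound 1
  have : Set.Ioo (0:ℝ) 1 ∈ 𝓝[>] (0:ℝ) := Ioo_mem_nhdsGT one_pos
  filter_upwards [this] with u hu
  rw [one_mul, norm_pow, norm_pow, Real.norm_of_nonneg hu.1.le]
  exact pow_le_pow_of_le_one hu.1.le hu.2.le h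

lemma log_isBigO : (fun u : ℝ => Real.log u) =O[𝓝[>] 0] (fun u : ℝ => (u⁻¹) ^ 1) := by
  have := (isLittleO_log_rpow_nhdsGT_zero (r := -1) (by norm_num)).isBigO
  refine this.congr' (by rfl) ?_
  filter_upwards [self_mem_nhdsWithin] with u hu
  rw [Real.rpow_neg_one, pow_one]

/-- Polynomial growth at the end point. -/
def PolyB (f : P → ℝ → ℝ) : Prop := ∃ m : ℕ, ∀ p, (f p) =O[𝓝[>] 0] (fun u : ℝ => (u⁻¹) ^ m)

lemma PolyB.add {f g : P → ℝ → ℝ} (hf : PolyB f) (hg : PolyB g) : PolyB (f + g) := by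
  obtain ⟨m, hm⟩ := hf
  obtain ⟨n, hn⟩ := hg
  exact ⟨m + n, fun p => ((hm p).trans (isBigO_inv_pow_mono (by omega))).add
    ((hn p).trans (isBigO_inv_pow_mono (by omega)))⟩

lemma PolyB.mul {f g : P → ℝ → ℝ} (hf : PolyB f) (hg : PolyB g) : PolyB (f * g) := by
  obtain ⟨m, hm⟩ := hf
  obtain ⟨n, hn⟩ := hg
  refine ⟨m + n, fun p => ?_⟩
  have := (hm p).mul (hn p)
  simp only [← pow_add] at this
  exact this

lemma PolyB.const (c : P → ℝ) : PolyB (fun p _ => c p) :=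
  ⟨0, fun p => by simpa using isBigO_const_const (c p) (one_ne_zero (α := ℝ)) _⟩

lemma T1_polyB {f : P → ℝ → ℝ} (hf : f ∈ T1 C) : PolyB f := by
  refine Algebra.adjoin_induction (p := fun f _ => PolyB f) ?_ ?_ ?_ ?_ hf
  · rintro f (⟨c, hc, rfl⟩ | hf)
    · exact PolyB.const c
    · simp only [Set.mem_insert_iff, Set.mem_singleton_iff] at hf
      rcases hf with rfl | rfl | rfl
      · exact ⟨0, fun p => by simpa using isBigO_pow_mono (m := 0) (n := 1) (by omega)⟩
      · exact ⟨1, fun p => by simpa using isBigO_refl _ _⟩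
      · exact ⟨1, fun p => log_isBigO⟩
  · intro r
    exact PolyB.const (fun _ => (r:ℝ))
  · intro f g _ _; exact PolyB.add
  · intro f g _ _; exact PolyB.mul

/-- `f` has an asymptotic expansion with terms in `T`. -/
def Exp (T : Subalgebra ℚ (P → ℝ → ℝ)) (f : P → ℝ → ℝ) : Prop :=
  ∀ N : ℕ, ∃ t ∈ T, ∀ p, (fun u => f p u - t p u) =O[𝓝[>] 0] (fun u : ℝ => u ^ N)

lemma Exp.of_mem {T : Subalgebra ℚ (P → ℝ → ℝ)} {f} (hf : f ∈ T) : Exp T f :=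
  fun N => ⟨f, hf, fun p => by simpa using isBigO_zero _ _⟩

lemma Exp.congr {T : Subalgebra ℚ (P → ℝ → ℝ)} {f g : P → ℝ → ℝ} (hf : Exp T f)
    (h : ∀ p, ∀ u ∈ Set.Ioo (0:ℝ) 1, f p u = g p u) : Exp T g := by
  intro N
  obtain ⟨t, ht, hb⟩ := hf N
  refine ⟨t, ht, fun p => (hb p).congr' ?_ (by rfl)⟩
  filter_upwards [Ioo_mem_nhdsGT one_pos] with u hu
  rw [h p u hu]

lemma Exp.add {T : Subalgebra ℚ (P → ℝ → ℝ)} {f g} (hf : Exp T f) (hg : Exp T g) : Exp T (f + g) := by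
  intro N
  obtain ⟨t, ht, hb⟩ := hf N
  obtain ⟨s, hs, hb'⟩ := hg N
  refine ⟨t + s, T.add_mem ht hs, fun p => ?_⟩
  refine ((hb p).add (hb' p)).congr_left fun u => ?_
  simp only [Pi.add_apply]; ring

lemma Exp.polyB {T : Subalgebra ℚ (P → ℝ → ℝ)} (hT : T ≤ T1 C) {f} (hf : Exp T f) : PolyB f := by
  obtain ⟨t, ht, hb⟩ := hf 0
  have h1 : PolyB (fun p u => f p u - t p u) := ⟨0, fun p => by simpa using hb p⟩
  have := h1.add (T1_polyB (hT ht))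
  convert this using 1
  ext p u; simp

lemma mul_cancel_O {f : ℝ → ℝ} {g : ℝ → ℝ} {m N : ℕ} (hf : f =O[𝓝[>] 0] (fun u : ℝ => (u⁻¹) ^ m))
    (hg : g =O[𝓝[>] 0] (fun u : ℝ => u ^ (N + m))) :
    (fun u => f u * g u) =O[𝓝[>] 0] (fun u : ℝ => u ^ N) := by
  refine (hf.mul hg).congr' (by rfl) ?_
  filter_upwards [self_mem_nhdsWithin] with u hu
  have : u ≠ 0 := ne_of_gt hu
  rw [inv_pow, pow_add]
  field_simp

lemma Exp.mul {T : Subalgebra ℚ (P → ℝ → ℝ)} (hT : T ≤ T1 C) {f g} (hf : Exp T f) (hg : Exp T g) :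
    Exp T (f * g) := by
  intro N
  obtain ⟨m, hm⟩ := hf.polyB hT
  obtain ⟨s, hs, hb'⟩ := hg (N + m)
  obtain ⟨n, hn⟩ := T1_polyB (hT hs)
  obtain ⟨t, ht, hb⟩ := hf (N + n)
  refine ⟨t * s, T.mul_mem ht hs, fun p => ?_⟩
  refine ((mul_cancel_O (hm p) (hb' p)).add (mul_cancel_O (hn p) (hb p))).congr_left fun u => ?_
  simp only [Pi.mul_apply]; ring

/-- Evaluation of coefficients. -/
noncomputable def evC (C : Subalgebra ℚ (P → ℝ)) (p : P) : C →+* ℝ := (Pi.evalRingHom _ p).comp C.val.toRingHom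

/-- Evaluation of a polynomial in `log u` and `u`. -/
noncomputable def ev2 (C : Subalgebra ℚ (P → ℝ)) (p : P) (u : ℝ) : Polynomial (Polynomial C) →+* ℝ :=
  Polynomial.eval₂RingHom (Polynomial.eval₂RingHom (evC C p) (Real.log u)) u

lemma T1_nf {f : P → ℝ → ℝ} (hf : f ∈ T1 C) : ∃ (m : ℕ) (q : Polynomial (Polynomial C)),
    ∀ p, ∀ u : ℝ, 0 < u → u ^ m * f p u = ev2 C p u q := by
  refine Algebra.adjoin_induction (p := fun f _ => ∃ (m : ℕ) (q : Polynomial (Polynomial C)),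
    ∀ p, ∀ u : ℝ, 0 < u → u ^ m * f p u = ev2 C p u q) ?_ ?_ ?_ ?_ hf
  · rintro f (⟨c, hc, rfl⟩ | hf)
    · exact ⟨0, Polynomial.C (Polynomial.C ⟨c, hc⟩), fun p u hu => by simp [ev2, evC]⟩
    · simp only [Set.mem_insert_iff, Set.mem_singleton_iff] at hf
      rcases hf with rfl | rfl | rfl
      · exact ⟨0, Polynomial.X, fun p u hu => by simp [ev2]⟩
      · exact ⟨1, 1, fun p u hu => by simp [hu.ne']⟩
      · exact ⟨0, Polynomial.C Polynomial.X, fun p u hu => by simp [ev2]⟩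
  · intro r
    refine ⟨0, Polynomial.C (Polynomial.C ⟨fun _ => (r:ℝ), C.algebraMap_mem r⟩), fun p u hu => ?_⟩
    have : (algebraMap ℚ (P → ℝ → ℝ) r) p u = (r:ℝ) := rfl
    rw [this]
    simp [ev2, evC]
  · rintro f g _ _ ⟨m, q, h⟩ ⟨n, r, h'⟩
    refine ⟨m + n, Polynomial.X ^ n * q + Polynomial.X ^ m * r, fun p u hu => ?_⟩
    rw [map_add, map_mul, map_mul, map_pow, map_pow, ← h p u hu, ← h' p u hu]
    simp [ev2]; ring
  · rintro f g _ _ ⟨m, q, h⟩ ⟨n, r, h'⟩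
    refine ⟨m + n, q * r, fun p u hu => ?_⟩
    rw [map_mul, ← h p u hu, ← h' p u hu]
    simp; ring

lemma T0_nf {f : P → ℝ → ℝ} (hf : f ∈ T0 C) : ∃ (m : ℕ) (q : Polynomial C),
    ∀ p, ∀ u : ℝ, 0 < u → u ^ m * f p u = q.eval₂ (evC C p) u := by
  refine Algebra.adjoin_induction (p := fun f _ => ∃ (m : ℕ) (q : Polynomial C),
    ∀ p, ∀ u : ℝ, 0 < u → u ^ m * f p u = q.eval₂ (evC C p) u) ?_ ?_ ?_ ?_ hf
  · rintro f (⟨c, hc, rfl⟩ | hf)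
    · exact ⟨0, (Polynomial.C ⟨c, hc⟩), fun p u hu => by simp [evC]⟩
    · simp only [Set.mem_insert_iff, Set.mem_singleton_iff] at hf
      rcases hf with rfl | rfl
      · exact ⟨0, Polynomial.X, fun p u hu => by simp⟩
      · exact ⟨1, 1, fun p u hu => by simp [hu.ne']⟩
  · intro r
    refine ⟨0, (Polynomial.C ⟨fun _ => (r:ℝ), C.algebraMap_mem r⟩), fun p u hu => ?_⟩
    have : (algebraMap ℚ (P → ℝ → ℝ) r) p u = (r:ℝ) := rfl
    rw [this]
    simp [evC]
  · rintro f g _ _ ⟨m, q, h⟩ ⟨n, r, h'⟩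
    refine ⟨m + n, Polynomial.X ^ n * q + Polynomial.X ^ m * r, fun p u hu => ?_⟩
    simp only [Polynomial.eval₂_add, Polynomial.eval₂_mul, Polynomial.eval₂_pow, Polynomial.eval₂_X]
    rw [← h p u hu, ← h' p u hu]
    simp; ring
  · rintro f g _ _ ⟨m, q, h⟩ ⟨n, r, h'⟩
    refine ⟨m + n, q * r, fun p u hu => ?_⟩
    rw [Polynomial.eval₂_mul, ← h p u hu, ← h' p u hu]
    simp; ring


lemma mul_log_pow (k : ℕ) : Tendsto (fun u : ℝ => u * Real.log u ^ k) (𝓝[>] 0) (𝓝 0) := by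
  have h := isLittleO_abs_log_rpow_rpow_nhdsGT_zero (s := -1) (k:ℝ) (by norm_num)
  have h2 := (h.tendsto_div_nhds_zero)
  rw [tendsto_zero_iff_norm_tendsto_zero] at h2 ⊢
  refine h2.congr' ?_
  filter_upwards [self_mem_nhdsWithin] with u hu
  have : u ≠ 0 := ne_of_gt hu
  rw [Real.rpow_neg_one, Real.rpow_natCast, norm_div, norm_inv, norm_mul, norm_pow, norm_pow]
  simp [mul_comm]

lemma mul_poly_log (r : Polynomial ℝ) : Tendsto (fun u : ℝ => u * r.eval (Real.log u)) (𝓝[>] 0) (𝓝 0) := by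
  induction r using Polynomial.induction_on' with
  | add p q hp hq =>
    simp only [Polynomial.eval_add, mul_add]
    simpa using hp.add hq
  | monomial n a =>
    simp only [Polynomial.eval_monomial]
    have := (mul_log_pow n).const_mul a
    rw [mul_zero] at this
    refine this.congr fun u => by ring

lemma mul_poly2 (r : Polynomial (Polynomial ℝ)) :
    Tendsto (fun u : ℝ => u * r.eval₂ (Polynomial.evalRingHom (Real.log u)) u) (𝓝[>] 0) (𝓝 0) := by
  induction r using Polynomial.induction_on' with
  | add p q hp hq =>
    simp only [Polynomial.eval₂_add, mul_add]
    simpa using hp.add hq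
  | monomial n a =>
    simp only [Polynomial.eval₂_monomial, Polynomial.coe_evalRingHom]
    have h1 : Tendsto (fun u : ℝ => u ^ n) (𝓝[>] 0) (𝓝 (0 ^ n)) :=
      (((continuous_pow n).tendsto (0:ℝ))).mono_left nhdsWithin_le_nhds
    have := (mul_poly_log a).mul h1
    rw [zero_mul] at this
    refine this.congr fun u => by ring

lemma poly_log_lim {P : Polynomial ℝ} {l : ℝ}
    (h : Tendsto (fun u => P.eval (Real.log u)) (𝓝[>] 0) (𝓝 l)) : P = Polynomial.C l := by
  have h1 : Tendsto (fun y : ℝ => Real.exp (-y)) atTop (𝓝[>] 0) :=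
    tendsto_nhdsWithin_iff.2 ⟨Real.tendsto_exp_neg_atTop_nhds_zero,
      Eventually.of_forall fun y => Real.exp_pos _⟩
  have h2 := h.comp h1
  have h3 : Tendsto (fun y => (P.comp (-Polynomial.X)).eval y) atTop (𝓝 l) := by
    refine h2.congr fun y => ?_
    simp [Polynomial.eval_comp]
  rw [Polynomial.tendsto_nhds_iff] at h3
  obtain ⟨h4, h5⟩ := h3
  have h6 := Polynomial.eq_C_of_degree_le_zero h5
  rw [h6, Polynomial.leadingCoeff_C] at h4
  rw [h4] at h6
  have : (P.comp (-Polynomial.X)).comp (-Polynomial.X) = P := by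
    rw [Polynomial.comp_assoc]; simp
  rw [← this, h6]; simp

lemma lim_nf : ∀ (m : ℕ) (q : Polynomial (Polynomial ℝ)) (g : ℝ → ℝ) (l : ℝ)
    (_ : ∀ u, 0 < u → u ^ m * g u = q.eval₂ (Polynomial.evalRingHom (Real.log u)) u)
    (_ : Tendsto g (𝓝[>] 0) (𝓝 l)), q.coeff m = Polynomial.C l := by
  have key : ∀ (q : Polynomial (Polynomial ℝ)) (g : ℝ → ℝ) (l : ℝ)
    (_ : ∀ u, 0 < u → g u = q.eval₂ (Polynomial.evalRingHom (Real.log u)) u)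
    (_ : Tendsto g (𝓝[>] 0) (𝓝 l)), q.coeff 0 = Polynomial.C l := by
    intro q g l h hl
    apply poly_log_lim
    have := hl.sub (mul_poly2 q.divX)
    rw [sub_zero] at this
    refine this.congr' ?_
    filter_upwards [self_mem_nhdsWithin] with u hu
    rw [h u hu]
    conv_lhs => enter [1]; rw [← Polynomial.divX_mul_X_add q]
    rw [Polynomial.eval₂_add, Polynomial.eval₂_mul, Polynomial.eval₂_X, Polynomial.eval₂_C]
    simp; ring
  intro m
  induction m with
  | zero =>
    intro q g l h hl
    exact key q g l (by simpa using h) hl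
  | succ m ih =>
    intro q g l h hl
    have h0 : q.coeff 0 = 0 := by
      have := key q (fun u => u ^ (m+1) * g u) 0 h ?_
      · simpa using this
      · have h1 : Tendsto (fun u : ℝ => u ^ (m+1)) (𝓝[>] 0) (𝓝 (0 ^ (m+1))) :=
          (((continuous_pow (m+1)).tendsto (0:ℝ))).mono_left nhdsWithin_le_nhds
        simpa using h1.mul hl
    rw [← Polynomial.coeff_divX]
    refine ih q.divX g l (fun u hu => ?_) hl
    have h2 := h u hu
    conv_rhs at h2 => rw [← Polynomial.divX_mul_X_add q]
    rw [h0, Polynomial.eval₂_add, Polynomial.eval₂_mul, Polynomial.eval₂_X] at h2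
    simp only [map_zero, Polynomial.eval₂_zero, add_zero] at h2
    apply mul_right_cancel₀ hu.ne'
    rw [← h2]; ring

lemma ev2_eq (p : P) (u : ℝ) (q : Polynomial (Polynomial C)) :
    ev2 C p u q = (q.map (Polynomial.mapRingHom (evC C p))).eval₂ (Polynomial.evalRingHom (Real.log u)) u := by
  rw [Polynomial.eval₂_map, ev2, Polynomial.coe_eval₂RingHom]
  congr 1
  ext x
  · simp
  · simp

/-- Limits of elements of `T1` are in `C`. -/
lemma T1_lim {t : P → ℝ → ℝ} (ht : t ∈ T1 C) : ∃ κ ∈ C, ∀ p l, Tendsto (t p) (𝓝[>] 0) (𝓝 l) → l = κ p := by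
  obtain ⟨m, q, h⟩ := T1_nf ht
  refine ⟨((q.coeff m).coeff 0 : C), ((q.coeff m).coeff 0).2, fun p l hl => ?_⟩
  have := lim_nf m (q.map (Polynomial.mapRingHom (evC C p))) (t p) l
    (fun u hu => by rw [← ev2_eq]; exact h p u hu) hl
  rw [Polynomial.coeff_map] at this
  have h2 := congrArg (fun r => Polynomial.coeff r 0) this
  simp at h2
  rw [← h2]; rfl

lemma T0_lim {t : P → ℝ → ℝ} (ht : t ∈ T0 C) (c : P → ℝ) : ∃ κ ∈ C, ∀ p l,
    Tendsto (fun u => t p u + c p * Real.log u) (𝓝[>] 0) (𝓝 l) → l = κ p ∧ c p = 0 := by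
  obtain ⟨m, q, h⟩ := T0_nf ht
  refine ⟨(q.coeff m : C), (q.coeff m).2, fun p l hl => ?_⟩
  have := lim_nf m ((q.map (evC C p)).map Polynomial.C +
      Polynomial.C (Polynomial.C (c p) * Polynomial.X) * Polynomial.X ^ m) (fun u => t p u + c p * Real.log u) l
    (fun u hu => by
      rw [mul_add, h p u hu, Polynomial.eval₂_add, Polynomial.eval₂_map, Polynomial.eval₂_map,
        Polynomial.eval₂_mul, Polynomial.eval₂_C]
      congr 1
      · congr 1
        ext x
        simp
      · simp; ring) hl
  rw [Polynomial.coeff_add, Polynomial.coeff_C_mul_X_pow, if_pos rfl, Polynomial.coeff_map] at this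
  have h2 := congrArg (fun r => Polynomial.coeff r 0) this
  have h3 := congrArg (fun r => Polynomial.coeff r 1) this
  simp at h2 h3
  refine ⟨?_, ?_⟩
  · rw [← h2]; rfl
  · exact h3

lemma T1_prim_mono : ∀ (k : ℕ) (j : ℤ), ∃ S ∈ T1 C, ∀ (p : P) (u : ℝ), 0 < u →
    HasDerivAt (S p) (u ^ j * Real.log u ^ k) u := by
  have hj1 : ∀ k : ℕ, ∃ S ∈ T1 C, ∀ (p : P) (u : ℝ), 0 < u →
    HasDerivAt (S p) (u ^ (-1:ℤ) * Real.log u ^ k) u := by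
    intro k
    refine ⟨((1:ℚ)/(k+1)) • (fun _ u => Real.log u : P → ℝ → ℝ) ^ (k+1),
      (T1 C).smul_mem ((T1 C).pow_mem T1_log _) _, fun p u hu => ?_⟩
    have := ((Real.hasDerivAt_log hu.ne').pow (k+1)).const_mul ((1:ℝ)/(k+1))
    refine derivCongr this (fun v => ?_) ?_
    · simp [Rat.smul_def]
    · have : (k:ℝ) + 1 ≠ 0 := by positivity
      push_cast
      simp
      field_simp
  have hz : ∀ (j : ℤ), j ≠ -1 → ∀ u : ℝ, 0 < u →
      HasDerivAt (fun u : ℝ => ((1:ℝ)/(j+1)) * u ^ (j+1)) (u ^ j) u := by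
    intro j hj u hu
    have := (hasDerivAt_zpow (j+1) u (Or.inl hu.ne')).const_mul ((1:ℝ)/(j+1))
    refine derivCongr this (fun v => rfl) ?_
    have : (j:ℝ) + 1 ≠ 0 := by
      intro h; apply hj; have : ((j+1 : ℤ):ℝ) = 0 := by push_cast; exact h
      have := Int.cast_eq_zero.1 this; omega
    push_cast
    rw [add_sub_cancel_right]
    field_simp
  intro k
  induction k with
  | zero =>
    intro j
    rcases eq_or_ne j (-1) with rfl | hj
    · exact hj1 0
    · refine ⟨((1:ℚ)/(j+1)) • (fun _ u => u ^ (j+1) : P → ℝ → ℝ),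
        (T1 C).smul_mem (T0_le_T1 C (T0_zpow _)) _, fun p u hu => ?_⟩
      refine derivCongr (hz j hj u hu) (fun v => ?_) ?_
      · simp [Rat.smul_def]
      · simp
  | succ k ih =>
    intro j
    rcases eq_or_ne j (-1) with rfl | hj
    · exact hj1 (k+1)
    · obtain ⟨S, hS, hd⟩ := ih j
      refine ⟨(((1:ℚ)/(j+1)) • (fun _ u => u ^ (j+1) : P → ℝ → ℝ)) * (fun _ u => Real.log u : P → ℝ → ℝ) ^ (k+1)
        - ((k+1 : ℚ)/(j+1)) • S,
        (T1 C).sub_mem ((T1 C).mul_mem ((T1 C).smul_mem (T0_le_T1 C (T0_zpow _)) _)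
          ((T1 C).pow_mem T1_log _)) ((T1 C).smul_mem hS _), fun p u hu => ?_⟩
      have h1 := (hz j hj u hu).mul ((Real.hasDerivAt_log hu.ne').pow (k+1))
      have h2 := (hd p u hu).const_mul ((k+1 : ℝ)/(j+1))
      refine derivCongr (h1.sub h2) (fun v => ?_) ?_
      · simp [Rat.smul_def]; ring
      · push_cast
        rw [zpow_add₀ hu.ne']
        simp
        field_simp
        ring

lemma T1_prim {t : P → ℝ → ℝ} (ht : t ∈ T1 C) : ∃ S ∈ T1 C, ∀ (p : P) (u : ℝ), 0 < u →
    HasDerivAt (S p) (t p u) u := by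
  obtain ⟨m, q, h⟩ := T1_nf ht
  suffices H : ∀ q : Polynomial (Polynomial C), ∃ S ∈ T1 C, ∀ (p : P) (u : ℝ), 0 < u →
    HasDerivAt (S p) (u ^ (-(m:ℤ)) * ev2 C p u q) u by
    obtain ⟨S, hS, hd⟩ := H q
    refine ⟨S, hS, fun p u hu => ?_⟩
    convert hd p u hu using 1
    rw [← h p u hu]
    simp [hu.ne']
  intro q
  induction q using Polynomial.induction_on' with
  | add q r hq hr =>
    obtain ⟨S, hS, hd⟩ := hq
    obtain ⟨S', hS', hd'⟩ := hr
    refine ⟨S + S', (T1 C).add_mem hS hS', fun p u hu => ?_⟩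
    rw [map_add, mul_add]
    exact (hd p u hu).add (hd' p u hu)
  | monomial j r =>
    induction r using Polynomial.induction_on' with
    | add q r hq hr =>
      obtain ⟨S, hS, hd⟩ := hq
      obtain ⟨S', hS', hd'⟩ := hr
      refine ⟨S + S', (T1 C).add_mem hS hS', fun p u hu => ?_⟩
      rw [map_add, map_add, mul_add]
      exact (hd p u hu).add (hd' p u hu)
    | monomial k c =>
      obtain ⟨S, hS, hd⟩ := T1_prim_mono (C := C) k (-(m:ℤ) + j)
      refine ⟨(fun p _ => (c : P → ℝ) p) * S, (T1 C).mul_mem (T0_le_T1 C (T0_const c.2)) hS, fun p u hu => ?_⟩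
      refine derivCongr ((hd p u hu).const_mul ((c : P → ℝ) p)) (fun v => rfl) ?_
      rw [zpow_add₀ hu.ne']
      simp [ev2, evC]
      ring

lemma lim_of_deriv_bd {D D' : ℝ → ℝ} {N : ℕ} (hd : ∀ u, 0 < u → u < 1 → HasDerivAt D (D' u) u)
    (hb : D' =O[𝓝[>] 0] (fun u : ℝ => u ^ N)) :
    ∃ c, Tendsto D (𝓝[>] 0) (𝓝 c) ∧ (fun u => D u - c) =O[𝓝[>] 0] (fun u : ℝ => u ^ N) := by
  obtain ⟨K, hK0, hK⟩ := hb.exists_nonneg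
  rw [IsBigOWith, eventually_nhdsWithin_iff, Metric.eventually_nhds_iff] at hK
  obtain ⟨d, hd0, hK⟩ := hK
  set e := min d 1 with he
  have he0 : 0 < e := lt_min hd0 one_pos
  have hb : ∀ u, 0 < u → u < e → |D' u| ≤ K * u ^ N := by
    intro u h0 h1
    have := @hK u (by rw [Real.dist_eq, sub_zero, abs_of_pos h0]; exact h1.trans_le (min_le_left _ _)) h0
    rwa [Real.norm_eq_abs, Real.norm_eq_abs, abs_of_nonneg (by positivity : 0 ≤ u ^ N)] at this
  have mv : ∀ x y, 0 < y → y ≤ x → x < e → |D x - D y| ≤ K * x ^ N * |x - y| := by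
    intro x y hy hyx hx
    have hx1 : x < 1 := hx.trans_le (min_le_right _ _)
    have := (convex_Icc y x).norm_image_sub_le_of_norm_hasDerivWithin_le (f := D) (f' := D')
      (C := K * x ^ N) (fun z hz => (hd z (by linarith [hz.1]) (by linarith [hz.2])).hasDerivWithinAt)
      (fun z hz => ?_) (Set.left_mem_Icc.2 hyx) (Set.right_mem_Icc.2 hyx)
    · simpa using this
    · have hz0 : 0 < z := by linarith [hz.1]
      refine (hb z hz0 (by linarith [hz.2])).trans ?_
      have := hz.2
      gcongr
  have hl : LipschitzOnWith (Real.toNNReal K) D (Set.Ioo 0 e) := by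
    have key : ∀ x ∈ Set.Ioo 0 e, ∀ y ∈ Set.Ioo 0 e, y ≤ x → |D x - D y| ≤ K * |x - y| := by
      intro x hx y hy hxy
      refine (mv x y hy.1 hxy hx.2).trans ?_
      have : x ^ N ≤ 1 := pow_le_one₀ hx.1.le (hx.2.le.trans (min_le_right _ _))
      have : K * x ^ N ≤ K * 1 := by gcongr
      rw [mul_one] at this
      gcongr
    apply LipschitzOnWith.of_dist_le_mul
    intro x hx y hy
    rw [Real.coe_toNNReal _ hK0, Real.dist_eq, Real.dist_eq]
    rcases le_total y x with h | h
    · exact key x hx y hy h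
    · rw [abs_sub_comm, abs_sub_comm x]; exact key y hy x hx h
  obtain ⟨g, hg, hgD⟩ := hl.extend_real
  have hlim : Tendsto D (𝓝[>] 0) (𝓝 (g 0)) := by
    have := (hg.continuous.tendsto 0).mono_left (nhdsWithin_le_nhds (s := Set.Ioi 0))
    refine this.congr' ?_
    filter_upwards [Ioo_mem_nhdsGT he0] with u hu
    exact (hgD hu).symm
  refine ⟨g 0, hlim, ?_⟩
  apply IsBigO.of_bound K
  filter_upwards [Ioo_mem_nhdsGT he0] with u hu
  have hu0 := hu.1
  rw [Real.norm_eq_abs, Real.norm_eq_abs, abs_of_nonneg (by positivity : 0 ≤ u ^ N)]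
  refine le_of_tendsto ((tendsto_const_nhds.sub hlim).abs) ?_
  filter_upwards [Ioo_mem_nhdsGT hu0] with y hy
  refine (mv u y hy.1 hy.2.le hu.2).trans ?_
  have h1 : |u - y| ≤ 1 := by
    rw [abs_of_pos (by linarith [hy.2])]
    have := hu.2.le.trans (min_le_right _ _)
    linarith [hy.1]
  have : K * u ^ N * |u - y| ≤ K * u ^ N * 1 := by gcongr
  linarith

lemma Exp.integ {f g : P → ℝ → ℝ} {ζ : P → ℝ} (hg : Exp (T1 C) g)
    (hd : ∀ p u, 0 < u → u < 1 → HasDerivAt (f p) (g p u) u) (hζ : ζ ∈ C)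
    (hl : ∀ p, Tendsto (f p) (𝓝[>] 0) (𝓝 (ζ p))) : Exp (T1 C) f := by
  intro N
  obtain ⟨t, ht, hb⟩ := hg N
  obtain ⟨S, hS, hSd⟩ := T1_prim ht
  obtain ⟨κ, hκ, hκl⟩ := T1_lim hS
  refine ⟨S + ((fun p _ => ζ p) - (fun p _ => κ p)), (T1 C).add_mem hS ((T1 C).sub_mem
    (T0_le_T1 C (T0_const hζ)) (T0_le_T1 C (T0_const hκ))), fun p => ?_⟩
  obtain ⟨c, hc, hcb⟩ := lim_of_deriv_bd (D := fun u => f p u - S p u)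
    (fun u h0 h1 => (hd p u h0 h1).sub (hSd p u h0)) (hb p)
  have h3 : Tendsto (S p) (𝓝[>] 0) (𝓝 (ζ p - c)) := by
    have := (hl p).sub hc
    simpa using this
  have h4 := hκl p _ h3
  refine hcb.congr_left fun u => ?_
  simp only [Pi.add_apply, Pi.sub_apply]
  rw [← h4]; ring

end expn

open MeasureTheory Filter Topology Asymptotics Polynomial

/-! ## The ring of hyperlogarithms with parameters -/

/-- Parameter data. -/
structure PD (P ι : Type) where
  C : Subalgebra ℚ (P → ℝ)
  ρ : ι → P → ℝ
  o : ι
  pos : ∀ i p, 0 < ρ i p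
  le_one : ∀ i p, ρ i p ≤ 1
  one : ∀ p, ρ o p = 1
  ne : ∀ i j, i ≠ j → ∀ p, ρ i p ≠ ρ j p
  mem : ∀ i, ρ i ∈ C
  inv_mem : ∀ i, (fun p => (ρ i p)⁻¹) ∈ C
  sub_mem : ∀ i j, i ≠ j → (fun p => (ρ i p - ρ j p)⁻¹) ∈ C

section ring
variable {P ι : Type} (D : PD P ι)

/-- Word of values. -/
def PD.wv (w : List (Option ι)) (p : P) : List (Option ℝ) := w.map (Option.map (fun i => D.ρ i p))

/-- Hyperlogarithm with parameters. -/
noncomputable def PD.HL (w : List (Option ι)) : P → ℝ → ℝ := fun p x => hL (D.wv w p) x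

/-- Kernel with parameters. -/
noncomputable def PD.K (a : Option ι) : P → ℝ → ℝ := fun p x => kf (a.map (fun i => D.ρ i p)) x

lemma PD.gd (w : List (Option ι)) (p : P) : Gd (D.wv w p) := by
  intro r hr
  rw [PD.wv, List.mem_map] at hr
  obtain ⟨a, _, h⟩ := hr
  cases a with
  | none => simp at h
  | some i => simp at h; subst h; exact ⟨(D.pos i p).le, D.le_one i p⟩

lemma vld_map {α β : Type} (f : α → β) : ∀ (w : List (Option α)), Vld w → Vld (w.map (Option.map f))
  | [], _ => trivial
  | a :: w, h => by
    refine ⟨fun h0 => ?_, vld_map f w h.2⟩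
    have := h.1 (by simpa using h0)
    simpa using this

lemma PD.vld {w : List (Option ι)} (h : Vld w) (p : P) : Vld (D.wv w p) := vld_map _ w h

lemma PD.lt_one {i : ι} (h : i ≠ D.o) (p : P) : D.ρ i p < 1 :=
  lt_of_le_of_ne (D.le_one i p) (by rw [← D.one p]; exact D.ne i D.o h p)

lemma PD.cv {w : List (Option ι)} (h : w.head? ≠ some (some D.o)) (p : P) : Cv (D.wv w p) := by
  cases w with
  | nil => simp [Cv, PD.wv]
  | cons a w =>
    cases a with
    | none => simp [Cv, PD.wv]
    | some i =>
      simp only [List.head?_cons, ne_eq, Option.some.injEq] at h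
      simp only [Cv, PD.wv, List.map_cons, List.head?_cons, Option.map_some, ne_eq, Option.some.injEq]
      exact (D.lt_one h p).ne

lemma PD.den_pos (i : ι) (p : P) {x : ℝ} (hx : x ∈ Set.Ioo (0:ℝ) 1) : 0 < 1 - D.ρ i p * x := by
  have := D.pos i p
  have := D.le_one i p
  have := hx.1
  have := hx.2
  nlinarith

/-- Linear combinations of rational functions times hyperlogarithms. -/
inductive MR (S : Set (List (Option ι))) : (P → ℝ → ℝ) → Prop
  | mono (w) (hw : w ∈ S) (hv : Vld w) (c : P → ℝ) (hc : c ∈ D.C) (j : ℤ) :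
      MR S (fun p x => c p * x ^ j * D.HL w p x)
  | pole (w) (hw : w ∈ S) (hv : Vld w) (c : P → ℝ) (hc : c ∈ D.C) (i : ι) (m : ℕ) :
      MR S (fun p x => c p * ((1 - D.ρ i p * x)⁻¹) ^ (m + 1) * D.HL w p x)
  | add {f g} : MR S f → MR S g → MR S (f + g)
  | congr {f g} : MR S f → (∀ p, ∀ x ∈ Set.Ioo (0:ℝ) 1, f p x = g p x) → MR S g

variable {D}
variable {S : Set (List (Option ι))}

lemma MR.mulC {f} (hf : MR D S f) {c : P → ℝ} (hc : c ∈ D.C) : MR D S (fun p x => c p * f p x) := by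
  induction hf with
  | mono w hw hv d hd j =>
    exact (MR.mono w hw hv _ (D.C.mul_mem hc hd) j).congr fun p x _ => by simp only [Pi.mul_apply]; ring
  | pole w hw hv d hd i m =>
    exact (MR.pole w hw hv _ (D.C.mul_mem hc hd) i m).congr fun p x _ => by simp only [Pi.mul_apply]; ring
  | add _ _ h1 h2 => exact (h1.add h2).congr fun p x _ => by simp only [Pi.add_apply]; ring
  | congr _ h h1 => exact h1.congr fun p x hx => by rw [h p x hx]

lemma MR.mono' (w) (hw : w ∈ S) (hv : Vld w) {c : P → ℝ} (hc : c ∈ D.C) (j : ℤ) {f : P → ℝ → ℝ}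
    (h : ∀ p, ∀ x ∈ Set.Ioo (0:ℝ) 1, f p x = c p * x ^ j * D.HL w p x) : MR D S f :=
  (MR.mono w hw hv c hc j).congr fun p x hx => (h p x hx).symm

lemma MR.pole' (w) (hw : w ∈ S) (hv : Vld w) {c : P → ℝ} (hc : c ∈ D.C) (i : ι) (m : ℕ) {f : P → ℝ → ℝ}
    (h : ∀ p, ∀ x ∈ Set.Ioo (0:ℝ) 1, f p x = c p * ((1 - D.ρ i p * x)⁻¹) ^ m * D.HL w p x) :
    MR D S f := by
  cases m with
  | zero => exact MR.mono' w hw hv hc 0 fun p x hx => by rw [h p x hx]; simp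
  | succ m => exact (MR.pole w hw hv c hc i m).congr fun p x hx => (h p x hx).symm

lemma MR.mulX {f} (hf : MR D S f) : MR D S (fun p x => x * f p x) := by
  induction hf with
  | mono w hw hv d hd j =>
    refine MR.mono' w hw hv hd (j + 1) fun p x hx => ?_
    rw [zpow_add₀ hx.1.ne', zpow_one]; ring
  | pole w hw hv d hd i m =>
    have h1 : MR D S (fun p x => (d p * (D.ρ i p)⁻¹) * ((1 - D.ρ i p * x)⁻¹) ^ (m+1) * D.HL w p x) :=
      MR.pole w hw hv _ (D.C.mul_mem hd (D.inv_mem i)) i m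
    have h2 : MR D S (fun p x => (d p * (-1 * (D.ρ i p)⁻¹)) * ((1 - D.ρ i p * x)⁻¹) ^ m * D.HL w p x) :=
      MR.pole' w hw hv (D.C.mul_mem hd (D.C.mul_mem (D.C.neg_mem D.C.one_mem) (D.inv_mem i))) i m fun p x _ => rfl
    refine (h1.add h2).congr fun p x hx => ?_
    have := D.den_pos i p hx
    have := D.pos i p
    simp only [Pi.add_apply]
    rw [pow_succ]
    field_simp
    ring
  | add _ _ h1 h2 => exact (h1.add h2).congr fun p x _ => by simp only [Pi.add_apply]; ring
  | congr _ h h1 => exact h1.congr fun p x hx => by rw [h p x hx]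

lemma MR.mulXinv {f} (hf : MR D S f) : MR D S (fun p x => x⁻¹ * f p x) := by
  induction hf with
  | mono w hw hv d hd j =>
    refine MR.mono' w hw hv hd (j - 1) fun p x hx => ?_
    rw [zpow_sub₀ hx.1.ne', zpow_one]
    have := hx.1
    field_simp
  | pole w hw hv d hd i m =>
    suffices H : ∀ m : ℕ, MR D S (fun p x => x⁻¹ * (d p * ((1 - D.ρ i p * x)⁻¹) ^ m * D.HL w p x)) from H _
    intro m
    induction m with
    | zero => exact MR.mono' w hw hv hd (-1) fun p x hx => by rw [zpow_neg_one]; ring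
    | succ m ih =>
      have h1 : MR D S (fun p x => (d p * (D.ρ i p)) * ((1 - D.ρ i p * x)⁻¹) ^ (m+1) * D.HL w p x) :=
        MR.pole w hw hv _ (D.C.mul_mem hd (D.mem i)) i m
      refine (ih.add h1).congr fun p x hx => ?_
      have h2 := (D.den_pos i p hx).ne'
      have h3 := hx.1.ne'
      have h4 : x⁻¹ + D.ρ i p * (1 - D.ρ i p * x)⁻¹ = x⁻¹ * (1 - D.ρ i p * x)⁻¹ := by
        linear_combination (-x⁻¹) * mul_inv_cancel₀ h2 -
          (D.ρ i p * (1 - D.ρ i p * x)⁻¹) * mul_inv_cancel₀ h3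
      simp only [Pi.add_apply]
      rw [pow_succ]
      linear_combination (d p * (1 - D.ρ i p * x)⁻¹ ^ m * D.HL w p x) * h4
  | add _ _ h1 h2 => exact (h1.add h2).congr fun p x _ => by simp only [Pi.add_apply]; ring
  | congr _ h h1 => exact h1.congr fun p x hx => by rw [h p x hx]

lemma MR.mulZpow {f} (hf : MR D S f) (j : ℤ) : MR D S (fun p x => x ^ j * f p x) := by
  cases j with
  | ofNat n =>
    induction n with
    | zero => simpa using hf
    | succ n ih => exact ih.mulX.congr fun p x hx => by
                    simp only [Int.ofNat_eq_natCast, zpow_natCast, pow_succ]; ring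
  | negSucc n =>
    induction n with
    | zero => simpa using hf.mulXinv
    | succ n ih => exact ih.mulXinv.congr fun p x hx => by
                      simp only [zpow_negSucc, pow_succ, mul_inv]; ring

lemma MR.mulPole {f} (hf : MR D S f) (i : ι) : MR D S (fun p x => (1 - D.ρ i p * x)⁻¹ * f p x) := by
  induction hf with
  | mono w hw hv d hd j =>
    have h := (MR.pole w hw hv d hd i 0).mulZpow j
    exact h.congr fun p x _ => by ring
  | pole w hw hv d hd k m =>
    by_cases hik : i = k
    · subst hik
      exact (MR.pole w hw hv d hd i (m+1)).congr fun p x _ => by ring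
    suffices H : ∀ m : ℕ, MR D S (fun p x => (1 - D.ρ i p * x)⁻¹ *
      (d p * ((1 - D.ρ k p * x)⁻¹) ^ m * D.HL w p x)) from H _
    intro m
    induction m with
    | zero => exact MR.pole' w hw hv hd i 1 fun p x hx => by ring
    | succ m ih =>
      have h1 : MR D S (fun p x => (d p * (-1 * (D.ρ k p * (D.ρ i p - D.ρ k p)⁻¹))) *
          ((1 - D.ρ k p * x)⁻¹) ^ (m+1) * D.HL w p x) :=
        MR.pole w hw hv _ (D.C.mul_mem hd (D.C.mul_mem (D.C.neg_mem D.C.one_mem)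
          (D.C.mul_mem (D.mem k) (D.sub_mem i k hik)))) k m
      have h2 := ih.mulC (D.C.mul_mem (D.mem i) (D.sub_mem i k hik))
      refine (h1.add h2).congr fun p x hx => ?_
      have := D.den_pos i p hx
      have := D.den_pos k p hx
      have h3 := sub_ne_zero.2 (D.ne i k hik p)
      simp only [Pi.add_apply, Pi.mul_apply]
      rw [pow_succ]
      field_simp
      ring
  | add _ _ h1 h2 => exact (h1.add h2).congr fun p x _ => by simp only [Pi.add_apply]; ring
  | congr _ h h1 => exact h1.congr fun p x hx => by rw [h p x hx]

lemma MR.mulK {f} (hf : MR D S f) (a : Option ι) : MR D S (fun p x => D.K a p x * f p x) := by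
  cases a with
  | none => exact hf.mulXinv
  | some i => exact ((hf.mulPole i).mulC (D.mem i)).congr fun p x _ => by simp [PD.K, kf]; ring

lemma MR.le {S' : Set (List (Option ι))} (h : S ⊆ S') {f} (hf : MR D S f) : MR D S' f := by
  induction hf with
  | mono w hw hv d hd j => exact MR.mono w (h hw) hv d hd j
  | pole w hw hv d hd k m => exact MR.pole w (h hw) hv d hd k m
  | add _ _ h1 h2 => exact h1.add h2
  | congr _ h h1 => exact h1.congr h

lemma HL_mul {u v : List (Option ι)} (hu : Vld u) (hv : Vld v) (p : P) {x : ℝ} (hx : x ∈ Set.Ioo (0:ℝ) 1) :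
    D.HL u p x * D.HL v p x = ((shf u v).map fun w => D.HL w p x).sum := by
  unfold PD.HL
  rw [hL_mul _ _ (D.gd u p) (D.gd v p) (D.vld hu p) (D.vld hv p) hx.1.le hx.2]
  unfold PD.wv
  rw [shf_map, List.map_map]
  rfl

lemma HL_nil (p : P) (x : ℝ) : D.HL [] p x = 1 := hL_nil x

lemma MR.zero : MR D Set.univ (fun _ _ => 0) :=
  MR.mono' [] (Set.mem_univ _) trivial D.C.zero_mem 0 fun p x _ => by simp

lemma MR.listSum {β : Type} (l : List β) (f : β → P → ℝ → ℝ) (h : ∀ b ∈ l, MR D Set.univ (f b)) :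
    MR D Set.univ (fun p x => (l.map fun b => f b p x).sum) := by
  induction l with
  | nil => simpa using MR.zero
  | cons b l ih =>
    refine ((h b (by simp)).add (ih fun c hc => h c (by simp [hc]))).congr fun p x _ => ?_
    simp

lemma MR.mulHL {f} (hf : MR D Set.univ f) {v} (hv : Vld v) : MR D Set.univ (fun p x => f p x * D.HL v p x) := by
  induction hf with
  | mono w hw hw' d hd j =>
    have := MR.listSum (shf w v) (fun u p x => d p * x ^ j * D.HL u p x)
      (fun u hu => MR.mono u (Set.mem_univ _) (shf_vld w v hw' hv u hu) d hd j)
    refine this.congr fun p x hx => ?_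
    rw [List.sum_map_mul_left, ← HL_mul hw' hv p hx]; ring
  | pole w hw hw' d hd k m =>
    have := MR.listSum (shf w v) (fun u p x => d p * ((1 - D.ρ k p * x)⁻¹) ^ (m + 1) * D.HL u p x)
      (fun u hu => MR.pole u (Set.mem_univ _) (shf_vld w v hw' hv u hu) d hd k m)
    refine this.congr fun p x hx => ?_
    rw [List.sum_map_mul_left, ← HL_mul hw' hv p hx]; ring
  | add _ _ h1 h2 => exact (h1.add h2).congr fun p x _ => by simp only [Pi.add_apply]; ring
  | congr _ h h1 => exact h1.congr fun p x hx => by rw [h p x hx]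

lemma MR.mul {f g} (hf : MR D Set.univ f) (hg : MR D Set.univ g) : MR D Set.univ (f * g) := by
  induction hg with
  | mono w hw hw' d hd j =>
    exact ((hf.mulHL hw').mulZpow j).mulC hd |>.congr fun p x _ => by simp only [Pi.mul_apply]; ring
  | pole w hw hw' d hd k m =>
    suffices H : ∀ m : ℕ, MR D Set.univ (fun p x => d p * ((1 - D.ρ k p * x)⁻¹) ^ m * (f p x * D.HL w p x)) from
      (H (m+1)).congr fun p x _ => by simp only [Pi.mul_apply]; ring
    intro m
    induction m with
    | zero => exact ((hf.mulHL hw').mulC hd).congr fun p x _ => by ring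
    | succ m ih => exact (ih.mulPole k).congr fun p x _ => by ring
  | add _ _ h1 h2 => exact (h1.add h2).congr fun p x _ => by simp only [Pi.add_apply, Pi.mul_apply]; ring
  | congr _ h h1 => exact h1.congr fun p x hx => by simp only [Pi.mul_apply]; rw [h p x hx]

lemma MR.const {c : P → ℝ} (hc : c ∈ D.C) : MR D Set.univ (fun p _ => c p) :=
  MR.mono' [] (Set.mem_univ _) trivial hc 0 fun p x _ => by simp [HL_nil]

variable (D) in
/-- The ring of hyperlogarithms. -/
def PD.R : Subalgebra ℚ (P → ℝ → ℝ) where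
  carrier := {f | MR D Set.univ f}
  mul_mem' := MR.mul
  add_mem' := MR.add
  algebraMap_mem' := fun r => MR.const (D.C.algebraMap_mem r)

lemma HL_deriv {a : Option ι} {w} (hv : Vld (a :: w)) (p : P) {x : ℝ} (hx : x ∈ Set.Ioo (0:ℝ) 1) :
    HasDerivAt (D.HL (a :: w) p) (D.K a p x * D.HL w p x) x :=
  hL_hasDerivAt _ _ (D.gd (a :: w) p) (D.vld hv p) hx.1 hx.2

variable (D) in
/-- Existence of a primitive. -/
def HasPrim (f : P → ℝ → ℝ) : Prop := ∃ G, MR D Set.univ G ∧ ∃ c ∈ D.C, ∀ p, ∀ x ∈ Set.Ioo (0:ℝ) 1,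
  HasDerivAt (fun x => G p x + c p * Real.log x) (f p x) x

lemma HasPrim.add {f g} (hf : HasPrim D f) (hg : HasPrim D g) : HasPrim D (f + g) := by
  obtain ⟨G, hG, c, hc, h⟩ := hf
  obtain ⟨G', hG', c', hc', h'⟩ := hg
  refine ⟨G + G', hG.add hG', c + c', D.C.add_mem hc hc', fun p x hx => ?_⟩
  refine derivCongr ((h p x hx).add (h' p x hx)) (fun y => ?_) rfl
  simp only [Pi.add_apply]; ring

lemma HasPrim.congr {f g} (hf : HasPrim D f) (h : ∀ p, ∀ x ∈ Set.Ioo (0:ℝ) 1, f p x = g p x) : HasPrim D g := by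
  obtain ⟨G, hG, c, hc, h'⟩ := hf
  exact ⟨G, hG, c, hc, fun p x hx => by rw [← h p x hx]; exact h' p x hx⟩

lemma HasPrim.mulC {f} (hf : HasPrim D f) {d : P → ℝ} (hd : d ∈ D.C) : HasPrim D (fun p x => d p * f p x) := by
  obtain ⟨G, hG, c, hc, h⟩ := hf
  refine ⟨_, hG.mulC hd, d * c, D.C.mul_mem hd hc, fun p x hx => ?_⟩
  refine derivCongr ((h p x hx).const_mul (d p)) (fun y => ?_) rfl
  simp only [Pi.mul_apply]; ring

lemma HasPrim.of_deriv {f} (G : P → ℝ → ℝ) (hG : MR D Set.univ G)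
    (h : ∀ p, ∀ x ∈ Set.Ioo (0:ℝ) 1, HasDerivAt (G p) (f p x) x) : HasPrim D f :=
  ⟨G, hG, 0, D.C.zero_mem, fun p x hx => by simpa using h p x hx⟩

lemma ratC (r : ℚ) : (fun _ => (r:ℝ)) ∈ D.C := D.C.algebraMap_mem r

/-- Integration by parts: `A' L_w`, with `A` rational. -/
lemma HasPrim.ibp {w : List (Option ι)} (hv : Vld w) (ih : ∀ a w', w = a :: w' → ∀ f, MR D {w'} f → HasPrim D f)
    {A A' : P → ℝ → ℝ} (hA : ∀ (S : Set (List (Option ι))) f, MR D S f → MR D S (fun p x => A p x * f p x))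
    (hd : ∀ p, ∀ x ∈ Set.Ioo (0:ℝ) 1, HasDerivAt (A p) (A' p x) x) :
    HasPrim D (fun p x => A' p x * D.HL w p x) := by
  have h1 : MR D Set.univ (fun p x => A p x * D.HL w p x) :=
    hA _ _ (MR.mono' w (Set.mem_univ _) hv D.C.one_mem 0 fun p x _ => by simp)
  cases w with
  | nil =>
    refine HasPrim.of_deriv _ h1 fun p x hx => ?_
    refine derivCongr (hd p x hx) (fun y => by simp [HL_nil]) (by simp [HL_nil])
  | cons a w =>
    have h2 : HasPrim D (fun p x => A p x * (D.K a p x * D.HL w p x)) :=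
      ih a w rfl _ (hA _ _ (MR.mulK (f := D.HL w)
        (MR.mono' w (Set.mem_singleton _) hv.2 D.C.one_mem 0 fun p x _ => by simp) a))
    have h3 : HasPrim D (fun p x => A' p x * D.HL (a::w) p x + A p x * (D.K a p x * D.HL w p x)) := by
      refine HasPrim.of_deriv _ h1 fun p x hx => ?_
      exact (hd p x hx).mul (HL_deriv hv p hx)
    refine (h3.add (h2.mulC (ratC (-1)))).congr fun p x _ => ?_
    simp


lemma hasPrim_core {w : List (Option ι)} (ih : ∀ a w', w = a :: w' → ∀ f, MR D {w'} f → HasPrim D f)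
    (f) (hf : MR D {w} f) : HasPrim D f := by
  induction hf with
  | add _ _ h1 h2 => exact h1.add h2
  | congr _ h h1 => exact h1.congr h
  | mono w hw hv d hd j =>
    simp only [Set.mem_singleton_iff] at hw
    subst hw
    suffices H : HasPrim D (fun p x => x ^ j * D.HL w p x) from
      (H.mulC hd).congr fun p x _ => by ring
    rcases eq_or_ne j (-1) with rfl | hj
    · cases w with
      | nil =>
        refine ⟨_, MR.zero, 1, D.C.one_mem, fun p x hx => ?_⟩
        refine derivCongr (Real.hasDerivAt_log hx.1.ne') (fun y => by simp) (by simp [HL_nil])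
      | cons a w =>
        have hv' : Vld (none :: a :: w) := ⟨by simp, hv⟩
        refine HasPrim.of_deriv (D.HL (none :: a :: w))
          (MR.mono' _ (Set.mem_univ _) hv' D.C.one_mem 0 fun p x _ => by simp) fun p x hx => ?_
        refine derivCongr (HL_deriv hv' p hx) (fun y => rfl) ?_
        simp [PD.K, kf]
    · have hj' : (j:ℝ) + 1 ≠ 0 := by
        intro h; apply hj; have : ((j+1 : ℤ):ℝ) = 0 := by push_cast; exact h
        have := Int.cast_eq_zero.1 this; omega
      refine HasPrim.ibp (A := fun _ x => (((1/(j+1) : ℚ)) : ℝ) * x ^ (j+1)) hv ih (fun S f hf => ?_) fun p x hx => ?_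
      · exact ((hf.mulZpow (j+1)).mulC (ratC (1/(j+1)))).congr fun p x _ => by ring
      · refine derivCongr ((hasDerivAt_zpow (j+1) x (Or.inl hx.1.ne')).const_mul (((1/(j+1) : ℚ)) : ℝ))
          (fun y => rfl) ?_
        push_cast
        rw [add_sub_cancel_right]
        field_simp
  | pole w hw hv d hd k m =>
    simp only [Set.mem_singleton_iff] at hw
    subst hw
    suffices H : HasPrim D (fun p x => (1 - D.ρ k p * x)⁻¹ ^ (m+1) * D.HL w p x) from
      (H.mulC hd).congr fun p x _ => by ring
    cases m with
    | zero =>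
      have hv' : Vld (some k :: w) := ⟨by simp, hv⟩
      have : HasPrim D (fun p x => D.K (some k) p x * D.HL w p x) :=
        HasPrim.of_deriv (D.HL (some k :: w))
          (MR.mono' _ (Set.mem_univ _) hv' D.C.one_mem 0 fun p x _ => by simp) fun p x hx => HL_deriv hv' p hx
      refine (this.mulC (D.inv_mem k)).congr fun p x hx => ?_
      have := (D.pos k p).ne'
      simp [PD.K, kf]
      field_simp
    | succ m =>
      refine HasPrim.ibp (A := fun p x => ((((1/(m+1) : ℚ)) : ℝ) * (D.ρ k p)⁻¹) * ((1 - D.ρ k p * x)⁻¹) ^ (m+1))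
        hv ih (fun S f hf => ?_) fun p x hx => ?_
      · have : ∀ n : ℕ, MR D S (fun p x => (1 - D.ρ k p * x)⁻¹ ^ n * f p x) := by
          intro n
          induction n with
          | zero => simpa using hf
          | succ n ih => exact (ih.mulPole k).congr fun p x _ => by ring
        exact ((this (m+1)).mulC (D.C.mul_mem (ratC (1/(m+1))) (D.inv_mem k))).congr fun p x _ => by
          simp only [Pi.mul_apply]; ring
      · have h1 := (D.den_pos k p hx).ne'
        have h2 := (D.pos k p).ne'
        have h3 : HasDerivAt (fun x => 1 - D.ρ k p * x) (- D.ρ k p) x := by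
          simpa using ((hasDerivAt_id x).const_mul (D.ρ k p)).const_sub 1
        refine derivCongr (((h3.inv h1).pow (m+1)).const_mul ((((1/(m+1) : ℚ)) : ℝ) * (D.ρ k p)⁻¹)) (fun y => rfl) ?_
        have : (m:ℝ) + 1 ≠ 0 := by positivity
        push_cast
        simp only [Nat.add_sub_cancel, Pi.inv_apply]
        rw [pow_succ, pow_succ]
        field_simp

lemma hasPrim_word : ∀ (w : List (Option ι)) (f), MR D {w} f → HasPrim D f := by
  intro w
  induction w with
  | nil => exact hasPrim_core (by simp)
  | cons a w ih =>
    refine hasPrim_core fun a' w' h => ?_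
    simp only [List.cons.injEq] at h
    rw [← h.2]; exact ih

/-- Every element of the ring has a primitive. -/
lemma MR.hasPrim {f} (hf : MR D Set.univ f) : HasPrim D f := by
  induction hf with
  | add _ _ h1 h2 => exact h1.add h2
  | congr _ h h1 => exact h1.congr h
  | mono w hw hv d hd j => exact hasPrim_word w _ (MR.mono w (Set.mem_singleton _) hv d hd j)
  | pole w hw hv d hd k m => exact hasPrim_word w _ (MR.pole w (Set.mem_singleton _) hv d hd k m)

end ring

open MeasureTheory Filter Topology Asymptotics Polynomial

section expring
variable {P ι : Type} {D : PD P ι}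

lemma T0_sum {C : Subalgebra ℚ (P → ℝ)} (N : ℕ) (a : ℕ → P → ℝ) (ha : ∀ k, a k ∈ C) :
    (fun p u => ∑ k ∈ Finset.range N, a k p * u ^ k) ∈ T0 C := by
  have : (∑ k ∈ Finset.range N, ((fun p _ => a k p) * (fun _ u => u) ^ k : P → ℝ → ℝ)) ∈ T0 C :=
    (T0 C).sum_mem fun k _ => (T0 C).mul_mem (T0_const (ha k)) ((T0 C).pow_mem T0_u k)
  convert this using 1
  ext p u
  simp

lemma Exp.mono {T T' : Subalgebra ℚ (P → ℝ → ℝ)} (h : T ≤ T') {f} (hf : Exp T f) : Exp T' f := by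
  intro N
  obtain ⟨t, ht, hb⟩ := hf N
  exact ⟨t, h ht, hb⟩

lemma Exp.geom {C : Subalgebra ℚ (P → ℝ)} {r : P → ℝ} (hr : r ∈ C) :
    Exp (T0 C) (fun p u => (1 - r p * u)⁻¹) := by
  intro N
  refine ⟨_, T0_sum N (fun k => r ^ k) (fun k => C.pow_mem hr k), fun p => ?_⟩
  have hlim : Tendsto (fun u : ℝ => 1 - r p * u) (𝓝[>] 0) (𝓝 1) := by
    have : ContinuousAt (fun u : ℝ => 1 - r p * u) 0 := by fun_prop
    have h := this.tendsto
    simp only [mul_zero, sub_zero] at h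
    exact h.mono_left nhdsWithin_le_nhds
  have hne : ∀ᶠ u in 𝓝[>] (0:ℝ), 1 - r p * u ≠ 0 := hlim.eventually_ne one_ne_zero
  have hO : (fun u : ℝ => r p ^ N * (1 - r p * u)⁻¹) =O[𝓝[>] 0] (fun _ => (1:ℝ)) :=
    ((hlim.inv₀ one_ne_zero).const_mul (r p ^ N)).isBigO_one ℝ
  have := hO.mul (isBigO_refl (fun u : ℝ => u ^ N) (𝓝[>] 0))
  refine this.congr' ?_ (by simp)
  filter_upwards [hne] with u hu
  have hs : ∑ k ∈ Finset.range N, (r ^ k) p * u ^ k = ∑ k ∈ Finset.range N, (r p * u) ^ k :=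
    Finset.sum_congr rfl fun k _ => by rw [mul_pow]; rfl
  rw [hs]
  have h3 := geom_sum_mul (r p * u) N
  have h4 : ∑ k ∈ Finset.range N, (r p * u) ^ k = (1 - (r p * u) ^ N) * (1 - r p * u)⁻¹ := by
    rw [eq_mul_inv_iff_mul_eq₀ hu]; linear_combination -h3
  rw [h4, mul_pow]; ring

lemma hA_mem (w : List (Option ι)) : ∀ N, (fun p => hA (D.wv w p) N) ∈ D.C := by
  induction w with
  | nil =>
    intro N
    have := D.C.algebraMap_mem (if N = 0 then 1 else 0)
    convert this using 1
    ext p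
    simp only [PD.wv, List.map_nil, hA]
    split_ifs <;> simp
  | cons a w ih =>
    intro N
    cases a with
    | none =>
      convert D.C.mul_mem (ih N) (ratC (1 / N)) using 1
      ext p
      simp [PD.wv, hA, opA, div_eq_mul_inv]
    | some i =>
      have h := D.C.mul_mem (D.C.sum_mem (t := Finset.range N) fun M _ =>
        D.C.mul_mem (D.C.pow_mem (D.mem i) (N - M)) (ih M)) (ratC (1 / N))
      convert h using 1
      ext p
      simp [PD.wv, hA, opA, div_eq_mul_inv]

lemma hL_trunc (w) (h : Gd w) (M : ℕ) :
    (fun u => hL w u - ∑ N ∈ Finset.range M, hA w N * u ^ N) =O[𝓝[>] 0] (fun u : ℝ => u ^ M) := by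
  apply IsBigO.of_bound 2
  filter_upwards [Ioo_mem_nhdsGT (show (0:ℝ) < 1/2 by norm_num)] with u hu
  have hu1 : |u| < 1 := by rw [abs_of_pos hu.1]; linarith [hu.2]
  have hs := (summable_hL w h hu1).of_norm
  have h1 : hL w u - ∑ N ∈ Finset.range M, hA w N * u ^ N = ∑' N, hA w (N + M) * u ^ (N + M) := by
    rw [hL, ← hs.sum_add_tsum_nat_add M]; ring
  rw [h1]
  have hg := summable_geometric_of_lt_one hu.1.le (by linarith [hu.2] : u < 1)
  have h2 : ‖∑' N, hA w (N + M) * u ^ (N + M)‖ ≤ ∑' N : ℕ, u ^ M * u ^ N := by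
    refine tsum_of_norm_bounded (hg.mul_left _).hasSum fun N => ?_
    refine (hA_term_le w h (N+M) (le_of_eq (abs_of_pos hu.1))).trans (le_of_eq ?_)
    rw [pow_add, mul_comm]
  refine h2.trans ?_
  rw [tsum_mul_left, tsum_geometric_of_lt_one hu.1.le (by linarith [hu.2])]
  rw [norm_pow, Real.norm_eq_abs, abs_of_pos hu.1, mul_comm]
  have : (1 - u)⁻¹ ≤ 2 := by
    rw [inv_le_comm₀ (by linarith [hu.2]) (by norm_num)]; linarith [hu.2]
  have := hu.1
  gcongr

lemma Exp.HL0 (w : List (Option ι)) : Exp (T0 D.C) (D.HL w) := fun N =>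
  ⟨_, T0_sum N (fun k p => hA (D.wv w p) k) (fun k => hA_mem w k), fun p => hL_trunc _ (D.gd w p) N⟩

lemma Exp.pow {C : Subalgebra ℚ (P → ℝ)} {T : Subalgebra ℚ (P → ℝ → ℝ)} (hT : T ≤ T1 C) {f} (hf : Exp T f) (n : ℕ) :
    Exp T (f ^ n) := by
  induction n with
  | zero => simpa using Exp.of_mem T.one_mem
  | succ n ih => rw [pow_succ]; exact ih.mul hT hf

/-- Expansion at zero. -/
lemma MR.exp0 {f} (hf : MR D Set.univ f) : Exp (T0 D.C) f := by
  have hT := T0_le_T1 D.C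
  induction hf with
  | add _ _ h1 h2 => exact h1.add h2
  | congr _ h h1 => exact h1.congr h
  | mono w hw hv d hd j =>
    exact ((Exp.of_mem (T0_const hd)).mul hT (Exp.of_mem (T0_zpow j))).mul hT (Exp.HL0 w)
  | pole w hw hv d hd k m =>
    exact ((Exp.of_mem (T0_const hd)).mul hT ((Exp.geom (D.mem k)).pow hT (m+1))).mul hT (Exp.HL0 w)

lemma hL_one_log {x : ℝ} (hx : x ∈ Set.Ioo (0:ℝ) 1) : hL [some 1] x = - Real.log (1 - x) := by
  have h := Real.hasSum_pow_div_log_of_abs_lt_one (x := x) (by rw [abs_of_pos hx.1]; exact hx.2)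
  rw [← h.tsum_eq, hL]
  have hs : Summable (fun N => hA [some 1] N * x ^ N) :=
    (summable_hL [some 1] (by intro r hr; simp at hr; subst hr; norm_num) (by rw [abs_of_pos hx.1]; exact hx.2)).of_norm
  rw [hs.tsum_eq_zero_add, hA_zero]
  simp only [zero_mul, zero_add]
  refine tsum_congr fun N => ?_
  simp only [hA, opA]
  simp
  ring

/-- Reflection. -/
def fl (f : P → ℝ → ℝ) : P → ℝ → ℝ := fun p u => f p (1 - u)

lemma exp1_pow (j : ℤ) {C : Subalgebra ℚ (P → ℝ)} : Exp (T1 C) (fun _ u => (1 - u) ^ j : P → ℝ → ℝ) := by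
  cases j with
  | ofNat n =>
    have : Exp (T1 C) ((fun _ u => 1 - u : P → ℝ → ℝ) ^ n) :=
      (Exp.of_mem (T0_le_T1 C ((T0 C).sub_mem (T0 C).one_mem T0_u))).pow le_rfl n
    convert this using 1
    ext p u; simp
  | negSucc n =>
    have : Exp (T1 C) ((fun p u => (1 - (1 : P → ℝ) p * u)⁻¹ : P → ℝ → ℝ) ^ (n+1)) :=
      ((Exp.geom C.one_mem).mono (T0_le_T1 C)).pow le_rfl (n+1)
    convert this using 1
    ext p u; simp [zpow_negSucc]

lemma exp1_pole (i : ι) : Exp (T1 D.C) (fun p u => (1 - D.ρ i p * (1 - u))⁻¹) := by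
  by_cases hi : i = D.o
  · subst hi
    refine (Exp.of_mem (T0_le_T1 D.C (T0_inv (C := D.C)))).congr fun p u _ => ?_
    rw [D.one]; simp
  · have hm : (fun p => (1 - D.ρ i p)⁻¹) ∈ D.C := by
      have := D.sub_mem D.o i (Ne.symm hi)
      simpa only [D.one] using this
    have h1 := Exp.geom (D.C.mul_mem (D.C.neg_mem (D.mem i)) hm)
    have h2 := (Exp.of_mem (T0_const hm)).mul (T0_le_T1 D.C) h1
    refine (h2.mono (T0_le_T1 D.C)).congr fun p u _ => ?_
    have h3 : 1 - D.ρ i p ≠ 0 := (sub_pos.2 (D.lt_one hi p)).ne'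
    simp only [Pi.mul_apply, Pi.neg_apply]
    rw [← mul_inv]
    congr 1
    field_simp
    ring

lemma exp1_K (a : Option ι) : Exp (T1 D.C) (fl (D.K a)) := by
  cases a with
  | none =>
    refine (exp1_pow (-1)).congr fun p u _ => ?_
    simp [fl, PD.K, kf]
  | some i =>
    exact ((Exp.of_mem (T0_le_T1 D.C (T0_const (D.mem i)))).mul le_rfl (exp1_pole i)).congr fun p u _ => by
      simp [fl, PD.K, kf]

/-- Number of leading letters `a`. -/
noncomputable def lead {α : Type} (a : α) : List α → ℕ
  | [] => 0
  | b :: w => open Classical in if b = a then lead a w + 1 else 0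

lemma shf_single {α : Type} (a : α) : ∀ (w : List α), a :: w ∈ shf [a] w ∧
    ∀ u ∈ shf [a] w, u = a :: w ∨ lead a u ≤ lead a w
  | [] => by simp [shf]
  | b :: v => by
    obtain ⟨-, ih2⟩ := shf_single a v
    have : shf [a] (b :: v) = (a :: b :: v) :: (shf [a] v).map (b :: ·) := by
      rw [shf]; simp [shf]
    rw [this]
    refine ⟨by simp, fun u hu => ?_⟩
    rw [List.mem_cons, List.mem_map] at hu
    rcases hu with rfl | ⟨u', hu', rfl⟩
    · exact Or.inl rfl
    · by_cases hb : b = a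
      · subst hb
        rcases ih2 u' hu' with rfl | h
        · exact Or.inl rfl
        · right; simp [lead, h]
      · right; simp [lead, hb]

lemma list_extract {α : Type} {C : Subalgebra ℚ (P → ℝ)} (f : α → P → ℝ → ℝ) (x : α) (l : List α)
    (h : ∀ y ∈ l, y = x ∨ Exp (T1 C) (f y)) : ∃ (m : ℕ) (e : P → ℝ → ℝ), Exp (T1 C) e ∧
      (∀ p u, (l.map fun y => f y p u).sum = m * f x p u + e p u) ∧ (x ∈ l → 1 ≤ m) := by
  induction l with
  | nil => exact ⟨0, 0, Exp.of_mem (T1 C).zero_mem, by simp, by simp⟩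
  | cons y l ih =>
    obtain ⟨m, e, he, hs, hm⟩ := ih fun z hz => h z (by simp [hz])
    by_cases hy : y = x
    · subst hy
      exact ⟨m + 1, e, he, fun p u => by simp [hs]; ring, fun _ => by omega⟩
    · have := (h y (by simp)).resolve_left hy
      refine ⟨m, f y + e, this.add he, fun p u => by simp [hs]; ring, fun hx => hm ?_⟩
      rcases List.mem_cons.1 hx with h | h
      · exact absurd h.symm hy
      · exact h

variable (D) in
/-- The values at one lie in the coefficient ring. -/
def ZIn : Prop := ∀ w : List (Option ι), Vld w → w.head? ≠ some (some D.o) → (fun p => hZ (D.wv w p)) ∈ D.C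

lemma tendsto_one_sub : Tendsto (fun u : ℝ => 1 - u) (𝓝[>] 0) (𝓝[<] 1) := by
  refine tendsto_nhdsWithin_iff.2 ⟨?_, ?_⟩
  · have : ContinuousAt (fun u : ℝ => 1 - u) 0 := by fun_prop
    have h := this.tendsto
    simp only [sub_zero] at h
    exact h.mono_left nhdsWithin_le_nhds
  · filter_upwards [self_mem_nhdsWithin] with u hu
    have : 0 < u := hu
    simpa using this

lemma exp1_HL (hZin : ZIn D) : ∀ (n : ℕ) (w : List (Option ι)), w.length = n → Vld w →
    Exp (T1 D.C) (fl (D.HL w)) := by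
  intro n
  induction n with
  | zero =>
    intro w hw _
    rw [List.length_eq_zero_iff] at hw
    subst hw
    exact (Exp.of_mem (T1 D.C).one_mem).congr fun p u _ => by simp [fl, HL_nil]
  | succ n ih =>
    suffices H : ∀ (k : ℕ) (w : List (Option ι)), lead (some D.o) w ≤ k → w.length = n + 1 → Vld w →
        Exp (T1 D.C) (fl (D.HL w)) from fun w => H _ w le_rfl
    have conv : ∀ (w : List (Option ι)), w.head? ≠ some (some D.o) → w.length = n + 1 → Vld w →
        Exp (T1 D.C) (fl (D.HL w)) := by
      intro w hc hn hv
      cases w with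
      | nil => simp at hn
      | cons a w =>
        have h1 := (exp1_K (D := D) a).mul le_rfl (ih w (by simpa using hn) hv.2)
        have h2 := (Exp.of_mem (T0_le_T1 D.C (T0_const (ratC (D := D) (-1))))).mul le_rfl h1
        refine Exp.integ h2 (fun p u h0 h1 => ?_) (hZin _ hv hc) fun p => ?_
        · have hx : (1 - u) ∈ Set.Ioo (0:ℝ) 1 := ⟨by linarith, by linarith⟩
          have h3 : HasDerivAt (fun u : ℝ => 1 - u) (-1) u := by
            simpa using (hasDerivAt_id u).const_sub 1
          refine derivCongr ((HL_deriv hv p hx).comp u h3) (fun y => rfl) ?_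
          simp only [Pi.mul_apply, fl]
          push_cast; ring
        · exact (hL_tendsto _ (D.gd _ p) (D.cv hc p)).comp tendsto_one_sub
    intro k
    induction k with
    | zero =>
      intro w hk hn hv
      refine conv w ?_ hn hv
      cases w with
      | nil => simp
      | cons a w =>
        simp only [List.head?_cons, ne_eq, Option.some.injEq]
        rintro rfl
        simp [lead] at hk
    | succ k ihk =>
      intro w hk hn hv
      by_cases hc : w.head? ≠ some (some D.o)
      · exact conv w hc hn hv
      cases w with
      | nil => simp at hc
      | cons a w =>
        simp only [List.head?_cons, ne_eq, Option.some.injEq, not_not] at hc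
        subst hc
        have hv1 : Vld [some D.o] := ⟨by simp, trivial⟩
        obtain ⟨hm, hl⟩ := shf_single (some D.o) w
        obtain ⟨m, e, he, hs, hm1⟩ := list_extract (C := D.C) (fun v => fl (D.HL v)) (some D.o :: w)
          (shf [some D.o] w) (fun u hu => by
            rcases hl u hu with h | h
            · exact Or.inl h
            · refine Or.inr (ihk u ?_ ?_ (shf_vld _ _ hv1 hv.2 u hu))
              · simp [lead] at hk; omega
              · rw [shf_length _ _ u hu, ← hn]; simp; omega)
        have hm2 := hm1 hm
        have h1 : Exp (T1 D.C) (fl (D.HL [some D.o])) := by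
          refine (Exp.of_mem ((T1 D.C).neg_mem T1_log)).congr fun p u hu => ?_
          simp only [fl, PD.HL, PD.wv, List.map_cons, Option.map_some, List.map_nil, D.one]
          rw [hL_one_log ⟨by linarith [hu.2], by linarith [hu.1]⟩]
          simp
        have h2 := h1.mul le_rfl (ih w (by simpa using hn) hv.2)
        have h3 := h2.add ((Exp.of_mem (T0_le_T1 D.C (T0_const (ratC (D := D) (-1))))).mul le_rfl he)
        have h4 := (Exp.of_mem (T0_le_T1 D.C (T0_const (ratC (D := D) (1/m))))).mul le_rfl h3
        refine h4.congr fun p u hu => ?_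
        have h5 := hs p u
        have h6 := HL_mul (D := D) hv1 hv.2 p (x := 1 - u) ⟨by linarith [hu.2], by linarith [hu.1]⟩
        simp only [fl] at h5
        rw [h5] at h6
        have : (m:ℝ) ≠ 0 := by
          have : (1:ℝ) ≤ m := by exact_mod_cast hm2
          linarith
        simp only [Pi.mul_apply, Pi.add_apply, fl, h6]
        push_cast
        field_simp
        ring

/-- Expansion at one. -/
lemma MR.exp1 (hZin : ZIn D) {f} (hf : MR D Set.univ f) : Exp (T1 D.C) (fl f) := by
  induction hf with
  | add _ _ h1 h2 => exact h1.add h2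
  | congr _ h h1 => exact h1.congr fun p u hu => h p (1-u) ⟨by linarith [hu.2], by linarith [hu.1]⟩
  | mono w hw hv d hd j =>
    exact ((Exp.of_mem (T0_le_T1 D.C (T0_const hd))).mul le_rfl (exp1_pow j)).mul le_rfl (exp1_HL hZin _ w rfl hv)
  | pole w hw hv d hd k m =>
    exact ((Exp.of_mem (T0_le_T1 D.C (T0_const hd))).mul le_rfl ((exp1_pole k).pow le_rfl (m+1))).mul le_rfl
      (exp1_HL hZin _ w rfl hv)

lemma pow_one_tendsto : Tendsto (fun u : ℝ => u ^ 1) (𝓝[>] 0) (𝓝 0) := by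
  simp only [pow_one]
  exact (tendsto_id (α := ℝ) (x := 𝓝 0)).mono_left (nhdsWithin_le_nhds (s := Set.Ioi 0))

/-- Limits of expandable functions. -/
lemma Exp.lim {C : Subalgebra ℚ (P → ℝ)} {f} (hf : Exp (T1 C) f) :
    ∃ κ ∈ C, ∀ p l, Tendsto (f p) (𝓝[>] 0) (𝓝 l) → l = κ p := by
  obtain ⟨t, ht, hb⟩ := hf 1
  obtain ⟨κ, hκ, h⟩ := T1_lim ht
  refine ⟨κ, hκ, fun p l hl => h p l ?_⟩
  have := hl.sub ((hb p).trans_tendsto pow_one_tendsto)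
  simpa using this

lemma prim_limits {F f : ℝ → ℝ} (hd : ∀ x ∈ Set.Ioo (0:ℝ) 1, HasDerivAt F (f x) x)
    (hi : IntegrableOn f (Set.Ioo 0 1)) : ∃ a b, Tendsto F (𝓝[>] 0) (𝓝 a) ∧ Tendsto F (𝓝[<] 1) (𝓝 b) ∧
      ∫ x in Set.Ioo (0:ℝ) 1, f x = b - a := by
  have hii : IntervalIntegrable f volume 0 1 := by
    rw [intervalIntegrable_iff_integrableOn_Ioo_of_le zero_le_one]; exact hi
  have hF : ∀ x ∈ Set.Ioo (0:ℝ) 1, F x = F (1/2) + ((∫ t in (0:ℝ)..x, f t) - ∫ t in (0:ℝ)..(1/2), f t) := by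
    intro x hx
    have h1 : IntervalIntegrable f volume 0 x := hii.mono_set (by
      rw [Set.uIcc_of_le hx.1.le, Set.uIcc_of_le zero_le_one]; exact Set.Icc_subset_Icc le_rfl hx.2.le)
    have h2 : IntervalIntegrable f volume 0 (1/2) := hii.mono_set (by
      rw [Set.uIcc_of_le (by norm_num), Set.uIcc_of_le zero_le_one]; exact Set.Icc_subset_Icc le_rfl (by norm_num))
    rw [intervalIntegral.integral_interval_sub_left h1 h2,
      intervalIntegral.integral_eq_sub_of_hasDerivAt (f := F) (fun y hy => hd y ?_) (h2.symm.trans h1)]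
    · ring
    · have hh : ((1:ℝ)/2) ∈ Set.Ioo (0:ℝ) 1 := ⟨by norm_num, by norm_num⟩
      exact (Set.ordConnected_Ioo.uIcc_subset hh hx) hy
  have hc : ContinuousOn (fun x => ∫ t in (0:ℝ)..x, f t) (Set.Icc 0 1) := by
    have := intervalIntegral.continuousOn_primitive_interval' (a := 0) hii (by simp)
    rwa [Set.uIcc_of_le zero_le_one] at this
  have h0 : Tendsto F (𝓝[>] 0) (𝓝 (F (1/2) + ((∫ t in (0:ℝ)..0, f t) - ∫ t in (0:ℝ)..(1/2), f t))) := by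
    have h1 := (hc 0 (by simp)).mono_left (nhdsWithin_mono 0 (Set.Ioo_subset_Icc_self (a := (0:ℝ)) (b := 1)))
    rw [nhdsWithin_Ioo_eq_nhdsGT one_pos] at h1
    refine (tendsto_const_nhds.add (h1.sub tendsto_const_nhds)).congr' ?_
    filter_upwards [Ioo_mem_nhdsGT one_pos] with x hx
    exact (hF x hx).symm
  have h1 : Tendsto F (𝓝[<] 1) (𝓝 (F (1/2) + ((∫ t in (0:ℝ)..1, f t) - ∫ t in (0:ℝ)..(1/2), f t))) := by
    have h1 := (hc 1 (by simp)).mono_left (nhdsWithin_mono 1 (Set.Ioo_subset_Icc_self (a := (0:ℝ)) (b := 1)))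
    rw [nhdsWithin_Ioo_eq_nhdsLT one_pos] at h1
    refine (tendsto_const_nhds.add (h1.sub tendsto_const_nhds)).congr' ?_
    filter_upwards [Ioo_mem_nhdsLT one_pos] with x hx
    exact (hF x hx).symm
  refine ⟨_, _, h0, h1, ?_⟩
  rw [intervalIntegral.integral_same, ← MeasureTheory.integral_Ioc_eq_integral_Ioo,
    ← intervalIntegral.integral_of_le zero_le_one]
  ring

/-- Integration of one variable. -/
lemma MR.step (hZin : ZIn D) {f} (hf : MR D Set.univ f) :
    ∃ g ∈ D.C, ∀ p, IntegrableOn (f p) (Set.Ioo 0 1) → ∫ x in Set.Ioo (0:ℝ) 1, f p x = g p := by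
  obtain ⟨G, hG, c, hc, hd⟩ := hf.hasPrim
  have e0 : Exp (T1 D.C) (fun p u => G p u + c p * Real.log u) :=
    (hG.exp0.mono (T0_le_T1 D.C)).add
      ((Exp.of_mem (T0_le_T1 D.C (T0_const hc))).mul le_rfl (Exp.of_mem T1_log))
  obtain ⟨κ0, hκ0, h0⟩ := e0.lim
  obtain ⟨κ1, hκ1, h1⟩ := (hG.exp1 hZin).lim
  refine ⟨κ1 - κ0, D.C.sub_mem hκ1 hκ0, fun p hi => ?_⟩
  obtain ⟨a, b, ha, hb, hI⟩ := prim_limits (hd p) hi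
  rw [hI, Pi.sub_apply, h0 p a ha]
  congr 1
  apply h1 p b
  have hl : Tendsto (fun x => c p * Real.log x) (𝓝[<] 1) (𝓝 0) := by
    have : ContinuousAt (fun x => c p * Real.log x) 1 := by
      have := Real.continuousAt_log (one_ne_zero)
      fun_prop
    have h := this.tendsto
    simp only [Real.log_one, mul_zero] at h
    exact h.mono_left nhdsWithin_le_nhds
  have := hb.sub hl
  simp only [add_sub_cancel_right, sub_zero] at this
  exact this.comp tendsto_one_sub

/-- Solutions of first order equations stay in the ring. -/
lemma MR.of_deriv {f H} (hf : MR D Set.univ f) (hd : ∀ p, ∀ x ∈ Set.Ioo (0:ℝ) 1, HasDerivAt (H p) (f p x) x)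
    (h0 : ∀ p, Tendsto (H p) (𝓝[>] 0) (𝓝 0)) : MR D Set.univ H := by
  obtain ⟨G, hG, c, hc, hG'⟩ := hf.hasPrim
  obtain ⟨t, ht, hb⟩ := hG.exp0 1
  obtain ⟨κ, hκ, hl⟩ := T0_lim ht c
  refine (hG.add ((MR.const hκ).mulC (ratC (-1)))).congr fun p x hx => ?_
  have hconst : ∀ y ∈ Set.Ioo (0:ℝ) 1, (G p y + c p * Real.log y) - H p y =
      (G p x + c p * Real.log x) - H p x := by
    intro y hy
    have hder : ∀ z ∈ Set.Ioo (0:ℝ) 1, HasDerivAt (fun y => (G p y + c p * Real.log y) - H p y) 0 z := fun z hz => by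
      exact derivCongr ((hG' p z hz).sub (hd p z hz)) (fun y => rfl) (by simp)
    exact isOpen_Ioo.is_const_of_deriv_eq_zero isPreconnected_Ioo
      (fun z hz => (hder z hz).differentiableAt.differentiableWithinAt) (fun z hz => (hder z hz).deriv) hy hx
  set e := (G p x + c p * Real.log x) - H p x with he
  have h1 : Tendsto (fun u => t p u + c p * Real.log u) (𝓝[>] 0) (𝓝 e) := by
    have h2 : Tendsto (fun u => H p u + e) (𝓝[>] 0) (𝓝 (0 + e)) := (h0 p).add tendsto_const_nhds
    have h3 := h2.sub ((hb p).trans_tendsto pow_one_tendsto)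
    rw [zero_add, sub_zero] at h3
    refine h3.congr' ?_
    filter_upwards [Ioo_mem_nhdsGT one_pos] with u hu
    have := hconst u hu
    linarith
  obtain ⟨h4, h5⟩ := hl p e h1
  rw [h5] at he
  simp only [Pi.add_apply]
  push_cast
  linarith

end expring

open MeasureTheory Filter Topology Asymptotics Polynomial

/-! ## Differentiating with respect to a parameter -/
section param
variable {ι : Type}

/-- Values of letters, some of which move with `z`. -/
def vz (r : ι → ℝ) (z : ℝ) : Option ι → ℝ
  | none => 1
  | some i => z * r i

/-- Values of words. -/
def wz (r : ι → ℝ) (z : ℝ) (w : List (Option (Option ι))) : List (Option ℝ) := w.map (Option.map (vz r z))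

lemma wz_cons (r : ι → ℝ) (z : ℝ) (a) (w) : wz r z (a :: w) = a.map (vz r z) :: wz r z w := rfl

/-- Monotone convex behaviour. -/
def NB (f f' : ℝ → ℝ) : Prop := (∀ z, HasDerivAt f (f' z) z) ∧ (∀ y, 0 ≤ y → 0 ≤ f y ∧ 0 ≤ f' y) ∧
  ∀ y z, 0 ≤ y → y ≤ z → f y + f' y * (z - y) ≤ f z

lemma NB.le {f f'} (h : NB f f') {y z : ℝ} (hy : 0 ≤ y) (hz : y ≤ z) : f y ≤ f z := by
  have h1 := h.2.2 y z hy hz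
  have h2 := (h.2.1 y hy).2
  nlinarith

lemma NB.add {f f' g g'} (hf : NB f f') (hg : NB g g') : NB (f + g) (f' + g') := by
  refine ⟨fun z => (hf.1 z).add (hg.1 z), fun y hy => ⟨add_nonneg (hf.2.1 y hy).1 (hg.2.1 y hy).1,
    add_nonneg (hf.2.1 y hy).2 (hg.2.1 y hy).2⟩, fun y z hy hz => ?_⟩
  have := hf.2.2 y z hy hz
  have := hg.2.2 y z hy hz
  simp only [Pi.add_apply]
  linarith

lemma NB.mul {f f' g g'} (hf : NB f f') (hg : NB g g') : NB (f * g) (f' * g + f * g') := by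
  refine ⟨fun z => (hf.1 z).mul (hg.1 z), fun y hy => ⟨mul_nonneg (hf.2.1 y hy).1 (hg.2.1 y hy).1,
    add_nonneg (mul_nonneg (hf.2.1 y hy).2 (hg.2.1 y hy).1) (mul_nonneg (hf.2.1 y hy).1 (hg.2.1 y hy).2)⟩,
    fun y z hy hz => ?_⟩
  have h1 := hf.2.2 y z hy hz
  have h2 := hg.2.2 y z hy hz
  obtain ⟨h3, h4⟩ := hf.2.1 y hy
  obtain ⟨h5, h6⟩ := hg.2.1 y hy
  have h7 : 0 ≤ z - y := by linarith
  simp only [Pi.add_apply, Pi.mul_apply]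
  have h8 : 0 ≤ f' y * (z - y) := by positivity
  have h9 : 0 ≤ g' y * (z - y) := by positivity
  calc _ ≤ (f y + f' y * (z - y)) * (g y + g' y * (z - y)) := by nlinarith [mul_nonneg h8 h9]
    _ ≤ f z * g z := by
      apply mul_le_mul h1 h2 (by positivity) (hf.2.1 z (hy.trans hz)).1

lemma NB.const {c : ℝ} (hc : 0 ≤ c) : NB (fun _ => c) (fun _ => 0) :=
  ⟨fun z => hasDerivAt_const z c, fun y hy => ⟨hc, le_rfl⟩, fun y z _ _ => by simp⟩

lemma NB.id : NB (fun z => z) (fun _ => 1) :=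
  ⟨fun z => hasDerivAt_id z, fun y hy => ⟨hy, zero_le_one⟩, fun y z _ _ => by linarith⟩

lemma NB.pow {f f'} (hf : NB f f') (n : ℕ) : ∃ g, NB (f ^ n) g := by
  induction n with
  | zero => exact ⟨fun _ => 0, by rw [pow_zero]; exact NB.const zero_le_one⟩
  | succ n ih => obtain ⟨g, hg⟩ := ih; exact ⟨_, by rw [pow_succ]; exact hg.mul hf⟩

lemma NB.sum {β : Type} (s : Finset β) (f : β → ℝ → ℝ) (h : ∀ b ∈ s, ∃ g, NB (f b) g) :
    ∃ g, NB (fun z => ∑ b ∈ s, f b z) g := by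
  classical
  induction s using Finset.induction_on with
  | empty => exact ⟨_, by simpa using NB.const (le_refl (0:ℝ))⟩
  | insert a s ha ih =>
    obtain ⟨g, hg⟩ := h a (by simp)
    obtain ⟨g', hg'⟩ := ih fun b hb => h b (by simp [hb])
    refine ⟨g + g', ?_⟩
    simp only [Finset.sum_insert ha]; exact hg.add hg'

lemma hA_NB {r : ι → ℝ} (hr : ∀ i, 0 ≤ r i) (w : List (Option (Option ι))) :
    ∀ N, ∃ g, NB (fun z => hA (wz r z w) N) g := by
  induction w with
  | nil =>
    intro N
    refine ⟨_, NB.const (c := if N = 0 then 1 else 0) (by split_ifs <;> simp)⟩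
  | cons a w ih =>
    intro N
    have hN : (0:ℝ) ≤ (N:ℝ)⁻¹ := by positivity
    rcases a with _ | b
    · obtain ⟨g, hg⟩ := ih N
      exact ⟨_, hg.mul (NB.const hN)⟩
    · have hb : ∃ g, NB (fun z => vz r z b) g := by
        cases b with
        | none => exact ⟨_, NB.const zero_le_one⟩
        | some i => exact ⟨_, NB.id.mul (NB.const (hr i))⟩
      obtain ⟨g, hg⟩ := hb
      have := NB.sum (Finset.range N) (fun M z => vz r z b ^ (N - M) * hA (wz r z w) M) fun M _ => by
        obtain ⟨g1, hg1⟩ := hg.pow (N - M)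
        obtain ⟨g2, hg2⟩ := ih M
        exact ⟨_, hg1.mul hg2⟩
      obtain ⟨g', hg'⟩ := this
      exact ⟨_, hg'.mul (NB.const hN)⟩

/-- Moving words. -/
def Mov (w : List (Option (Option ι))) : Prop := ∃ i, some (some i) ∈ w

lemma hA_ZB {r : ι → ℝ} (hr : ∀ i, 0 ≤ r i) (w : List (Option (Option ι))) (hw : Mov w) {y z : ℝ} (hy : 0 < y)
    (hz : y ≤ z) : ∀ N, z * hA (wz r y w) N ≤ y * hA (wz r z w) N := by
  induction w with
  | nil => obtain ⟨i, hi⟩ := hw; simp at hi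
  | cons a w ih =>
    intro N
    have hN : (0:ℝ) ≤ (N:ℝ)⁻¹ := by positivity
    have hz0 : 0 < z := hy.trans_le hz
    rcases a with _ | b
    · have : Mov w := by
        obtain ⟨i, hi⟩ := hw; exact ⟨i, by simpa using hi⟩
      have := mul_le_mul_of_nonneg_right (ih this N) hN
      simp only [wz_cons, Option.map_none, hA, opA, div_eq_mul_inv]
      linarith
    · simp only [wz_cons, Option.map_some, hA, opA, div_eq_mul_inv]
      rw [← mul_assoc, ← mul_assoc]
      refine mul_le_mul_of_nonneg_right ?_ hN
      rw [Finset.mul_sum, Finset.mul_sum]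
      refine Finset.sum_le_sum fun M hM => ?_
      have hM' : M < N := Finset.mem_range.1 hM
      obtain ⟨g, hg⟩ := hA_NB hr w M
      cases b with
      | none =>
        have hw' : Mov w := by
          obtain ⟨i, hi⟩ := hw; exact ⟨i, by simpa using hi⟩
        simpa [vz] using ih hw' M
      | some i =>
        obtain ⟨k, hk⟩ : ∃ k, N - M = k + 1 := ⟨N - M - 1, by omega⟩
        simp only [vz]
        rw [hk]
        have h1 : hA (wz r y w) M ≤ hA (wz r z w) M := hg.le hy.le hz
        have h2 : 0 ≤ hA (wz r y w) M := (hg.2.1 y hy.le).1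
        have h3 := hr i
        calc z * ((y * r i) ^ (k+1) * hA (wz r y w) M) = (z * y * r i) * (y * r i) ^ k * hA (wz r y w) M := by ring
          _ ≤ (z * y * r i) * (z * r i) ^ k * hA (wz r z w) M := by gcongr
          _ = y * ((z * r i) ^ (k+1) * hA (wz r z w) M) := by ring

/-- Is the letter moving? -/
def eps : Option (Option ι) → ℝ
  | some (some _) => 1
  | _ => 0

/-- Is the first letter moving? -/
def epsH : List (Option (Option ι)) → ℝ
  | [] => 0
  | a :: _ => eps a

/-- The correction term in the differential equation. -/
noncomputable def Rw (r : ι → ℝ) (z : ℝ) : List (Option (Option ι)) → ℕ → ℝ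
  | [] => fun _ => 0
  | a :: w => fun N => opA (a.map (vz r z)) (Rw r z w) N +
      (epsH w - eps a) * opA (a.map (vz r z)) (fun M => M * hA (wz r z w) M) N

lemma hA_theta (r : ι → ℝ) {z : ℝ} (hz : z ≠ 0) (w : List (Option (Option ι))) : ∀ N,
    HasDerivAt (fun z => hA (wz r z w) N) (z⁻¹ * (epsH w * (N * hA (wz r z w) N) + Rw r z w N)) z := by
  induction w with
  | nil =>
    intro N
    exact derivCongr (hasDerivAt_const z (if N = 0 then (1:ℝ) else 0)) (fun y => rfl) (by simp [epsH, Rw])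
  | cons a w ih =>
    intro N
    rcases Nat.eq_zero_or_pos N with rfl | hN
    · refine derivCongr (hasDerivAt_const z (0:ℝ)) (fun y => ?_) ?_
      · rw [wz_cons, hA_zero]
      · have : ∀ (a : Option ℝ) c, opA a c 0 = 0 := by intro a c; cases a <;> simp [opA]
        simp [Rw, this]
    have hN' : (N:ℝ) ≠ 0 := by positivity
    rcases a with _ | b
    · refine derivCongr ((ih N).div_const (N:ℝ)) (fun y => rfl) ?_
      simp only [epsH, eps, Rw, opA, Option.map_none]
      ring
    · have hb : HasDerivAt (fun z => vz r z b) (z⁻¹ * (eps (some b) * vz r z b)) z := by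
        cases b with
        | none => exact derivCongr (hasDerivAt_const z (1:ℝ)) (fun y => rfl) (by simp [eps])
        | some i =>
          exact derivCongr ((hasDerivAt_id z).mul_const (r i)) (fun y => rfl)
            (by simp only [eps, vz]; field_simp)
      have h1 := HasDerivAt.fun_sum (u := Finset.range N) fun M _ => (hb.pow (N - M)).mul (ih M)
      refine derivCongr (h1.div_const (N:ℝ)) (fun y => ?_) ?_
      · simp [wz_cons, hA, opA]
      · rw [show epsH (some b :: w) = eps (some b) from rfl]
        simp only [Rw, opA, Option.map_some, wz_cons, hA]
        have h2 : ∀ M ∈ Finset.range N,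
            ((((N - M : ℕ) : ℝ) * (vz r z b) ^ (N - M - 1) * (z⁻¹ * (eps (some b) * vz r z b))) * hA (wz r z w) M +
             ((fun z => vz r z b) ^ (N - M)) z * (z⁻¹ * (epsH w * (M * hA (wz r z w) M) + Rw r z w M))) =
             z⁻¹ * (eps (some b) * N * (vz r z b ^ (N - M) * hA (wz r z w) M) +
              vz r z b ^ (N - M) * Rw r z w M + (epsH w - eps (some b)) * (vz r z b ^ (N-M) * (M * hA (wz r z w) M))) := by
          intro M hM
          have hM' : M < N := Finset.mem_range.1 hM
          obtain ⟨k, hk⟩ : ∃ k, N - M = k + 1 := ⟨N - M - 1, by omega⟩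
          have hk' : (k:ℝ) = N - M - 1 := by
            have : N = M + (k + 1) := by omega
            rw [this]; push_cast; ring
          rw [hk]
          simp only [Nat.add_sub_cancel, Pi.pow_apply]
          push_cast
          rw [hk', pow_succ]
          ring
        rw [Finset.sum_congr rfl h2, ← Finset.mul_sum, Finset.sum_add_distrib, Finset.sum_add_distrib,
          ← Finset.mul_sum, ← Finset.mul_sum]
        field_simp
        ring

/-- Geometric convolution. -/
noncomputable def Sg (α : ℝ) (d : ℕ → ℝ) (N : ℕ) : ℝ := ∑ M ∈ Finset.range N, α ^ (N - M) * d M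

lemma Sg_succ (α : ℝ) (d : ℕ → ℝ) (N : ℕ) : Sg α d (N + 1) = α * (Sg α d N + d N) := by
  unfold Sg
  rw [Finset.sum_range_succ, mul_add, Finset.mul_sum]
  congr 1
  · refine Finset.sum_congr rfl fun M hM => ?_
    have : M < N := Finset.mem_range.1 hM
    rw [show N + 1 - M = (N - M) + 1 by omega]; ring
  · simp

lemma Sg_zero (α : ℝ) (d : ℕ → ℝ) : Sg α d 0 = 0 := by simp [Sg]

lemma opA_some (α : ℝ) (d : ℕ → ℝ) (N : ℕ) : opA (some α) d N = Sg α d N / N := rfl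

lemma N_mul_hA (α : ℝ) (w) (N : ℕ) : N * hA (some α :: w) N = Sg α (hA w) N := by
  rcases Nat.eq_zero_or_pos N with rfl | hN
  · simp [Sg_zero]
  · have hN' : (N:ℝ) ≠ 0 := by positivity
    show (N:ℝ) * opA (some α) (hA w) N = _
    rw [opA_some]; field_simp

lemma Sg_Sg (α β : ℝ) (d : ℕ → ℝ) (N : ℕ) : (α - β) * Sg α (Sg β d) N = β * Sg α d N - α * Sg β d N := by
  induction N with
  | zero => simp [Sg_zero]
  | succ N ih => simp only [Sg_succ]; linear_combination α * ih

lemma op_MA_real {α β : ℝ} (h : α ≠ β) (w) (N : ℕ) :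
    opA (some α) (fun M => M * hA (some β :: w) M) N =
      β * (α - β)⁻¹ * hA (some α :: w) N - α * (α - β)⁻¹ * hA (some β :: w) N := by
  have h0 : α - β ≠ 0 := sub_ne_zero.2 h
  simp only [N_mul_hA]
  show opA (some α) (fun M => Sg β (hA w) M) N = β * (α - β)⁻¹ * opA (some α) (hA w) N -
    α * (α - β)⁻¹ * opA (some β) (hA w) N
  rw [opA_some, opA_some, opA_some]
  have := Sg_Sg α β (hA w) N
  have h2 : Sg α (fun M => Sg β (hA w) M) N = (α - β)⁻¹ * (β * Sg α (hA w) N - α * Sg β (hA w) N) := by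
    rw [← this]; field_simp
  rw [h2]; ring

lemma op_MA_none_left (b : Option ℝ) (w) (N : ℕ) :
    opA none (fun M => M * hA (b :: w) M) N = hA (b :: w) N := by
  rcases Nat.eq_zero_or_pos N with rfl | hN
  · simp [opA, hA_zero]
  · have hN' : (N:ℝ) ≠ 0 := by positivity
    simp only [opA]; field_simp

lemma op_MA_none_right (a b : Option ℝ) (w) (N : ℕ) :
    opA a (fun M => M * hA (none :: b :: w) M) N = hA (a :: b :: w) N := by
  have : (fun M : ℕ => (M:ℝ) * hA (none :: b :: w) M) = hA (b :: w) := by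
    ext M
    rcases Nat.eq_zero_or_pos M with rfl | hM
    · simp [hA_zero]
    · have hM' : (M:ℝ) ≠ 0 := by positivity
      show (M:ℝ) * (hA (b :: w) M / M) = _
      field_simp
  rw [this]; rfl

lemma Sg_tendsto {α : ℝ} (h0 : 0 ≤ α) (h1 : α < 1) {d : ℕ → ℝ} (hd0 : ∀ N, 0 ≤ d N)
    (hd : Tendsto d atTop (𝓝 0)) : Tendsto (Sg α d) atTop (𝓝 0) := by
  have hnn : ∀ N, 0 ≤ Sg α d N := fun N => Finset.sum_nonneg fun M _ => mul_nonneg (pow_nonneg h0 _) (hd0 M)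
  rw [Metric.tendsto_atTop]
  intro ε hε
  set δ := ε * (1 - α) / 2 with hδ
  have hα : 0 < 1 - α := by linarith
  have hδ0 : 0 < δ := by positivity
  obtain ⟨N0, hN0⟩ := (Metric.tendsto_atTop.1 hd) δ hδ0
  have hb : ∀ k, Sg α d (N0 + k) ≤ α ^ k * Sg α d N0 + ε / 2 := by
    intro k
    induction k with
    | zero => simp; linarith
    | succ k ih =>
      have h2 := hN0 (N0 + k) (by omega)
      rw [Real.dist_eq, sub_zero, abs_of_nonneg (hd0 _)] at h2
      rw [← add_assoc, Sg_succ]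
      calc _ ≤ α * ((α ^ k * Sg α d N0 + ε / 2) + δ) := by gcongr
        _ = α ^ (k+1) * Sg α d N0 + α * (ε/2 + δ) := by ring
        _ ≤ α ^ (k+1) * Sg α d N0 + ε / 2 := by
          rw [hδ]; nlinarith
  have hp : Tendsto (fun k : ℕ => α ^ k * Sg α d N0) atTop (𝓝 0) := by
    simpa using (tendsto_pow_atTop_nhds_zero_of_lt_one h0 h1).mul_const (Sg α d N0)
  obtain ⟨k0, hk0⟩ := (Metric.tendsto_atTop.1 hp) (ε/2) (by positivity)
  refine ⟨N0 + k0, fun n hn => ?_⟩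
  rw [Real.dist_eq, sub_zero, abs_of_nonneg (hnn _)]
  obtain ⟨k, rfl⟩ : ∃ k, n = N0 + k := ⟨n - N0, by omega⟩
  have h3 := hk0 k (by omega)
  rw [Real.dist_eq, sub_zero] at h3
  have := hb k
  have := le_abs_self (α ^ k * Sg α d N0)
  linarith

lemma hA_tendsto' (w) (h : Gd w) : Tendsto (hA w) atTop (𝓝 0) := by
  cases w with
  | cons a w => exact hA_tendsto a w h
  | nil =>
    refine tendsto_const_nhds.congr' ?_
    filter_upwards [eventually_ge_atTop 1] with N hN
    have : N ≠ 0 := by omega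
    simp [hA, this]

/-- Telescoping. -/
lemma tele {α : ℝ} (h0 : 0 ≤ α) (h1 : α < 1) (w) (h : Gd w) :
    Tendsto (fun T => ∑ N ∈ Finset.range T, (N * hA (some α :: w) N - α * (1 - α)⁻¹ * hA w N)) atTop (𝓝 0) := by
  have hα : 1 - α ≠ 0 := by linarith
  have key : ∀ T, ∑ N ∈ Finset.range T, (N * hA (some α :: w) N - α * (1 - α)⁻¹ * hA w N) =
      - (1 - α)⁻¹ * Sg α (hA w) T := by
    intro T
    induction T with
    | zero => simp [Sg_zero]
    | succ T ih =>
      rw [Finset.sum_range_succ, ih, Sg_succ, N_mul_hA]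
      field_simp
      ring
  simp only [key]
  simpa using (Sg_tendsto h0 h1 (fun N => (hA_bd w h N).1) (hA_tendsto' w h)).const_mul (-(1-α)⁻¹)

/-- Differentiability of the values at one. -/
lemma hZ_deriv {r : ι → ℝ} (hr : ∀ i, 0 < r i ∧ r i ≤ 1) (w : List (Option (Option ι)))
    (hc : w.head? ≠ some (some none)) {z : ℝ} (hz : z ∈ Set.Ioo (0:ℝ) 1) :
    Summable (fun N : ℕ => epsH w * (N * hA (wz r z w) N) + Rw r z w N) ∧
    HasDerivAt (fun z => hZ (wz r z w)) (z⁻¹ * ∑' N : ℕ, (epsH w * (N * hA (wz r z w) N) + Rw r z w N)) z := by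
  have gd : ∀ z ∈ Set.Ioo (0:ℝ) 1, Gd (wz r z w) := by
    intro z hz s hs
    rw [wz, List.mem_map] at hs
    obtain ⟨a, _, h⟩ := hs
    rcases a with _ | (_ | i)
    · simp at h
    · simp [vz] at h; subst h; simp
    · simp [vz] at h; subst h
      have := hr i
      have := hz.1
      have := hz.2
      constructor
      · nlinarith
      · nlinarith
  have cv : ∀ z ∈ Set.Ioo (0:ℝ) 1, Cv (wz r z w) := by
    intro z hz
    rcases w with _ | ⟨_ | (_ | i), w⟩
    · simp [Cv, wz]
    · simp [Cv, wz]
    · simp at hc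
    · simp only [Cv, wz, List.map_cons, List.head?_cons, Option.map_some, ne_eq, Option.some.injEq, vz]
      have := hr i
      have := hz.1
      have := hz.2
      intro h
      nlinarith
  obtain ⟨z1, h1, h2⟩ := exists_between hz.2
  obtain ⟨z2, h3, h4⟩ := exists_between h2
  have hz2 : z2 ∈ Set.Ioo (0:ℝ) 1 := ⟨by linarith [hz.1], h4⟩
  have hs2 := summable_hA _ (gd z2 hz2) (cv z2 hz2)
  have hs := summable_hA _ (gd z hz) (cv z hz)
  have hb : ∀ (N : ℕ) (y : ℝ), y ∈ Set.Ioo (0:ℝ) z1 →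
      ‖y⁻¹ * (epsH w * (N * hA (wz r y w) N) + Rw r y w N)‖ ≤ hA (wz r z2 w) N * (z2 - z1)⁻¹ := by
    intro N y hy
    obtain ⟨g, hg⟩ := hA_NB (fun i => (hr i).1.le) w N
    rw [← (hg.1 y).unique (hA_theta r hy.1.ne' w N)]
    have h5 := hg.2.1 y hy.1.le
    have h6 := hg.2.2 y z2 hy.1.le (by linarith [hy.2])
    rw [Real.norm_of_nonneg h5.2, le_mul_inv_iff₀ (by linarith)]
    have : g y * (z2 - z1) ≤ g y * (z2 - y) := mul_le_mul_of_nonneg_left (by linarith [hy.2]) h5.2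
    simp only at h6
    linarith [h5.1]
  have hd := hasDerivAt_tsum_of_isPreconnected (g := fun (N : ℕ) z => hA (wz r z w) N) (y₀ := z) (y := z)
    (hs2.mul_right (z2 - z1)⁻¹) (isOpen_Ioo (a := (0:ℝ)) (b := z1)) isPreconnected_Ioo
    (fun N y hy => hA_theta r hy.1.ne' w N) hb ⟨hz.1, h1⟩ hs ⟨hz.1, h1⟩
  have hsum : Summable (fun N : ℕ => z⁻¹ * (epsH w * (N * hA (wz r z w) N) + Rw r z w N)) :=
    Summable.of_norm_bounded (hs2.mul_right (z2 - z1)⁻¹) fun N => hb N z ⟨hz.1, h1⟩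
  refine ⟨?_, ?_⟩
  · have := hsum.mul_left z
    refine this.congr fun N => ?_
    have := hz.1.ne'
    field_simp
  · rw [← tsum_mul_left]; exact hd

lemma hZ_lim_zero {r : ι → ℝ} (hr : ∀ i, 0 < r i ∧ r i ≤ 1) (w : List (Option (Option ι)))
    (hsum : ∀ z ∈ Set.Ioo (0:ℝ) 1, Summable (hA (wz r z w))) (hm : Mov w) :
    Tendsto (fun z => hZ (wz r z w)) (𝓝[>] 0) (𝓝 0) := by
  have hh : (1/2:ℝ) ∈ Set.Ioo (0:ℝ) 1 := ⟨by norm_num, by norm_num⟩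
  have hu : Tendsto (fun y : ℝ => y * (2 * hZ (wz r (1/2) w))) (𝓝[>] 0) (𝓝 0) := by
    have : Tendsto (fun y : ℝ => y * (2 * hZ (wz r (1/2) w))) (𝓝 0) (𝓝 (0 * (2 * hZ (wz r (1/2) w)))) :=
      tendsto_id.mul_const _
    rw [zero_mul] at this
    exact this.mono_left nhdsWithin_le_nhds
  refine squeeze_zero' ?_ ?_ hu
  · filter_upwards [Ioo_mem_nhdsGT one_pos] with y hy
    refine tsum_nonneg fun N => ?_
    obtain ⟨g, hg⟩ := hA_NB (fun i => (hr i).1.le) w N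
    exact (hg.2.1 y hy.1.le).1
  · filter_upwards [Ioo_mem_nhdsGT (show (0:ℝ) < 1/2 by norm_num)] with y hy
    have hy' : y ∈ Set.Ioo (0:ℝ) 1 := ⟨hy.1, by linarith [hy.2]⟩
    unfold hZ
    rw [← mul_assoc, ← tsum_mul_left]
    refine (hsum y hy').tsum_le_tsum (fun N => ?_) ((hsum _ hh).mul_left _)
    have := hA_ZB (fun i => (hr i).1.le) w hm hy.1 hy.2.le N
    linarith

end param

open MeasureTheory Filter Topology Asymptotics Polynomial

section paramring
variable {P ι : Type} {D : PD P ι}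

lemma opA_add (a : Option ℝ) (f g : ℕ → ℝ) (N : ℕ) : opA a (f + g) N = opA a f N + opA a g N := by
  cases a with
  | none => simp only [opA, Pi.add_apply]; ring
  | some r => simp only [opA, Pi.add_apply, mul_add, Finset.sum_add_distrib]; ring

lemma opA_mul (a : Option ℝ) (c : ℝ) (f : ℕ → ℝ) (N : ℕ) : opA a (fun M => c * f M) N = c * opA a f N := by
  cases a with
  | none => simp only [opA]; ring
  | some r => simp only [opA, mul_left_comm _ c, ← Finset.mul_sum]; ring

lemma opA_zero (a : Option ℝ) (N : ℕ) : opA a (fun _ => 0) N = 0 := by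
  cases a <;> simp [opA]

variable (D) in
/-- Combinations of coefficient sequences. -/
inductive Sq (S : Set (List (Option (Option ι)))) : (P → ℝ → ℕ → ℝ) → Prop
  | base (u) (hu : u ∈ S) (c : P → ℝ → ℝ) (hc : MR D Set.univ c) :
      Sq S (fun p z N => c p z * hA (wz (fun i => D.ρ i p) z u) N)
  | zero : Sq S (fun _ _ _ => 0)
  | add {f g} : Sq S f → Sq S g → Sq S (fun p z N => f p z N + g p z N)
  | congr {f g} : Sq S f → (∀ p, ∀ z ∈ Set.Ioo (0:ℝ) 1, ∀ N, f p z N = g p z N) → Sq S g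

lemma Sq.op {S S' : Set (List (Option (Option ι)))} {f} (hf : Sq D S f) (a : Option (Option ι))
    (h : ∀ u ∈ S, a :: u ∈ S') : Sq D S' (fun p z N => opA (a.map (vz (fun i => D.ρ i p) z)) (f p z) N) := by
  induction hf with
  | base u hu c hc =>
    exact (Sq.base (a :: u) (h u hu) c hc).congr fun p z _ N => by rw [opA_mul]; rfl
  | zero => exact Sq.zero.congr fun p z _ N => by rw [opA_zero]
  | add _ _ h1 h2 => exact (h1.add h2).congr fun p z _ N => by rw [← opA_add]; rfl
  | congr _ hh h1 =>
    exact h1.congr fun p z hz N => by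
      congr 1; ext M; exact hh p z hz M

lemma Sq.mono {S S' : Set (List (Option (Option ι)))} {f} (hf : Sq D S f)
    (h : S ⊆ S') : Sq D S' f := by
  induction hf with
  | base u hu c hc => exact Sq.base u (h hu) c hc
  | zero => exact Sq.zero
  | add _ _ h1 h2 => exact h1.add h2
  | congr _ hh h1 => exact h1.congr hh

lemma MR.one : MR D Set.univ (fun _ _ => 1) := MR.const D.C.one_mem
lemma MR.neg {f} (h : MR D Set.univ f) : MR D Set.univ (fun p x => - f p x) :=
  (h.mulC (D.C.neg_mem D.C.one_mem)).congr fun p x _ => by simp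
lemma MR.rho (i : ι) : MR D Set.univ (fun p z => z * D.ρ i p) := (MR.const (D.mem i)).mulX
lemma MR.pol (i : ι) : MR D Set.univ (fun p z => (1 - z * D.ρ i p)⁻¹) :=
  (MR.one.mulPole i).congr fun p z _ => by rw [mul_comm z, mul_one]
lemma MR.rhopol (i : ι) : MR D Set.univ (fun p z => (z * D.ρ i p) * (1 - z * D.ρ i p)⁻¹) :=
  (MR.rho i).mul (MR.pol i)

lemma PD.zlt (i : ι) (p : P) {z : ℝ} (hz : z ∈ Set.Ioo (0:ℝ) 1) : z * D.ρ i p < 1 := by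
  have := D.den_pos i p hz
  linarith

/-- Auxiliary words. -/
def S1 (n : ℕ) : Set (List (Option (Option ι))) := {u | Vld u ∧ u ≠ [] ∧ u.length < n}

/-- Convergent auxiliary words. -/
def S3 (n : ℕ) : Set (List (Option (Option ι))) := {u | Vld u ∧ u.head? ≠ some (some none) ∧ u.length < n}

lemma S1_op {a : Option (Option ι)} {n : ℕ} : ∀ u ∈ (S1 n : Set (List (Option (Option ι)))), a :: u ∈ (S1 (n+1) : Set (List (Option (Option ι)))) := by
  rintro u ⟨h1, h2, h3⟩
  exact ⟨⟨fun h => absurd h h2, h1⟩, by simp, by simpa using h3⟩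

lemma S3_op {a : Option (Option ι)} (ha : a ≠ some none) {n : ℕ} : ∀ u ∈ (S1 n : Set (List (Option (Option ι)))), a :: u ∈ (S3 (n+1) : Set (List (Option (Option ι)))) := by
  rintro u ⟨h1, h2, h3⟩
  exact ⟨⟨fun h => absurd h h2, h1⟩, by simpa using ha, by simpa using h3⟩

variable (D) in
/-- The new term in the differential equation. -/
noncomputable def Tw (a : Option (Option ι)) (w : List (Option (Option ι))) (p : P) (z : ℝ) (N : ℕ) : ℝ :=
  (epsH w - eps a) * opA (a.map (vz (fun i => D.ρ i p) z)) (fun M => M * hA (wz (fun i => D.ρ i p) z w) M) N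

lemma Rw_cons (a : Option (Option ι)) (w : List (Option (Option ι))) (p : P) (z : ℝ) (N : ℕ) :
    Rw (fun i => D.ρ i p) z (a :: w) N =
      opA (a.map (vz (fun i => D.ρ i p) z)) (Rw (fun i => D.ρ i p) z w) N + Tw D a w p z N := rfl

lemma Tw_zero {a : Option (Option ι)} {w : List (Option (Option ι))} (h : epsH w = eps a) (p : P) (z : ℝ) (N : ℕ) :
    Tw D a w p z N = 0 := by simp [Tw, h]

lemma Tw_nil (a : Option (Option ι)) (p : P) (z : ℝ) (N : ℕ) : Tw D a [] p z N = 0 := by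
  unfold Tw
  have : (fun M : ℕ => (M:ℝ) * hA (wz (fun i => D.ρ i p) z []) M) = fun _ => 0 := by
    ext M
    simp only [wz, List.map_nil, hA]
    split_ifs with h <;> simp [h]
  rw [this, opA_zero, mul_zero]

lemma Tw_none_left (i : ι) (w : List (Option (Option ι))) (p : P) (z : ℝ) (N : ℕ) :
    Tw D none (some (some i) :: w) p z N = hA (wz (fun i => D.ρ i p) z (some (some i) :: w)) N := by
  unfold Tw
  rw [wz_cons]
  have := op_MA_none_left (some (vz (fun i => D.ρ i p) z (some i))) (wz (fun i => D.ρ i p) z w) N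
  simp only [epsH, eps, Option.map_none, Option.map_some]
  rw [this]; ring

lemma Tw_none_right (i : ι) (c) (w : List (Option (Option ι))) (p : P) (z : ℝ) (N : ℕ) :
    Tw D (some (some i)) (none :: c :: w) p z N = - hA (wz (fun i => D.ρ i p) z (some (some i) :: c :: w)) N := by
  unfold Tw
  simp only [wz_cons]
  have := op_MA_none_right (some (vz (fun i => D.ρ i p) z (some i))) (c.map (vz (fun i => D.ρ i p) z)) (wz (fun i => D.ρ i p) z w) N
  simp only [epsH, eps, Option.map_none, Option.map_some]
  rw [this]; ring

lemma Tw_one_right (i : ι) (w : List (Option (Option ι))) (p : P) {z : ℝ} (hz : z ∈ Set.Ioo (0:ℝ) 1) (N : ℕ) :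
    Tw D (some (some i)) (some none :: w) p z N =
      (1 - z * D.ρ i p)⁻¹ * hA (wz (fun i => D.ρ i p) z (some (some i) :: w)) N -
      (z * D.ρ i p) * (1 - z * D.ρ i p)⁻¹ * hA (wz (fun i => D.ρ i p) z (some none :: w)) N := by
  unfold Tw
  simp only [wz_cons]
  have h := (D.zlt i p hz)
  have := op_MA_real h.ne (wz (fun i => D.ρ i p) z w) N
  simp only [epsH, eps, Option.map_some, vz]
  rw [this]
  have h2 : (z * D.ρ i p - 1)⁻¹ = - (1 - z * D.ρ i p)⁻¹ := by
    rw [← inv_neg]; congr 1; ring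
  rw [h2]; ring

lemma Tw_one_left (i : ι) (w : List (Option (Option ι))) (p : P) {z : ℝ} (hz : z ∈ Set.Ioo (0:ℝ) 1) (N : ℕ) :
    Tw D (some none) (some (some i) :: w) p z N =
      (z * D.ρ i p) * (1 - z * D.ρ i p)⁻¹ * hA (wz (fun i => D.ρ i p) z (some none :: w)) N +
      - (1 - z * D.ρ i p)⁻¹ * hA (wz (fun i => D.ρ i p) z (some (some i) :: w)) N := by
  unfold Tw
  simp only [wz_cons]
  have h := (D.zlt i p hz)
  have := op_MA_real h.ne' (wz (fun i => D.ρ i p) z w) N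
  simp only [epsH, eps, Option.map_some, vz]
  rw [this]
  ring

lemma Sq.b1 {n : ℕ} (u : List (Option (Option ι))) (hu : Vld u ∧ u ≠ [] ∧ u.length < n) (c : P → ℝ → ℝ)
    (hc : MR D Set.univ c) : Sq D (S1 n) (fun p z N => c p z * hA (wz (fun i => D.ρ i p) z u) N) :=
  Sq.base u hu c hc

lemma Sq.b3 {n : ℕ} (u : List (Option (Option ι))) (hu : Vld u ∧ u.head? ≠ some (some none) ∧ u.length < n)
    (c : P → ℝ → ℝ) (hc : MR D Set.univ c) : Sq D (S3 n) (fun p z N => c p z * hA (wz (fun i => D.ρ i p) z u) N) :=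
  Sq.base u hu c hc

lemma Tw_Sq (a : Option (Option ι)) (w : List (Option (Option ι))) (hv : Vld (a :: w)) :
    Sq D (S1 (w.length + 1)) (Tw D a w) := by
  rcases w with _ | ⟨b, w⟩
  · exact Sq.zero.congr fun p z _ N => (Tw_nil a p z N).symm
  rcases a with _ | (_ | i) <;> rcases b with _ | (_ | j)
  · exact Sq.zero.congr fun p z _ N => (Tw_zero rfl p z N).symm
  · exact Sq.zero.congr fun p z _ N => (Tw_zero rfl p z N).symm
  · exact (Sq.b1 (some (some j) :: w) ⟨hv.2, by simp, by simp⟩ _ MR.one).congr fun p z _ N => by rw [Tw_none_left, one_mul]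
  · exact Sq.zero.congr fun p z _ N => (Tw_zero rfl p z N).symm
  · exact Sq.zero.congr fun p z _ N => (Tw_zero rfl p z N).symm
  · exact ((Sq.b1 (some none :: w) ⟨⟨fun _ => by simp, hv.2.2⟩, by simp, by simp⟩ _ (MR.rhopol j)).add
      (Sq.b1 (some (some j) :: w) ⟨hv.2, by simp, by simp⟩ _ (MR.pol j).neg)).congr fun p z hz N => by
        rw [Tw_one_left j w p hz]
  · rcases w with _ | ⟨c, w⟩
    · exact absurd rfl (hv.2.1 rfl)
    · exact (Sq.b1 (some (some i) :: c :: w) ⟨⟨fun _ => by simp, hv.2.2⟩, by simp, by simp⟩ _ MR.one.neg).congr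
        fun p z _ N => by rw [Tw_none_right]; ring
  · exact ((Sq.b1 (some (some i) :: w) ⟨⟨fun _ => by simp, hv.2.2⟩, by simp, by simp⟩ _ (MR.pol i)).add
      (Sq.b1 (some none :: w) ⟨hv.2, by simp, by simp⟩ _ (MR.rhopol i).neg)).congr fun p z hz N => by
        rw [Tw_one_right i w p hz]; ring
  · exact Sq.zero.congr fun p z _ N => (Tw_zero rfl p z N).symm

lemma Rw_Sq (w : List (Option (Option ι))) (hv : Vld w) :
    Sq D (S1 w.length) (fun p z N => Rw (fun i => D.ρ i p) z w N) := by
  induction w with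
  | nil => exact Sq.zero
  | cons a w ih => exact ((ih hv.2).op a S1_op).add (Tw_Sq a w hv)

lemma claim3 (w : List (Option (Option ι))) (hv : Vld w) (hc : w.head? ≠ some (some none)) (hne : w ≠ []) :
    ∃ f, Sq D (S3 w.length) f ∧ ∀ p, ∀ z ∈ Set.Ioo (0:ℝ) 1,
      Tendsto (fun T => ∑ N ∈ Finset.range T, ((epsH w * (N * hA (wz (fun i => D.ρ i p) z w) N) +
        Rw (fun i => D.ρ i p) z w N) - f p z N)) atTop (𝓝 0) := by
  rcases w with _ | ⟨_ | (_ | i), w⟩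
  · exact absurd rfl hne
  · refine ⟨fun p z N => Rw (fun i => D.ρ i p) z (none :: w) N, ?_, fun p z _ => ?_⟩
    · have h1 := (Rw_Sq (D := D) w hv.2).op none (S3_op (by simp))
      refine Sq.congr (h1.add (?_ : Sq D _ (Tw D none w))) fun p z _ N => rfl
      rcases w with _ | ⟨_ | (_ | j), w⟩
      · exact Sq.zero.congr fun p z _ N => (Tw_nil _ p z N).symm
      · exact Sq.zero.congr fun p z _ N => (Tw_zero rfl p z N).symm
      · exact Sq.zero.congr fun p z _ N => (Tw_zero rfl p z N).symm
      · exact (Sq.b3 (some (some j) :: w) ⟨hv.2, by simp, by simp⟩ _ MR.one).congr fun p z _ N => by rw [Tw_none_left, one_mul]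
    · simp [epsH, eps]
  · simp at hc
  · have h1 := (Rw_Sq (D := D) w hv.2).op (some (some i)) (S3_op (by simp))
    have h2 : Sq D (S3 (w.length + 1)) (fun p z N => (z * D.ρ i p) * (1 - z * D.ρ i p)⁻¹ *
        hA (wz (fun i => D.ρ i p) z w) N + Tw D (some (some i)) w p z N) := by
      have hb : w.head? ≠ some (some none) → Sq D (S3 (w.length + 1)) (fun p z N => (z * D.ρ i p) * (1 - z * D.ρ i p)⁻¹ *
        hA (wz (fun i => D.ρ i p) z w) N) := fun h => Sq.b3 w ⟨hv.2, h, by simp⟩ _ (MR.rhopol i)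
      rcases w with _ | ⟨_ | (_ | j), w⟩
      · exact (hb (by simp)).congr fun p z _ N => by rw [Tw_nil, add_zero]
      · refine (hb (by simp)).add ?_
        rcases w with _ | ⟨c, w⟩
        · exact absurd rfl (hv.2.1 rfl)
        · exact (Sq.b3 (some (some i) :: c :: w) ⟨⟨fun _ => by simp, hv.2.2⟩, by simp, by simp⟩ _ MR.one.neg).congr
            fun p z _ N => by rw [Tw_none_right]; ring
      · exact (Sq.b3 (some (some i) :: w) ⟨⟨fun _ => by simp, hv.2.2⟩, by simp, by simp⟩ _ (MR.pol i)).congr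
          fun p z hz N => by rw [Tw_one_right i w p hz]; ring
      · exact (hb (by simp)).congr fun p z _ N => by rw [Tw_zero rfl, add_zero]
    refine ⟨_, h1.add h2, fun p z hz => ?_⟩
    have h3 : Gd (wz (fun i => D.ρ i p) z w) := by
      intro s hs
      rw [wz, List.mem_map] at hs
      obtain ⟨a, _, h⟩ := hs
      rcases a with _ | (_ | i)
      · simp at h
      · simp [vz] at h; subst h; simp
      · simp [vz] at h; subst h
        have := D.pos i p
        have := D.zlt i p hz
        have := hz.1
        exact ⟨by positivity, by linarith⟩
    have h4 := tele (α := z * D.ρ i p) (mul_pos hz.1 (D.pos i p)).le (D.zlt i p hz) _ h3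
    refine h4.congr fun T => Finset.sum_congr rfl fun N _ => ?_
    rw [Rw_cons]
    simp only [epsH, eps, wz_cons, Option.map_some, vz]
    ring

lemma wz_gd (w : List (Option (Option ι))) (p : P) {z : ℝ} (hz : z ∈ Set.Ioo (0:ℝ) 1) :
    Gd (wz (fun i => D.ρ i p) z w) := by
  intro s hs
  rw [wz, List.mem_map] at hs
  obtain ⟨a, _, h⟩ := hs
  rcases a with _ | (_ | i)
  · simp at h
  · simp [vz] at h; subst h; simp
  · simp [vz] at h; subst h
    have := D.pos i p
    have := D.zlt i p hz
    have := hz.1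
    exact ⟨by positivity, by linarith⟩

lemma wz_cv (w : List (Option (Option ι))) (hc : w.head? ≠ some (some none)) (p : P) {z : ℝ} (hz : z ∈ Set.Ioo (0:ℝ) 1) :
    Cv (wz (fun i => D.ρ i p) z w) := by
  rcases w with _ | ⟨_ | (_ | i), w⟩
  · simp [Cv, wz]
  · simp [Cv, wz]
  · simp at hc
  · simp only [Cv, wz, List.map_cons, List.head?_cons, Option.map_some, ne_eq, Option.some.injEq, vz]
    exact (D.zlt i p hz).ne

lemma Sq.sum {n : ℕ} (hn : ∀ u ∈ (S3 n : Set (List (Option (Option ι)))),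
      MR D Set.univ (fun p z => hZ (wz (fun i => D.ρ i p) z u))) {f} (hf : Sq D (S3 n) f) :
    MR D Set.univ (fun p z => ∑' N, f p z N) ∧ ∀ p, ∀ z ∈ Set.Ioo (0:ℝ) 1, Summable (f p z) := by
  induction hf with
  | base u hu c hc =>
    refine ⟨(hc.mul (hn u hu)).congr fun p z _ => ?_, fun p z hz => ?_⟩
    · simp only [Pi.mul_apply]; rw [tsum_mul_left]; rfl
    · exact (summable_hA _ (wz_gd u p hz) (wz_cv u hu.2.1 p hz)).mul_left _
  | zero => exact ⟨MR.zero.congr fun p z _ => by simp, fun p z _ => summable_zero⟩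
  | add _ _ h1 h2 =>
    refine ⟨(h1.1.add h2.1).congr fun p z hz => ?_, fun p z hz => (h1.2 p z hz).add (h2.2 p z hz)⟩
    exact ((h1.2 p z hz).tsum_add (h2.2 p z hz)).symm
  | congr _ h h1 =>
    refine ⟨h1.1.congr fun p z hz => ?_, fun p z hz => ?_⟩
    · exact tsum_congr fun N => h p z hz N
    · exact (h1.2 p z hz).congr fun N => h p z hz N

lemma not_mov (w : List (Option (Option ι))) (h : ¬ Mov w) (p : P) (z : ℝ) :
    wz (fun i => D.ρ i p) z w = D.wv (w.map (Option.map (fun _ => D.o))) p := by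
  unfold wz PD.wv
  rw [List.map_map]
  refine List.map_congr_left fun a ha => ?_
  rcases a with _ | (_ | i)
  · rfl
  · simp [vz, D.one]
  · exact absurd ⟨i, ha⟩ h

theorem ZMR (hZin : ZIn D) : ∀ (n : ℕ) (w : List (Option (Option ι))), w.length < n → Vld w → w.head? ≠ some (some none) →
    MR D Set.univ (fun p z => hZ (wz (fun i => D.ρ i p) z w)) := by
  intro n
  induction n with
  | zero => intro w h; omega
  | succ n ih =>
    intro w hn hv hc
    by_cases hm : Mov w
    · have hne : w ≠ [] := by rintro rfl; obtain ⟨i, hi⟩ := hm; simp at hi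
      obtain ⟨f, hf, hf2⟩ := claim3 (D := D) w hv hc hne
      have hs := Sq.sum (D := D) (n := w.length) (fun u hu => ih u (by have := hu.2.2; omega) hu.1 hu.2.1) hf
      refine MR.of_deriv (f := fun p z => z⁻¹ * ∑' N, f p z N) hs.1.mulXinv ?_ ?_
      · intro p z hz
        have h1 := hZ_deriv (r := fun i => D.ρ i p) (fun i => ⟨D.pos i p, D.le_one i p⟩) w hc hz
        refine derivCongr h1.2 (fun y => rfl) ?_
        congr 1
        have h2 := (h1.1.sub (hs.2 p z hz)).hasSum.tendsto_sum_nat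
        have h3 := tendsto_nhds_unique h2 (hf2 p z hz)
        rw [h1.1.tsum_sub (hs.2 p z hz)] at h3
        linarith
      · intro p
        exact hZ_lim_zero (fun i => ⟨D.pos i p, D.le_one i p⟩) w
          (fun z hz => summable_hA _ (wz_gd w p hz) (wz_cv w hc p hz)) hm
    · refine (MR.const (hZin (w.map (Option.map (fun _ => D.o))) (vld_map _ w hv) ?_)).congr fun p z _ => ?_
      · rcases w with _ | ⟨_ | (_ | i), w⟩
        · simp
        · simp
        · simp at hc
        · exact absurd ⟨i, by simp⟩ hm
      · rw [not_mov w hm]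

end paramring

open MeasureTheory Filter Topology Asymptotics Polynomial


section MZV

/-- Words attached to indices. -/
def uw : List ℕ → List (Option Unit)
  | [] => []
  | k :: l => List.replicate (k - 1) none ++ some () :: uw l

/-- Values of words. -/
def evu (w : List (Option Unit)) : List (Option ℝ) := w.map (Option.map fun _ => (1:ℝ))

/-- Coefficients of multiple polylogarithms. -/
noncomputable def mz : List ℕ → ℕ → ℝ
  | [] => fun N => if N = 0 then 1 else 0
  | k :: l => fun N => (∑ M ∈ Finset.range N, mz l M) / (N:ℝ) ^ k

lemma hA_replicate (m : ℕ) (u : List (Option Unit)) (N : ℕ) :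
    hA (evu (List.replicate m none ++ u)) N = hA (evu u) N / (N:ℝ) ^ m := by
  induction m with
  | zero => simp
  | succ m ih =>
    have : hA (evu (List.replicate (m+1) none ++ u)) N = hA (evu (List.replicate m none ++ u)) N / N := rfl
    rw [this, ih, pow_succ, div_div]

lemma hA_uw : ∀ (l : List ℕ), (∀ k ∈ l, 1 ≤ k) → ∀ N, hA (evu (uw l)) N = mz l N
  | [], _, N => rfl
  | k :: l, h, N => by
    have hk : 1 ≤ k := h k (by simp)
    have ih := hA_uw l (fun j hj => h j (by simp [hj]))
    rw [uw, hA_replicate]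
    have : hA (evu (some () :: uw l)) N = (∑ M ∈ Finset.range N, (1:ℝ) ^ (N - M) * hA (evu (uw l)) M) / N := rfl
    rw [this]
    simp only [one_pow, one_mul, ih, mz]
    rw [div_div]
    congr 1
    rw [← pow_succ']
    congr 1
    omega

lemma exists_uw : ∀ (w : List (Option Unit)), Vld w → ∃ l : List ℕ, (∀ k ∈ l, 1 ≤ k) ∧ w = uw l
  | [], _ => ⟨[], by simp, rfl⟩
  | some () :: w, h => by
    obtain ⟨l, hl, rfl⟩ := exists_uw w h.2
    exact ⟨1 :: l, by simpa using hl, by simp [uw]⟩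
  | none :: w, h => by
    obtain ⟨l, hl, rfl⟩ := exists_uw w h.2
    cases l with
    | nil => exact absurd rfl (h.1 rfl)
    | cons k l =>
      have hk : 1 ≤ k := hl k (by simp)
      refine ⟨(k+1) :: l, ?_, ?_⟩
      · intro j hj
        rcases List.mem_cons.1 hj with rfl | hj
        · omega
        · exact hl j (by simp [hj])
      · obtain ⟨m, rfl⟩ : ∃ m, k = m + 1 := ⟨k - 1, by omega⟩
        simp [uw, List.replicate_succ]

lemma vld_uw : ∀ l : List ℕ, Vld (uw l)
  | [] => trivial
  | k :: l => by
    have ih := vld_uw l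
    rw [uw]
    generalize k - 1 = m
    induction m with
    | zero => exact ⟨by simp, ih⟩
    | succ m h => exact ⟨by simp, h⟩

lemma head_uw (k : ℕ) (l : List ℕ) (hk : 1 ≤ k) : (uw (k :: l)).head? ≠ some (some ()) ↔ 2 ≤ k := by
  obtain ⟨m, rfl⟩ : ∃ m, k = m + 1 := ⟨k - 1, by omega⟩
  cases m with
  | zero => simp [uw]
  | succ m => simp [uw, List.replicate_succ]

open Classical in
/-- Finite truncations of multiple zeta values. -/
noncomputable def Hs {r : ℕ} (n : Fin r → ℕ) (N : ℕ) : ℝ :=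
  ∑ k ∈ (Fintype.piFinset fun _ : Fin r => Finset.range N).filter (fun k => StrictMono k ∧ ∀ i, 0 < k i),
    ∏ i, (1:ℝ) / (k i : ℝ) ^ (n i)

lemma strictMono_snoc {r : ℕ} (k : Fin (r+1) → ℕ) : (StrictMono k ∧ ∀ i, 0 < k i) ↔
    (StrictMono (Fin.init k) ∧ ∀ i, 0 < Fin.init k i) ∧ (∀ i, Fin.init k i < k (Fin.last r)) ∧ 0 < k (Fin.last r) := by
  constructor
  · rintro ⟨h1, h2⟩
    exact ⟨⟨fun i j h => h1 (Fin.castSucc_lt_castSucc_iff.2 h), fun i => h2 _⟩,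
      fun i => h1 (Fin.castSucc_lt_last i), h2 _⟩
  · rintro ⟨⟨h1, h2⟩, h3, h4⟩
    refine ⟨fun i j h => ?_, fun i => ?_⟩
    · cases i using Fin.lastCases with
      | last => exact absurd (Fin.le_last j) (not_le.2 h)
      | cast i =>
        cases j using Fin.lastCases with
        | last => exact h3 i
        | cast j => exact h1 (Fin.castSucc_lt_castSucc_iff.1 h)
    · cases i using Fin.lastCases with
      | last => exact h4
      | cast i => exact h2 i

lemma Hs_succ {r : ℕ} (n : Fin (r+1) → ℕ) (N : ℕ) (hN : 1 ≤ N) :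
    Hs n (N+1) = Hs n N + Hs (Fin.init n) N / (N:ℝ) ^ (n (Fin.last r)) := by
  classical
  unfold Hs
  rw [← Finset.sum_filter_add_sum_filter_not _ (fun k : Fin (r+1) → ℕ => k (Fin.last r) < N)]
  congr 1
  · refine Finset.sum_congr ?_ fun _ _ => rfl
    ext k
    simp only [Finset.mem_filter, Fintype.mem_piFinset, Finset.mem_range]
    constructor
    · rintro ⟨⟨h1, h2⟩, h3⟩
      refine ⟨fun i => lt_of_le_of_lt (h2.1.monotone (Fin.le_last i)) h3, h2⟩
    · rintro ⟨h1, h2⟩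
      exact ⟨⟨fun i => (h1 i).trans (Nat.lt_succ_self N), h2⟩, h1 _⟩
  · rw [Finset.sum_div]
    symm
    refine Finset.sum_bij' (fun k _ => (Fin.snoc k N : Fin (r+1) → ℕ)) (fun k _ => Fin.init k) ?_ ?_ ?_ ?_ ?_
    · intro k hk
      simp only [Finset.mem_filter, Fintype.mem_piFinset, Finset.mem_range] at hk ⊢
      rw [strictMono_snoc]
      simp only [Fin.init_snoc, Fin.snoc_last]
      refine ⟨⟨fun i => ?_, hk.2, hk.1, by omega⟩, by omega⟩
      cases i using Fin.lastCases with
      | last => simp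
      | cast i => have := hk.1 i; simp; omega
    · intro k hk
      simp only [Finset.mem_filter, Fintype.mem_piFinset, Finset.mem_range] at hk ⊢
      obtain ⟨⟨h1, h2⟩, h3⟩ := hk
      rw [strictMono_snoc] at h2
      refine ⟨fun i => ?_, h2.1⟩
      have := h2.2.1 i
      have := h1 (Fin.last r)
      omega
    · intro k hk; simp
    · intro k hk
      simp only [Finset.mem_filter, Fintype.mem_piFinset, Finset.mem_range] at hk
      have h1 := hk.1.1 (Fin.last r)
      have h2 := hk.2
      have : N = k (Fin.last r) := by omega
      rw [this]; exact Fin.snoc_init_self k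
    · intro k hk
      rw [Fin.prod_univ_castSucc]
      simp only [Fin.snoc_castSucc, Fin.snoc_last]
      rw [div_eq_mul_one_div]
      rfl

lemma Hs_zero (n : Fin 0 → ℕ) (N : ℕ) : Hs n N = 1 := by
  classical
  unfold Hs
  rw [Finset.filter_true_of_mem]
  · simp
  · intro k _
    exact ⟨fun i => i.elim0, fun i => i.elim0⟩

lemma Hs_one {r : ℕ} (n : Fin (r+1) → ℕ) : Hs n 1 = 0 := by
  classical
  unfold Hs
  rw [Finset.filter_false_of_mem]
  · simp
  · intro k hk h
    have := Fintype.mem_piFinset.1 hk 0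
    have h2 := h.2 0
    simp at this
    omega

/-- Index lists. -/
def idx : {r : ℕ} → (Fin r → ℕ) → List ℕ
  | 0, _ => []
  | r + 1, n => n (Fin.last r) :: idx (Fin.init n)

lemma idx_mem : ∀ {r : ℕ} (n : Fin r → ℕ) (k : ℕ), k ∈ idx n → ∃ i, k = n i
  | 0, n, k, h => by simp [idx] at h
  | r + 1, n, k, h => by
    rw [idx, List.mem_cons] at h
    rcases h with rfl | h
    · exact ⟨_, rfl⟩
    · obtain ⟨i, hi⟩ := idx_mem _ k h
      exact ⟨i.castSucc, hi⟩

lemma exists_idx : ∀ l : List ℕ, ∃ n : Fin l.length → ℕ, idx n = l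
  | [] => ⟨fun i => i.elim0, rfl⟩
  | k :: l => by
    obtain ⟨n, hn⟩ := exists_idx l
    refine ⟨(Fin.snoc n k : Fin (l.length + 1) → ℕ), ?_⟩
    rw [idx, Fin.snoc_last, Fin.init_snoc, hn]

lemma Hs_eq : ∀ {r : ℕ} (n : Fin r → ℕ) (N : ℕ), 1 ≤ N → Hs n N = ∑ M ∈ Finset.range N, mz (idx n) M
  | 0, n, N, hN => by
    rw [Hs_zero]
    rw [Finset.sum_eq_single 0]
    · simp [idx, mz]
    · intro b _ hb; simp [idx, mz, hb]
    · intro h; simp at h; omega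
  | r + 1, n, N, hN => by
    induction N, hN using Nat.le_induction with
    | base => rw [Hs_one]; simp [idx, mz]
    | succ N hN ih =>
      rw [Hs_succ n N hN, ih, Finset.sum_range_succ, Hs_eq (Fin.init n) N hN]
      rfl

lemma mzv_eq {r : ℕ} (n : Fin r → ℕ) (hs : Summable (mz (idx n))) (hnn : ∀ N, 0 ≤ mz (idx n) N) :
    mzv n = ∑' N, mz (idx n) N := by
  classical
  set p : (Fin r → ℕ) → Prop := fun k => StrictMono k ∧ ∀ i, 0 < k i with hp
  set f : {k // p k} → ℝ := fun k => ∏ i, (1:ℝ) / (k.1 i : ℝ) ^ (n i) with hf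
  set s : ℕ → Finset {k // p k} := fun N => (Fintype.piFinset fun _ : Fin r => Finset.range N).subtype p with hsdef
  have hf0 : ∀ k, 0 ≤ f k := fun k => Finset.prod_nonneg fun i _ => by positivity
  have h1 : ∀ N, ∑ k ∈ s N, f k = Hs n N := by
    intro N
    rw [hsdef]
    exact Finset.sum_subtype_eq_sum_filter (s := Fintype.piFinset fun _ : Fin r => Finset.range N) (p := p)
      (fun k => ∏ i, (1:ℝ) / (k i : ℝ) ^ (n i))
  have hmono : Monotone s := by
    intro a b hab k hk
    simp only [hsdef, Finset.mem_subtype, Fintype.mem_piFinset, Finset.mem_range] at hk ⊢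
    exact fun i => (hk i).trans_le hab
  have hmem : ∀ k, ∃ N, k ∈ s N := by
    intro k
    refine ⟨(∑ i, k.1 i) + 1, ?_⟩
    simp only [hsdef, Finset.mem_subtype, Fintype.mem_piFinset, Finset.mem_range]
    intro i
    have := Finset.single_le_sum (f := k.1) (fun _ _ => Nat.zero_le _) (Finset.mem_univ i)
    omega
  have hts : Tendsto s atTop atTop := tendsto_atTop_finset_of_monotone hmono hmem
  have hsum : Summable f := by
    refine summable_of_sum_le hf0 (c := ∑' N, mz (idx n) N) fun u => ?_
    obtain ⟨N, hN⟩ := ((hts.eventually (eventually_ge_atTop u)).and (eventually_ge_atTop 1)).exists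
    calc _ ≤ ∑ k ∈ s N, f k := Finset.sum_le_sum_of_subset_of_nonneg hN.1 fun k _ _ => hf0 k
      _ = ∑ M ∈ Finset.range N, mz (idx n) M := by rw [h1, Hs_eq n N hN.2]
      _ ≤ _ := hs.sum_le_tsum _ fun M _ => hnn M
  have h2 := hsum.hasSum.comp hts
  have h3 := hs.hasSum.tendsto_sum_nat
  refine tendsto_nhds_unique h2 (h3.congr' ?_)
  filter_upwards [eventually_ge_atTop 1] with N hN
  rw [← Hs_eq n N hN, ← h1]; rfl

lemma evu_gd (w : List (Option Unit)) : Gd (evu w) := by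
  intro s hs
  rw [evu, List.mem_map] at hs
  obtain ⟨a, _, h⟩ := hs
  cases a with
  | none => simp at h
  | some i => simp at h; subst h; simp

lemma evu_cv {w : List (Option Unit)} (h : w.head? ≠ some (some ())) : Cv (evu w) := by
  rcases w with _ | ⟨_ | i, w⟩
  · simp [Cv, evu]
  · simp [Cv, evu]
  · simp at h

lemma mzv_hZ {r : ℕ} (n : Fin (r+1) → ℕ) (h1 : ∀ i, 1 ≤ n i) (h2 : 2 ≤ n (Fin.last r)) :
    mzv n = hZ (evu (uw (idx n))) ∧ (uw (idx n)).head? ≠ some (some ()) := by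
  have hc : (uw (idx n)).head? ≠ some (some ()) := (head_uw _ _ (h1 _)).2 h2
  have hk : ∀ k ∈ idx n, 1 ≤ k := fun k hk => by obtain ⟨i, rfl⟩ := idx_mem n k hk; exact h1 i
  have he := hA_uw (idx n) hk
  refine ⟨?_, hc⟩
  rw [mzv_eq n]
  · exact tsum_congr fun N => (he N).symm
  · exact (summable_hA _ (evu_gd _) (evu_cv hc)).congr he
  · intro N; rw [← he]; exact (hA_bd _ (evu_gd _) N).1

/-- Values of convergent words. -/
def ZSet : Set ℝ := {x | ∃ w : List (Option Unit), Vld w ∧ w.head? ≠ some (some ()) ∧ x = hZ (evu w)}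

lemma hZ_nil : hZ [] = 1 := by
  unfold hZ
  rw [tsum_eq_single 0]
  · simp [hA]
  · intro N hN; simp [hA, hN]

lemma ZSet_eq : ZSet = insert 1 mzvSet := by
  ext x
  constructor
  · rintro ⟨w, hv, hc, rfl⟩
    obtain ⟨l, hl, rfl⟩ := exists_uw w hv
    cases l with
    | nil => left; exact hZ_nil
    | cons k l =>
      right
      obtain ⟨n, hn⟩ := exists_idx (k :: l)
      have h1 : n (Fin.last l.length) = k := by
        have : n (Fin.last l.length) :: _ = k :: l := hn
        exact (List.cons.inj this).1
      refine ⟨l.length, n, ?_, ?_, ?_⟩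
      · have : ∀ (r : ℕ) (n : Fin r → ℕ) (i : Fin r), n i ∈ idx n := by
          intro r
          induction r with
          | zero => intro n i; exact i.elim0
          | succ r ih =>
            intro n i
            rw [idx, List.mem_cons]
            cases i using Fin.lastCases with
            | last => left; rfl
            | cast i => right; exact ih (Fin.init n) i
        intro i
        exact hl _ (hn ▸ this _ n i)
      · rw [h1]; exact (head_uw k l (hl k (by simp))).1 hc
      · have hk : 2 ≤ k := (head_uw k l (hl k (by simp))).1 hc
        rw [mzv_eq n]
        · rw [hn]; exact tsum_congr fun N => hA_uw _ hl N
        · rw [hn]; exact (summable_hA _ (evu_gd _) (evu_cv hc)).congr (hA_uw _ hl)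
        · intro N; rw [hn, ← hA_uw _ hl]; exact (hA_bd _ (evu_gd _) N).1
  · rintro (rfl | ⟨r, n, h1, h2, rfl⟩)
    · exact ⟨[], trivial, by simp, hZ_nil.symm⟩
    · obtain ⟨h3, h4⟩ := mzv_hZ n h1 h2
      exact ⟨_, vld_uw _, h4, h3⟩

lemma tends_lsum {β : Type} (l : List β) (f : β → ℝ → ℝ) (c : β → ℝ) (F : Filter ℝ)
    (h : ∀ b ∈ l, Tendsto (f b) F (𝓝 (c b))) : Tendsto (fun x => (l.map fun b => f b x).sum) F (𝓝 (l.map c).sum) := by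
  induction l with
  | nil => simp [tendsto_const_nhds]
  | cons b l ih =>
    simp only [List.map_cons, List.sum_cons]
    exact (h b (by simp)).add (ih fun c hc => h c (by simp [hc]))

lemma hZ_mul {u v : List (Option Unit)} (hu : Vld u) (hv : Vld v) (cu : u.head? ≠ some (some ()))
    (cv : v.head? ≠ some (some ())) : hZ (evu u) * hZ (evu v) = ((shf u v).map fun w => hZ (evu w)).sum := by
  have hc : ∀ w ∈ shf u v, w.head? ≠ some (some ()) := fun w hw => by
    rcases shf_head u v w hw with h | h <;> rw [h] <;> assumption
  have h1 := (hL_tendsto _ (evu_gd u) (evu_cv cu)).mul (hL_tendsto _ (evu_gd v) (evu_cv cv))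
  have h2 := tends_lsum (shf u v) (fun w => hL (evu w)) (fun w => hZ (evu w)) (𝓝[<] 1)
    fun w hw => hL_tendsto _ (evu_gd w) (evu_cv (hc w hw))
  refine tendsto_nhds_unique h1 (h2.congr' ?_)
  filter_upwards [Ioo_mem_nhdsLT (zero_lt_one (α := ℝ))] with x hx
  rw [hL_mul _ _ (evu_gd u) (evu_gd v) (vld_map _ u hu) (vld_map _ v hv) hx.1.le hx.2]
  unfold evu
  rw [shf_map, List.map_map]; rfl

/-- The algebra of multiple zeta values. -/
noncomputable def ZS : Subalgebra ℚ ℝ :=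
  (Submodule.span ℚ ZSet).toSubalgebra (Submodule.subset_span ⟨[], trivial, by simp, hZ_nil.symm⟩) (by
    intro x y hx hy
    induction hx, hy using Submodule.span_induction₂ with
    | mem_mem x y hx hy =>
      obtain ⟨u, hu, cu, rfl⟩ := hx
      obtain ⟨v, hv, cv, rfl⟩ := hy
      rw [hZ_mul hu hv cu cv]
      refine list_sum_mem fun x hx => ?_
      rw [List.mem_map] at hx
      obtain ⟨w, hw, rfl⟩ := hx
      refine Submodule.subset_span ⟨w, shf_vld u v hu hv w hw, ?_, rfl⟩
      rcases shf_head u v w hw with h | h <;> rw [h] <;> assumption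
    | zero_left y _ => simp
    | zero_right x _ => simp
    | add_left x y z _ _ _ h1 h2 => rw [add_mul]; exact add_mem h1 h2
    | add_right x y z _ _ _ h1 h2 => rw [mul_add]; exact add_mem h1 h2
    | smul_left r x y _ _ h => rw [smul_mul_assoc]; exact Submodule.smul_mem _ r h
    | smul_right r x y _ _ h => rw [mul_smul_comm]; exact Submodule.smul_mem _ r h)

lemma mem_ZS {x : ℝ} : x ∈ ZS ↔ x ∈ Submodule.span ℚ (insert (1:ℝ) mzvSet) := by
  rw [← ZSet_eq]; rfl

end MZV

open MeasureTheory Filter Topology Asymptotics Polynomial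

/-- The open unit interval. -/
abbrev UI : Type := ↥(Set.Ioo (0:ℝ) 1)

section extension
variable {P Q ι : Type}

/-- Substitution of a parameter. -/
def sbst (e : Q → P × UI) : (P → ℝ → ℝ) →ₐ[ℚ] (Q → ℝ) where
  toFun g := fun q => g (e q).1 (e q).2
  map_one' := rfl
  map_mul' _ _ := rfl
  map_zero' := rfl
  map_add' _ _ := rfl
  commutes' _ := rfl

lemma mem_ext {D : PD P ι} (e : Q → P × UI) {g : P → ℝ → ℝ} (hg : MR D Set.univ g) {f : Q → ℝ}
    (h : ∀ q, g (e q).1 (e q).2 = f q) : f ∈ D.R.map (sbst e) :=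
  ⟨g, hg, funext h⟩

/-- Adding a parameter. -/
noncomputable def PD.ext (D : PD P ι) (e : Q → P × UI) : PD Q (Option ι) where
  C := D.R.map (sbst e)
  ρ i q := vz (fun i => D.ρ i (e q).1) (e q).2 i
  o := none
  pos i q := by
    cases i with
    | none => exact one_pos
    | some i => exact mul_pos (e q).2.2.1 (D.pos i _)
  le_one i q := by
    cases i with
    | none => exact le_rfl
    | some i => exact (D.zlt i _ (e q).2.2).le
  one q := rfl
  ne i j h q := by
    rcases i with _ | i <;> rcases j with _ | j
    · exact absurd rfl h
    · exact (D.zlt j _ (e q).2.2).ne'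
    · exact (D.zlt i _ (e q).2.2).ne
    · have h1 : i ≠ j := fun h' => h (by rw [h'])
      have h2 := D.ne i j h1 (e q).1
      intro h3
      exact h2 (mul_left_cancel₀ (e q).2.2.1.ne' h3)
  mem i := by
    cases i with
    | none => exact mem_ext e MR.one fun q => rfl
    | some i => exact mem_ext e (MR.rho i) fun q => rfl
  inv_mem i := by
    cases i with
    | none => exact mem_ext e MR.one fun q => by simp [vz]
    | some i => exact mem_ext e (MR.const (D.inv_mem i)).mulXinv fun q => by simp [vz, mul_comm]
  sub_mem i j h := by
    rcases i with _ | i <;> rcases j with _ | j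
    · exact absurd rfl h
    · exact mem_ext e (MR.pol j) fun q => rfl
    · exact mem_ext e (MR.pol i).neg fun q => by
        simp only [vz]; rw [← inv_neg]; congr 1; ring
    · have h1 : i ≠ j := fun h' => h (by rw [h'])
      exact mem_ext e (MR.const (D.sub_mem i j h1)).mulXinv fun q => by
        simp only [vz]; rw [← mul_inv]; congr 1; ring

lemma ZIn.ext {D : PD P ι} (h : ZIn D) (e : Q → P × UI) : ZIn (D.ext e) := by
  intro w hv hc
  exact mem_ext e (ZMR h (w.length + 1) w (Nat.lt_succ_self _) hv hc) fun q => rfl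

end extension

/-- The starting data. -/
noncomputable def D0 : PD (Fin 0 → UI) Unit where
  C := ZS.comap (Pi.evalAlgHom ℚ (fun _ : Fin 0 → UI => ℝ) (fun i => i.elim0))
  ρ _ _ := 1
  o := ()
  pos _ _ := one_pos
  le_one _ _ := le_rfl
  one _ := rfl
  ne i j h := absurd rfl h
  mem _ := ZS.one_mem
  inv_mem _ := by
    show (1:ℝ)⁻¹ ∈ ZS
    rw [inv_one]; exact ZS.one_mem
  sub_mem i j h := absurd rfl h

lemma ZIn_D0 : ZIn D0 := by
  intro w hv hc
  show hZ _ ∈ ZS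
  exact Submodule.subset_span ⟨w, hv, hc, rfl⟩

/-- Index types. -/
def iot : ℕ → Type
  | 0 => Unit
  | n + 1 => Option (iot n)

/-- Peeling off the first coordinate. -/
def peel (n : ℕ) (q : Fin (n+1) → UI) : (Fin n → UI) × UI := (Fin.tail q, q 0)

/-- The tower of parameter data. -/
noncomputable def Dn : (n : ℕ) → PD (Fin n → UI) (iot n)
  | 0 => D0
  | n + 1 => (Dn n).ext (peel n)

lemma ZIn_Dn : ∀ n, ZIn (Dn n)
  | 0 => ZIn_D0
  | n + 1 => (ZIn_Dn n).ext (peel n)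

/-- The open cube. -/
def cube (n : ℕ) : Set (Fin n → ℝ) := Set.univ.pi fun _ => Set.Ioo (0:ℝ) 1

lemma mem_cube {n : ℕ} {x : Fin n → ℝ} : x ∈ cube n ↔ ∀ i, x i ∈ Set.Ioo (0:ℝ) 1 := by
  simp only [cube, Set.mem_univ_pi]

lemma cube_meas (n : ℕ) : MeasurableSet (cube n) := MeasurableSet.univ_pi fun _ => measurableSet_Ioo

theorem cube_integral : ∀ (n : ℕ) (F : (Fin n → ℝ) → ℝ) (f : (Fin n → UI) → ℝ), f ∈ (Dn n).C →
    (∀ q : Fin n → UI, F (fun i => (q i : ℝ)) = f q) → IntegrableOn F (cube n) → ∫ x in cube n, F x ∈ ZS := by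
  classical
  intro n
  induction n with
  | zero =>
    intro F f hf hF hi
    have h1 : cube 0 = Set.univ := by ext x; simp [mem_cube]
    rw [h1, Measure.restrict_univ, volume_pi, Measure.pi_of_empty _ (fun i => i.elim0), integral_dirac]
    have h2 := hF (fun i => i.elim0)
    have h3 : (fun i : Fin 0 => i.elim0 : Fin 0 → ℝ) = fun i => (((fun i => i.elim0 : Fin 0 → UI) i : UI) : ℝ) := by
      ext i; exact i.elim0
    rw [h3, h2]
    exact hf
  | succ n ih =>
    rintro F f ⟨g, hg, hgf⟩ hF hi
    have hg' : MR (Dn n) Set.univ g := hg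
    obtain ⟨h, hh, hstep⟩ := hg'.step (ZIn_Dn n)
    have key : ∀ (q : Fin n → UI) (x : UI), F (Fin.cons (x:ℝ) (fun i => (q i : ℝ))) = g q x := by
      intro q x
      have h1 := hF (Fin.cons x q)
      have h2 : f (Fin.cons x q) = g q x := by rw [← hgf]; rfl
      rw [← h2, ← h1]
      congr 1
      ext i
      cases i using Fin.cases <;> simp
    have hlift : ∀ y ∈ cube n, ∃ q : Fin n → UI, y = fun i => (q i : ℝ) := fun y hy =>
      ⟨fun i => ⟨y i, mem_cube.1 hy i⟩, rfl⟩
    set F1 : (Fin (n+1) → ℝ) → ℝ := (cube (n+1)).indicator F with hF1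
    have hi1 : Integrable F1 := (integrable_indicator_iff (cube_meas _)).2 hi
    have hmp := volume_preserving_piFinSuccAbove (fun _ : Fin (n+1) => ℝ) 0
    set e := MeasurableEquiv.piFinSuccAbove (fun _ : Fin (n+1) => ℝ) 0 with he
    have hcons : ∀ x y, e.symm (x, y) = Fin.cons x y := by
      intro x y
      exact Fin.insertNth_zero' x y
    have hF1c : ∀ y ∈ cube n, ∀ x, F1 (Fin.cons x y) = (Set.Ioo (0:ℝ) 1).indicator (fun x => F (Fin.cons x y)) x := by
      intro y hy x
      have : (Fin.cons x y : Fin (n+1) → ℝ) ∈ cube (n+1) ↔ x ∈ Set.Ioo (0:ℝ) 1 := by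
        rw [mem_cube, Fin.forall_fin_succ]
        simp only [Fin.cons_zero, Fin.cons_succ]
        exact ⟨fun h => h.1, fun h => ⟨h, mem_cube.1 hy⟩⟩
      rw [hF1]
      by_cases hx : x ∈ Set.Ioo (0:ℝ) 1
      · rw [Set.indicator_of_mem (this.2 hx), Set.indicator_of_mem hx]
      · rw [Set.indicator_of_notMem (fun h => hx (this.1 h)), Set.indicator_of_notMem hx]
    have hF1n : ∀ y ∉ cube n, ∀ x, F1 (Fin.cons x y) = 0 := by
      intro y hy x
      refine Set.indicator_of_notMem (fun h => hy ?_) _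
      rw [mem_cube, Fin.forall_fin_succ] at h
      simp only [Fin.cons_zero, Fin.cons_succ] at h
      exact mem_cube.2 h.2
    have hi2 : Integrable (fun z : ℝ × (Fin n → ℝ) => F1 (Fin.cons z.1 z.2)) := by
      have := hmp.symm.integrable_comp_emb (e.symm.measurableEmbedding) (g := F1)
      refine (this.2 hi1).congr (Eventually.of_forall fun z => ?_)
      exact congrArg F1 (hcons z.1 z.2)
    have hIntEq : ∫ x in cube (n+1), F x = ∫ y : Fin n → ℝ, ∫ x : ℝ, F1 (Fin.cons x y) := by
      rw [← integral_indicator (cube_meas _), ← hmp.symm.integral_comp e.symm.measurableEmbedding]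
      rw [← integral_prod_symm (fun z : ℝ × (Fin n → ℝ) => F1 (Fin.cons z.1 z.2)) hi2]
      refine integral_congr_ae (Eventually.of_forall fun z => ?_)
      exact congrArg F1 (hcons z.1 z.2)
    set F2 : (Fin n → ℝ) → ℝ := fun y => if hy : y ∈ cube n then h (fun i => ⟨y i, mem_cube.1 hy i⟩) else 0 with hF2
    have hae : ∀ᵐ y : Fin n → ℝ, ∫ x : ℝ, F1 (Fin.cons x y) = (cube n).indicator F2 y := by
      filter_upwards [hi2.prod_left_ae] with y hy
      by_cases hyc : y ∈ cube n
      · rw [Set.indicator_of_mem hyc]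
        simp only [hF2, dif_pos hyc]
        set q : Fin n → UI := fun i => ⟨y i, mem_cube.1 hyc i⟩ with hq
        have hFg : ∀ x ∈ Set.Ioo (0:ℝ) 1, F (Fin.cons x y) = g q x := fun x hx => key q ⟨x, hx⟩
        simp only [hF1c y hyc] at hy ⊢
        rw [integral_indicator measurableSet_Ioo]
        have hy2 := (integrable_indicator_iff measurableSet_Ioo).1 hy
        rw [setIntegral_congr_fun measurableSet_Ioo hFg]
        exact hstep q (hy2.congr_fun hFg measurableSet_Ioo)
      · rw [Set.indicator_of_notMem hyc]
        simp only [hF1n y hyc, integral_zero]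
    rw [hIntEq, integral_congr_ae hae, integral_indicator (cube_meas _)]
    refine ih F2 h hh (fun q => ?_) ?_
    · have : (fun i => (q i : ℝ)) ∈ cube n := mem_cube.2 fun i => (q i).2
      simp only [hF2, dif_pos this]
    · rw [← integrable_indicator_iff (cube_meas _)]
      exact hi2.integral_prod_right.congr hae

/-! ## Elements of the coefficient rings -/

/-- Products of consecutive coordinates. -/
def pr {n : ℕ} (x : Fin n → ℝ) (a b : ℕ) : ℝ := ∏ l : Fin n, if a ≤ l ∧ (l:ℕ) < b then x l else 1

/-- Coercion of points of the cube. -/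
def cq {n : ℕ} (q : Fin n → UI) : Fin n → ℝ := fun i => q i

lemma pr_zero {n : ℕ} (x : Fin n → ℝ) (a : ℕ) : pr x a 0 = 1 := by simp [pr]

lemma pr_succ_succ {n : ℕ} (x : Fin (n+1) → ℝ) (a b : ℕ) : pr x (a+1) (b+1) = pr (Fin.tail x) a b := by
  unfold pr
  rw [Fin.prod_univ_succ]
  simp [Fin.tail]

lemma pr_zero_succ {n : ℕ} (x : Fin (n+1) → ℝ) (b : ℕ) : pr x 0 (b+1) = x 0 * pr (Fin.tail x) 0 b := by
  unfold pr
  rw [Fin.prod_univ_succ]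
  simp [Fin.tail]

lemma letter : ∀ (n b : ℕ), ∃ i, ∀ q, (Dn n).ρ i q = pr (cq q) 0 b
  | 0, b => ⟨(), fun q => by simp [pr]; rfl⟩
  | n + 1, 0 => ⟨(Dn (n+1)).o, fun q => by rw [pr_zero, (Dn (n+1)).one]⟩
  | n + 1, b + 1 => by
    obtain ⟨i, hi⟩ := letter n b
    refine ⟨(some i : Option (iot n)), fun q => ?_⟩
    rw [pr_zero_succ]
    show (q 0 : ℝ) * (Dn n).ρ i (Fin.tail q) = _
    rw [hi]; rfl

lemma mem_Dn_succ {n : ℕ} {g : (Fin n → UI) → ℝ → ℝ} (hg : MR (Dn n) Set.univ g) {f : (Fin (n+1) → UI) → ℝ}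
    (h : ∀ q, g (Fin.tail q) (q 0) = f q) : f ∈ (Dn (n+1)).C :=
  mem_ext (peel n) hg h

lemma Dn_inv : ∀ (n a b : ℕ), (fun q => (1 - pr (cq q) a b)⁻¹) ∈ (Dn n).C
  | 0, a, b => by
    have : (fun q : Fin 0 → UI => (1 - pr (cq q) a b)⁻¹) = 0 := by ext q; simp [pr]
    rw [this]; exact zero_mem _
  | n + 1, a, 0 => by
    have : (fun q : Fin (n+1) → UI => (1 - pr (cq q) a 0)⁻¹) = 0 := by ext q; simp [pr_zero]
    rw [this]; exact zero_mem _
  | n + 1, 0, b + 1 => by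
    obtain ⟨i, hi⟩ := letter n b
    refine mem_Dn_succ (MR.pol i) fun q => ?_
    rw [pr_zero_succ, hi]; rfl
  | n + 1, a + 1, b + 1 => by
    refine mem_Dn_succ (MR.const (Dn_inv n a b)) fun q => ?_
    rw [pr_succ_succ]; rfl

lemma Dn_coord : ∀ (n : ℕ) (l : Fin n), (fun q => cq q l) ∈ (Dn n).C ∧ (fun q => (cq q l)⁻¹) ∈ (Dn n).C
  | 0, l => l.elim0
  | n + 1, l => by
    cases l using Fin.cases with
    | zero =>
      exact ⟨mem_Dn_succ (MR.one.mulX) fun q => mul_one _, mem_Dn_succ (MR.one.mulXinv) fun q => mul_one _⟩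
    | succ l =>
      have := Dn_coord n l
      exact ⟨mem_Dn_succ (MR.const this.1) fun q => rfl, mem_Dn_succ (MR.const this.2) fun q => rfl⟩

/-- Invertible elements of the coefficient ring. -/
def Un {n : ℕ} (f : (Fin n → ℝ) → ℝ) : Prop :=
  (fun q => f (cq q)) ∈ (Dn n).C ∧ (fun q => (f (cq q))⁻¹) ∈ (Dn n).C

lemma Un.mul {n : ℕ} {f g : (Fin n → ℝ) → ℝ} (hf : Un f) (hg : Un g) : Un (fun x => f x * g x) := by
  refine ⟨(Dn n).C.mul_mem hf.1 hg.1, ?_⟩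
  have := (Dn n).C.mul_mem hf.2 hg.2
  convert this using 1
  ext q; simp [mul_comm]

lemma Un.inv {n : ℕ} {f : (Fin n → ℝ) → ℝ} (hf : Un f) : Un (fun x => (f x)⁻¹) :=
  ⟨hf.2, by simpa using hf.1⟩

lemma Un.one {n : ℕ} : Un (fun _ : Fin n → ℝ => (1:ℝ)) :=
  ⟨(Dn n).C.one_mem, by simp only [inv_one]; exact (Dn n).C.one_mem⟩

lemma Un.pow {n : ℕ} {f : (Fin n → ℝ) → ℝ} (hf : Un f) (k : ℕ) : Un (fun x => f x ^ k) := by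
  induction k with
  | zero => simpa using Un.one
  | succ k ih => simp only [pow_succ]; exact ih.mul hf

lemma Un.zpow {n : ℕ} {f : (Fin n → ℝ) → ℝ} (hf : Un f) (k : ℤ) : Un (fun x => f x ^ k) := by
  cases k with
  | ofNat k => simpa using hf.pow k
  | negSucc k => simp only [zpow_negSucc]; exact (hf.pow (k+1)).inv

lemma Un.prod {n : ℕ} {β : Type} (s : Finset β) (f : β → (Fin n → ℝ) → ℝ) (hf : ∀ b ∈ s, Un (f b)) :
    Un (fun x => ∏ b ∈ s, f b x) := by
  classical
  induction s using Finset.induction_on with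
  | empty => simpa using Un.one
  | insert a s ha ih =>
    simp only [Finset.prod_insert ha]
    exact (hf a (by simp)).mul (ih fun b hb => hf b (by simp [hb]))

lemma Un.pr {n : ℕ} (a b : ℕ) : Un (fun x : Fin n → ℝ => pr x a b) := by
  refine Un.prod _ _ fun l _ => ?_
  split_ifs
  · exact Dn_coord n l
  · exact Un.one

lemma Un.one_sub {n : ℕ} (a b : ℕ) : Un (fun x : Fin n → ℝ => 1 - _root_.pr x a b) :=
  ⟨(Dn n).C.sub_mem (Dn n).C.one_mem (Un.pr a b).1, Dn_inv n a b⟩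

open MeasureTheory Filter Topology Asymptotics Polynomial

/-! ## From the cube to the simplex -/

lemma pr_step {n : ℕ} (x : Fin n → ℝ) (i : Fin n) {b : ℕ} (hb : (i:ℕ) < b) : pr x i b = x i * pr x (i+1) b := by
  unfold pr
  rw [← Finset.mul_prod_erase Finset.univ (fun l : Fin n => if (i:ℕ) ≤ l ∧ (l:ℕ) < b then x l else 1) (Finset.mem_univ i),
    ← Finset.mul_prod_erase Finset.univ (fun l : Fin n => if (i:ℕ) + 1 ≤ l ∧ (l:ℕ) < b then x l else 1) (Finset.mem_univ i)]
  rw [if_pos ⟨le_rfl, hb⟩, if_neg (by omega), one_mul]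
  congr 1
  refine Finset.prod_congr rfl fun l hl => ?_
  have h1 : l ≠ i := Finset.ne_of_mem_erase hl
  have h2 : (l:ℕ) ≠ i := fun h => h1 (Fin.ext h)
  by_cases h : (i:ℕ) ≤ l ∧ (l:ℕ) < b
  · rw [if_pos h, if_pos (by omega)]
  · rw [if_neg h, if_neg (by omega)]

lemma pr_self {n : ℕ} (x : Fin n → ℝ) (a : ℕ) : pr x a a = 1 := by
  unfold pr
  exact Finset.prod_eq_one fun l _ => if_neg (by omega)

lemma pr_mul {n : ℕ} (x : Fin n → ℝ) {a b c : ℕ} (h1 : a ≤ b) (h2 : b ≤ c) : pr x a c = pr x a b * pr x b c := by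
  unfold pr
  rw [← Finset.prod_mul_distrib]
  refine Finset.prod_congr rfl fun l _ => ?_
  by_cases h3 : a ≤ (l:ℕ) <;> by_cases h4 : (l:ℕ) < b <;> by_cases h5 : (l:ℕ) < c
  all_goals first | omega | skip
  · simp [h3, h4, h5]
  · simp [h3, h4, h5]
  · simp [h3, h4, h5]
  · simp [h3, h4, h5]

lemma pr_pos {n : ℕ} {x : Fin n → ℝ} (hx : x ∈ cube n) (a b : ℕ) : 0 < pr x a b :=
  Finset.prod_pos fun l _ => by split_ifs; exacts [(mem_cube.1 hx l).1, one_pos]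

lemma pr_le_one {n : ℕ} {x : Fin n → ℝ} (hx : x ∈ cube n) (a b : ℕ) : pr x a b ≤ 1 :=
  Finset.prod_le_one (fun l _ => by split_ifs; exacts [(mem_cube.1 hx l).1.le, zero_le_one])
    fun l _ => by split_ifs; exacts [(mem_cube.1 hx l).2.le, le_rfl]

lemma pr_lt_one {n : ℕ} {x : Fin n → ℝ} (hx : x ∈ cube n) (i : Fin n) {b : ℕ} (hb : (i:ℕ) < b) : pr x i b < 1 := by
  rw [pr_step x i hb]
  have h1 := pr_le_one hx (i+1) b
  have h2 := pr_pos hx (i+1) b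
  have h3 := mem_cube.1 hx i
  nlinarith [h3.1, h3.2]

/-- The substitution. -/
def Tm {n : ℕ} (x : Fin n → ℝ) : Fin n → ℝ := fun i => pr x i n

lemma Tm_inj (n : ℕ) : Set.InjOn (Tm (n := n)) (cube n) := by
  intro x hx y hy h
  have h1 : ∀ a : ℕ, a ≤ n → pr x a n = pr y a n := by
    intro a ha
    rcases Nat.lt_or_ge a n with h2 | h2
    · exact congrFun h ⟨a, h2⟩
    · have : a = n := le_antisymm ha h2
      rw [this, pr_self, pr_self]
  ext i
  have h2 := h1 i i.2.le
  rw [pr_step x i i.2, pr_step y i i.2, h1 (i+1) i.2] at h2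
  exact mul_right_cancel₀ (pr_pos hy _ _).ne' h2

lemma Tm_image (n : ℕ) : Set.image Tm (cube n) = openSimplex n := by
  ext t
  constructor
  · rintro ⟨x, hx, rfl⟩
    refine ⟨fun i => ⟨pr_pos hx _ _, pr_lt_one hx i i.2⟩, fun i j hij => ?_⟩
    show pr x i n < pr x j n
    rw [pr_mul x (Fin.lt_def.1 hij).le j.2.le]
    have := pr_lt_one hx i (Fin.lt_def.1 hij)
    have := pr_pos hx j n
    nlinarith
  · rintro ⟨h1, h2⟩
    set s : ℕ → ℝ := fun k => if h : k < n then t ⟨k, h⟩ else 1 with hs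
    have hs1 : ∀ i : Fin n, s i = t i := fun i => by simp [hs]
    have hs2 : ∀ k, 0 < s k := fun k => by
      simp only [hs]; split_ifs with h
      · exact (h1 _).1
      · exact one_pos
    have hs3 : ∀ i : Fin n, s i < s (i+1) := fun i => by
      rw [hs1]
      simp only [hs]; split_ifs with h
      · exact h2 _ _ (Fin.lt_def.2 (Nat.lt_succ_self _))
      · exact (h1 _).2
    refine ⟨fun i => s i / s (i+1), ?_, ?_⟩
    · rw [mem_cube]
      intro i
      exact ⟨div_pos (hs2 _) (hs2 _), (div_lt_one (hs2 _)).2 (hs3 i)⟩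
    · have key : ∀ d a : ℕ, a + d = n → pr (fun i : Fin n => s i / s (i+1)) a n = s a := by
        intro d
        induction d with
        | zero =>
          intro a ha
          have : a = n := by omega
          subst this
          rw [pr_self]; simp [hs]
        | succ d ih =>
          intro a ha
          have h3 : a < n := by omega
          have h4 := pr_step (fun i : Fin n => s i / s (i+1)) ⟨a, h3⟩ (b := n) h3
          simp only at h4
          rw [h4, ih (a+1) (by omega)]
          have := (hs2 (a+1)).ne'
          field_simp
      ext i
      rw [← hs1]
      exact key (n - i) i (by have := i.2; omega)

/-- Index sets. -/
def us {n : ℕ} (i : Fin n) : Finset (Fin n) := Finset.univ.filter fun l => (i:ℕ) ≤ l ∧ (l:ℕ) < n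

/-- The derivative of the substitution. -/
noncomputable def Tm' {n : ℕ} (x : Fin n → ℝ) : (Fin n → ℝ) →L[ℝ] (Fin n → ℝ) :=
  ContinuousLinearMap.pi fun i => ∑ l ∈ us i, (∏ j ∈ (us i).erase l, x j) • ContinuousLinearMap.proj (R := ℝ) l

lemma Tm_eq {n : ℕ} (x : Fin n → ℝ) (i : Fin n) : Tm x i = ∏ l ∈ us i, x l := by
  unfold Tm pr us
  rw [Finset.prod_filter]

lemma Tm_deriv {n : ℕ} (x : Fin n → ℝ) : HasFDerivAt Tm (Tm' x) x := by
  rw [hasFDerivAt_pi']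
  intro i
  have h := HasFDerivAt.finset_prod (u := us i) (g := fun l (x : Fin n → ℝ) => x l)
    (g' := fun l => ContinuousLinearMap.proj (R := ℝ) l) (x := x)
    (fun l _ => (ContinuousLinearMap.proj (R := ℝ) (φ := fun _ : Fin n => ℝ) l).hasFDerivAt)
  have h2 : (fun x : Fin n → ℝ => Tm x i) = fun x => ∏ l ∈ us i, x l := funext fun x => Tm_eq x i
  rw [h2]
  exact h

lemma Tm_det {n : ℕ} (x : Fin n → ℝ) : (Tm' x).det = ∏ i : Fin n, pr x (i+1) n := by
  have h1 : (Tm' x).det = (LinearMap.toMatrix' (Tm' x : (Fin n → ℝ) →ₗ[ℝ] (Fin n → ℝ))).det :=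
    (LinearMap.det_toMatrix' _).symm
  have hent : ∀ i j, LinearMap.toMatrix' (Tm' x : (Fin n → ℝ) →ₗ[ℝ] (Fin n → ℝ)) i j =
      if j ∈ us i then ∏ l ∈ (us i).erase j, x l else 0 := by
    intro i j
    rw [LinearMap.toMatrix'_apply]
    show (∑ l ∈ us i, (∏ j ∈ (us i).erase l, x j) • ContinuousLinearMap.proj (R := ℝ) l : (Fin n → ℝ) →L[ℝ] ℝ) _ = _
    rw [ContinuousLinearMap.sum_apply]
    simp [Pi.single_apply]
  rw [h1, Matrix.det_of_upperTriangular]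
  · refine Finset.prod_congr rfl fun i _ => ?_
    rw [hent, if_pos (by simp [us])]
    unfold pr
    rw [← Finset.prod_filter]
    refine Finset.prod_congr ?_ fun _ _ => rfl
    ext l
    simp only [us, Finset.mem_erase, Finset.mem_filter, Finset.mem_univ, true_and, ne_eq, Fin.ext_iff]
    omega
  · intro i j hij
    have hij' : (j:ℕ) < i := hij
    rw [hent, if_neg]
    simp only [us, Finset.mem_filter, Finset.mem_univ, true_and]
    omega

/-- Convergent integrals of products of integer powers of `tᵢ`, `1 - tᵢ` and `t_j - tᵢ`
over the open simplex `0 < t₁ < ⋯ < t_n < 1` are ℚ-linear combinations of `1` and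
multiple zeta values. -/
theorem stmt0 (n : ℕ) (hn : 1 ≤ n) (a b : Fin n → ℤ) (c : Fin n → Fin n → ℤ)
    (F : (Fin n → ℝ) → ℝ)
    (hF : ∀ t, F t =
      (∏ i, (t i) ^ (a i) * (1 - t i) ^ (b i)) /
        ∏ i, ∏ j ∈ Finset.univ.filter (fun j => i < j), (t j - t i) ^ (c i j))
    (hInt : IntegrableOn F (openSimplex n)) :
    (∫ t in openSimplex n, F t) ∈ Submodule.span ℚ (insert (1 : ℝ) mzvSet) := by
  rw [← mem_ZS]
  rw [← Tm_image] at hInt ⊢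
  have hder : ∀ x ∈ cube n, HasFDerivWithinAt Tm (Tm' x) (cube n) x := fun x _ => (Tm_deriv x).hasFDerivWithinAt
  rw [integral_image_eq_integral_abs_det_fderiv_smul volume (cube_meas n) hder (Tm_inj n)]
  rw [integrableOn_image_iff_integrableOn_abs_det_fderiv_smul volume (cube_meas n) hder (Tm_inj n)] at hInt
  set G : (Fin n → ℝ) → ℝ := fun x => (∏ i : Fin n, pr x (i+1) n) *
    ((∏ i : Fin n, (pr x i n) ^ (a i) * (1 - pr x i n) ^ (b i)) *
      (∏ i : Fin n, ∏ j ∈ Finset.univ.filter (fun j : Fin n => i < j), (pr x j n * (1 - pr x i j)) ^ (c i j))⁻¹) with hG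
  have hU : Un G := by
    refine (Un.prod _ _ fun i _ => Un.pr _ _).mul ((Un.prod _ _ fun i _ => ?_).mul (Un.inv ?_))
    · exact ((Un.pr _ _).zpow _).mul ((Un.one_sub _ _).zpow _)
    · exact Un.prod _ _ fun i _ => Un.prod _ _ fun j _ => ((Un.pr _ _).mul (Un.one_sub _ _)).zpow _
  refine cube_integral n _ _ hU.1 (fun q => ?_) hInt
  have hq : cq q ∈ cube n := mem_cube.2 fun i => (q i).2
  show |(Tm' (cq q)).det| • F (Tm (cq q)) = G (cq q)
  rw [Tm_det, abs_of_pos (Finset.prod_pos fun i _ => pr_pos hq _ _), smul_eq_mul, hF, hG, div_eq_mul_inv]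
  congr 3
  refine Finset.prod_congr rfl fun i _ => Finset.prod_congr rfl fun j hj => ?_
  have hij : i < j := (Finset.mem_filter.1 hj).2
  congr 1
  show pr (cq q) j n - pr (cq q) i n = _
  rw [pr_mul (cq q) (Fin.lt_def.1 hij).le j.2.le]
  ring
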